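/- arXiv:1309.1420 — 2 statements merged into one kernel-verified Lean document; each statement's English description precedes it below -/
import Mathlib

section
/- For the multi-dimensional market with solvency cones K_t whose dual cones K*_t have analytic graphs, the following are equivalent: (i) NA^s(𝒫) and efficient friction hold; (ii) for every P ∈ 𝒫 there exist Q ∈ 𝔓(Ω) and a Q-martingale Z in the filtration (𝓕_t) such that P ≪ Q, Q ≪ P' for some P' ∈ 𝒫, and Z_t ∈ int K*_t Q-a.s. for all t = 0,…,T. -/
open MeasureTheory Set
open scoped ENNReal Pointwise

noncomputable section

/-- The universal completion of the σ-algebra on `α`. -/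
def univComp (α : Type*) [MeasurableSpace α] : MeasurableSpace α where
  MeasurableSet' s := ∀ μ : Measure α, IsProbabilityMeasure μ → NullMeasurableSet s μ
  measurableSet_empty := fun _ _ => MeasurableSet.empty.nullMeasurableSet
  measurableSet_compl := fun _ hs μ hμ => (hs μ hμ).compl
  measurableSet_iUnion := fun _ hf μ hμ => NullMeasurableSet.iUnion fun i => hf i μ hμ

/-- A universally measurable set. -/
def UnivMeasurableSet {α : Type*} [MeasurableSpace α] (s : Set α) : Prop :=
  MeasurableSet[univComp α] s

/-- A universally measurable function. -/
def UnivMeasurable {α β : Type*} [MeasurableSpace α] [MeasurableSpace β] (f : α → β) : Prop :=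
  Measurable[univComp α] f

/-- Convexity for a set of probability measures. -/
def ConvexProb {α : Type*} [MeasurableSpace α] (𝒬 : Set (ProbabilityMeasure α)) : Prop :=
  ∀ P ∈ 𝒬, ∀ Q ∈ 𝒬, ∀ a b : ℝ≥0∞, a + b = 1 → ∀ R : ProbabilityMeasure α,
    (R : Measure α) = a • (P : Measure α) + b • (Q : Measure α) → R ∈ 𝒬

/-- The product measure `P₀ ⊗ ⋯ ⊗ P_{T-1}` of a family of one-step kernels. -/
def prodMeas {Ω₁ : Type*} [MeasurableSpace Ω₁]
    (P : (t : ℕ) → (Fin t → Ω₁) → Measure Ω₁) : (T : ℕ) → Measure (Fin T → Ω₁)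
  | 0 => Measure.dirac (fun i => i.elim0)
  | T + 1 => (prodMeas P T).bind fun ω => (P T ω).map (Fin.snoc ω)

/-- The set `𝒫` of all products of universally measurable selectors of the `𝒫ₜ`. -/
def ProdSet {Ω₁ : Type*} [MeasurableSpace Ω₁]
    (𝒬 : (t : ℕ) → (Fin t → Ω₁) → Set (ProbabilityMeasure Ω₁)) (T : ℕ) :
    Set (Measure (Fin T → Ω₁)) :=
  {μ | ∃ P : (t : ℕ) → (Fin t → Ω₁) → ProbabilityMeasure Ω₁,
      (∀ t, t < T → UnivMeasurable (fun ω => (P t ω : Measure Ω₁)) ∧ ∀ ω, P t ω ∈ 𝒬 t ω) ∧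
      μ = prodMeas (fun t ω => (P t ω : Measure Ω₁)) T}

/-- Projection onto the first `t` coordinates. -/
def proj {Ω₁ : Type*} (T t : ℕ) (ht : t ≤ T) (ω : Fin T → Ω₁) : Fin t → Ω₁ :=
  fun i => ω (Fin.castLE ht i)

/-- The σ-algebra `𝓕ₜ` on `Ω = Ω₁^T`: the pullback under the projection onto the first `t`
coordinates of the universal completion of the Borel σ-algebra of `Ω₁^t`. -/
def filt {Ω₁ : Type*} [MeasurableSpace Ω₁] (T t : ℕ) (ht : t ≤ T) :
    MeasurableSpace (Fin T → Ω₁) :=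
  MeasurableSpace.comap (proj T t ht) (univComp (Fin t → Ω₁))

/-- The dual cone of a set in `ℝ^d`. -/
def dualCone {d : ℕ} (C : Set (Fin d → ℝ)) : Set (Fin d → ℝ) :=
  {y | ∀ x ∈ C, 0 ≤ ∑ i, x i * y i}

/-- `f ∈ Aₜ`: attainable claims at time `t` from zero endowment, i.e. `f = ξ₀ + ⋯ + ξₜ`
with each `ξₛ` an `𝓕ₛ`-measurable function with values in `−Cₛ`. -/
def Attainable {Ω₁ : Type*} [MeasurableSpace Ω₁] {d : ℕ}
    (C : (s : ℕ) → (Fin s → Ω₁) → Set (Fin d → ℝ)) (t : ℕ)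
    (f : (Fin t → Ω₁) → Fin d → ℝ) : Prop :=
  ∃ ξ : ℕ → (Fin t → Ω₁) → Fin d → ℝ,
    (∀ s, ∀ hs : s ≤ t, ∃ g : (Fin s → Ω₁) → Fin d → ℝ, UnivMeasurable g ∧
      (∀ ωs, g ωs ∈ -C s ωs) ∧ ∀ ω, ξ s ω = g fun i => ω (Fin.castLE hs i)) ∧
    ∀ ω, f ω = ∑ s ∈ Finset.range (t + 1), ξ s ω

/-- Strict no-arbitrage `NAˢ(𝒫)` for the market with solvency cones `C`:
`Aₜ ∩ L⁰_𝒫(Cₜ; 𝓕ₜ) ⊆ L⁰_𝒫(C⁰ₜ; 𝓕ₜ)` for all `t ∈ {0, …, T}`. -/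
def StrictNoArbitrage {Ω₁ : Type*} [MeasurableSpace Ω₁] {d : ℕ}
    (𝒬 : (t : ℕ) → (Fin t → Ω₁) → Set (ProbabilityMeasure Ω₁))
    (C : (s : ℕ) → (Fin s → Ω₁) → Set (Fin d → ℝ)) (T : ℕ) : Prop :=
  ∀ t, t ≤ T → ∀ f : (Fin t → Ω₁) → Fin d → ℝ, Attainable C t f → UnivMeasurable f →
    (∀ μ ∈ ProdSet 𝒬 t, ∀ᵐ ω ∂μ, f ω ∈ C t ω) →
    (∀ μ ∈ ProdSet 𝒬 t, ∀ᵐ ω ∂μ, f ω ∈ C t ω ∩ -C t ω)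

/-- Efficient friction: `int C*ₜ ≠ ∅` `𝒫`-q.s. for all `t`. -/
def EfficientFriction {Ω₁ : Type*} [MeasurableSpace Ω₁] {d : ℕ}
    (𝒬 : (t : ℕ) → (Fin t → Ω₁) → Set (ProbabilityMeasure Ω₁))
    (C : (s : ℕ) → (Fin s → Ω₁) → Set (Fin d → ℝ)) (T : ℕ) : Prop :=
  ∀ t, t ≤ T → ∀ μ ∈ ProdSet 𝒬 t, ∀ᵐ ω ∂μ, (interior (dualCone (C t ω))).Nonempty

/-- `NA₂(𝒫)`: `L⁰_𝒫(Cₜ₊₁; 𝓕ₜ) ⊆ L⁰_𝒫(Cₜ; 𝓕ₜ)` for all `t`. -/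
def NoArbitrage2 {Ω₁ : Type*} [MeasurableSpace Ω₁] {d : ℕ}
    (𝒬 : (t : ℕ) → (Fin t → Ω₁) → Set (ProbabilityMeasure Ω₁))
    (C : (s : ℕ) → (Fin s → Ω₁) → Set (Fin d → ℝ)) (T : ℕ) : Prop :=
  ∀ t, t < T → ∀ f : (Fin t → Ω₁) → Fin d → ℝ, UnivMeasurable f →
    (∀ μ ∈ ProdSet 𝒬 (t + 1), ∀ᵐ ω ∂μ, f (Fin.init ω) ∈ C (t + 1) ω) →
    (∀ μ ∈ ProdSet 𝒬 t, ∀ᵐ ω ∂μ, f ω ∈ C t ω)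

/-! ### Universally measurable sets and functions -/

section UnivMeasurable

variable {X Y Z : Type*} [MeasurableSpace X] [MeasurableSpace Y] [MeasurableSpace Z]

theorem le_univComp : ‹MeasurableSpace X› ≤ univComp X :=
  fun _ hs _ _ => hs.nullMeasurableSet

theorem MeasurableSet.univMeasurableSet {s : Set X} (hs : MeasurableSet s) :
    UnivMeasurableSet s := le_univComp s hs

theorem Measurable.univMeasurable {f : X → Y} (hf : Measurable f) : UnivMeasurable f :=
  hf.mono le_univComp le_rfl

theorem UnivMeasurable.aemeasurable [MeasurableSpace.CountablyGenerated Y] {f : X → Y}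
    (hf : UnivMeasurable f) (μ : Measure X) [IsProbabilityMeasure μ] : AEMeasurable f μ :=
  NullMeasurable.aemeasurable fun _ hs => hf hs μ inferInstance

theorem univMeasurable_of_aemeasurable {f : X → Y}
    (hf : ∀ μ : Measure X, IsProbabilityMeasure μ → AEMeasurable f μ) : UnivMeasurable f :=
  fun _ hs μ hμ => (hf μ hμ).nullMeasurable hs

theorem UnivMeasurable.preimage [MeasurableSpace.CountablyGenerated Y] {f : X → Y}
    (hf : UnivMeasurable f) {s : Set Y} (hs : UnivMeasurableSet s) :
    UnivMeasurableSet (f ⁻¹' s) := by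
  intro μ hμ
  have hf' := hf.aemeasurable μ
  have : IsProbabilityMeasure (μ.map f) := Measure.isProbabilityMeasure_map hf'
  have h1 : NullMeasurableSet (hf'.mk f ⁻¹' s) μ := by
    have h2 := hs (μ.map f) this
    rw [Measure.map_congr hf'.ae_eq_mk] at h2
    exact h2.preimage (hf'.measurable_mk.quasiMeasurePreserving μ)
  refine h1.congr ?_
  filter_upwards [hf'.ae_eq_mk] with x hx
  exact propext (by change hf'.mk f x ∈ s ↔ f x ∈ s; rw [hx])

theorem UnivMeasurable.comp [MeasurableSpace.CountablyGenerated Y] {g : Y → Z} {f : X → Y}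
    (hg : UnivMeasurable g) (hf : UnivMeasurable f) : UnivMeasurable (g ∘ f) :=
  fun _ hs => hf.preimage (hg hs)

theorem Measurable.comp_univMeasurable {g : Y → Z} {f : X → Y}
    (hg : Measurable g) (hf : UnivMeasurable f) : UnivMeasurable (g ∘ f) :=
  Measurable.comp hg hf

theorem UnivMeasurable.comp_measurable {g : Y → Z} {f : X → Y}
    (hg : UnivMeasurable g) (hf : Measurable f) : UnivMeasurable (g ∘ f) := by
  intro s hs μ hμ
  have : IsProbabilityMeasure (μ.map f) := Measure.isProbabilityMeasure_map hf.aemeasurable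
  exact (hg hs (μ.map f) this).preimage (hf.quasiMeasurePreserving μ)

theorem UnivMeasurableSet.preimage_measurable {s : Set Y} (hs : UnivMeasurableSet s) {f : X → Y}
    (hf : Measurable f) : UnivMeasurableSet (f ⁻¹' s) := by
  intro μ hμ
  have : IsProbabilityMeasure (μ.map f) := Measure.isProbabilityMeasure_map hf.aemeasurable
  exact (hs (μ.map f) this).preimage (hf.quasiMeasurePreserving μ)

/-- Gluing countably many universally measurable functions along a universally measurable index. -/
theorem UnivMeasurable.glue {ι : Type*} [Countable ι] {F : X → ι}
    (hF : ∀ i, UnivMeasurableSet {x | F x = i}) {f : ι → X → Y}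
    (hf : ∀ i, UnivMeasurable (f i)) : UnivMeasurable fun x => f (F x) x := by
  intro s hs
  have h : (fun x => f (F x) x) ⁻¹' s = ⋃ i, {x | F x = i} ∩ f i ⁻¹' s := by
    ext x; simp
  rw [h]
  exact MeasurableSet.iUnion fun i => (hF i).inter (hf i hs)

theorem UnivMeasurable.ite' {s : Set X} (hs : UnivMeasurableSet s) {f g : X → Y}
    (hf : UnivMeasurable f) (hg : UnivMeasurable g) [DecidablePred (· ∈ s)] :
    UnivMeasurable fun x => if x ∈ s then f x else g x :=
  Measurable.ite (m := univComp X) hs hf hg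

/-- First index satisfying a predicate. -/
theorem exists_univMeasurable_index {ι : Type*} [Countable ι] [Nonempty ι] (G : ι → Set X)
    (hG : ∀ i, UnivMeasurableSet (G i)) :
    ∃ F : X → ι, (∀ i, UnivMeasurableSet {x | F x = i}) ∧ ∀ x, (∃ i, x ∈ G i) → x ∈ G (F x) := by
  classical
  obtain ⟨e, he⟩ := exists_surjective_nat ι
  let N : X → ℕ := fun x => if h : ∃ n, x ∈ G (e n) then Nat.find h else 0
  have hN : ∀ n, UnivMeasurableSet {x | N x = n} := by
    intro n
    have hU : UnivMeasurableSet {x | ∃ n, x ∈ G (e n)} := by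
      have : {x | ∃ n, x ∈ G (e n)} = ⋃ n, G (e n) := by ext; simp
      rw [this]; exact MeasurableSet.iUnion fun n => hG _
    have h1 : {x | N x = n} = ({x | ∃ n, x ∈ G (e n)} ∩ (G (e n) ∩ ⋂ m, ⋂ (_ : m < n), (G (e m))ᶜ))
        ∪ ({x | ∃ n, x ∈ G (e n)}ᶜ ∩ {_x | n = 0}) := by
      ext x
      by_cases h : ∃ n, x ∈ G (e n)
      · have : N x = Nat.find h := dif_pos h
        simp only [mem_ofPred_eq, this, Nat.find_eq_iff, mem_union, mem_inter_iff, mem_iInter,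
          mem_compl_iff, h, true_and, not_true, false_and, or_false]
      · have : N x = 0 := dif_neg h
        simp only [mem_ofPred_eq, this, mem_union, mem_inter_iff, mem_compl_iff, h, false_and,
          not_false_eq_true, true_and, false_or]
        exact eq_comm
    rw [h1]
    refine (hU.inter ((hG _).inter ?_)).union (hU.compl.inter (MeasurableSet.const _))
    exact MeasurableSet.iInter fun m => MeasurableSet.iInter fun _ => (hG _).compl
  refine ⟨fun x => e (N x), fun i => ?_, fun x hx => ?_⟩
  · have : {x | e (N x) = i} = ⋃ n, ⋃ (_ : e n = i), {x | N x = n} := by ext x; simp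
    rw [this]
    exact MeasurableSet.iUnion fun n => MeasurableSet.iUnion fun _ => hN n
  · have h : ∃ n, x ∈ G (e n) := by
      obtain ⟨i, hi⟩ := hx
      obtain ⟨n, rfl⟩ := he i
      exact ⟨n, hi⟩
    have : N x = Nat.find h := dif_pos h
    change x ∈ G (e (N x))
    rw [this]
    exact Nat.find_spec h

end UnivMeasurable

/-! ### Universally measurable kernels -/

section Kernel

variable {X Y Z : Type*} [MeasurableSpace X] [MeasurableSpace Y] [MeasurableSpace Z]

theorem exists_countable_piSystem (Y : Type*) [m : MeasurableSpace Y]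
    [MeasurableSpace.CountablyGenerated Y] :
    ∃ S : Set (Set Y), S.Countable ∧ IsPiSystem S ∧ m = MeasurableSpace.generateFrom S := by
  let A := MeasurableSpace.natGeneratingSequence Y
  have hA : MeasurableSpace.generateFrom (range A) = m :=
    MeasurableSpace.generateFrom_natGeneratingSequence Y
  refine ⟨range fun F : Finset ℕ => ⋂ n ∈ F, A n, countable_range _, ?_, le_antisymm ?_ ?_⟩
  · classical
    rintro _ ⟨F, rfl⟩ _ ⟨G, rfl⟩ _
    exact ⟨F ∪ G, by simp only [Finset.mem_union, iInter_or, iInter_inter_distrib]⟩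
  · conv_lhs => rw [← hA]
    refine MeasurableSpace.generateFrom_mono ?_
    rintro _ ⟨n, rfl⟩
    exact ⟨{n}, by simp⟩
  · refine MeasurableSpace.generateFrom_le ?_
    rintro _ ⟨F, rfl⟩
    refine F.measurableSet_biInter fun n _ => ?_
    rw [← hA]
    exact MeasurableSpace.measurableSet_generateFrom ⟨n, rfl⟩

/-- Universal measurability of a family of probability measures. -/
theorem univMeasurable_kernel_of_apply {κ : X → ProbabilityMeasure Y}
    (h : ∀ s, MeasurableSet s → UnivMeasurable fun x => (κ x : Measure Y) s) :
    UnivMeasurable fun x => (κ x : Measure Y) :=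
  @Measure.measurable_of_measurable_coe Y X _ (univComp X) _ h

theorem UnivMeasurable.kernel_apply {κ : X → ProbabilityMeasure Y}
    (h : UnivMeasurable fun x => (κ x : Measure Y)) {s : Set Y} (hs : MeasurableSet s) :
    UnivMeasurable fun x => (κ x : Measure Y) s :=
  (Measure.measurable_coe hs).comp_univMeasurable h

theorem UnivMeasurable.exists_kernel_ae_eq [MeasurableSpace.CountablyGenerated Y]
    {κ : X → ProbabilityMeasure Y}
    (h : UnivMeasurable fun x => (κ x : Measure Y)) (μ : Measure X) [IsProbabilityMeasure μ] :
    ∃ κ' : X → ProbabilityMeasure Y, Measurable (fun x => (κ' x : Measure Y)) ∧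
      ∀ᵐ x ∂μ, κ x = κ' x := by
  classical
  obtain ⟨S, hSc, hSpi, hSgen⟩ := exists_countable_piSystem Y
  obtain ⟨x₀⟩ : Nonempty X := nonempty_of_isProbabilityMeasure μ
  have hS : ∀ s ∈ S, MeasurableSet s := fun s hs => by
    rw [hSgen]; exact MeasurableSpace.measurableSet_generateFrom hs
  have hae : ∀ s ∈ S, AEMeasurable (fun x => (κ x : Measure Y) s) μ :=
    fun s hs => (h.kernel_apply (hS s hs)).aemeasurable μ
  have hall : ∀ᵐ x ∂μ, ∀ s (hs : s ∈ S), (κ x : Measure Y) s = (hae s hs).mk _ x :=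
    (ae_ball_iff hSc).2 fun s hs => (hae s hs).ae_eq_mk
  let N := toMeasurable μ {x | ¬ ∀ s (hs : s ∈ S), (κ x : Measure Y) s = (hae s hs).mk _ x}
  have hN : MeasurableSet N := measurableSet_toMeasurable _ _
  have hN0 : μ N = 0 := by rw [measure_toMeasurable]; exact hall
  refine ⟨fun x => if x ∈ N then κ x₀ else κ x, ?_, ?_⟩
  · refine Measurable.measure_of_isPiSystem_of_isProbabilityMeasure hSgen hSpi fun s hs => ?_
    have : (fun x => ((if x ∈ N then κ x₀ else κ x : ProbabilityMeasure Y) : Measure Y) s) =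
        fun x => if x ∈ N then (κ x₀ : Measure Y) s else (hae s hs).mk _ x := by
      funext x
      split_ifs with hx
      · rfl
      · by_contra hne
        exact hx (subset_toMeasurable _ _ fun hh => hne (hh s hs))
    rw [this]
    exact Measurable.ite hN measurable_const (hae s hs).measurable_mk
  · have : ∀ᵐ x ∂μ, x ∉ N := measure_eq_zero_iff_ae_notMem.1 hN0
    filter_upwards [this] with x hx
    rw [if_neg hx]

theorem measurable_map_kernel {κ : X → ProbabilityMeasure Y}
    (h : Measurable fun x => (κ x : Measure Y)) {e : X → Y → Z}
    (he : Measurable (Function.uncurry e)) :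
    Measurable fun x => (κ x : Measure Y).map (e x) := by
  let k : ProbabilityTheory.Kernel X Y := ⟨fun x => (κ x : Measure Y), h⟩
  have : ProbabilityTheory.IsMarkovKernel k :=
    ⟨fun x => inferInstanceAs (IsProbabilityMeasure (κ x : Measure Y))⟩
  refine Measure.measurable_of_measurable_coe _ fun s hs => ?_
  have h1 := ProbabilityTheory.Kernel.measurable_kernel_prodMk_left (κ := k) (he hs)
  convert h1 using 2 with x
  exact Measure.map_apply (he.comp measurable_prodMk_left) hs

variable [MeasurableSpace.CountablyGenerated Y] {κ : X → ProbabilityMeasure Y} {e : X → Y → Z}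

theorem UnivMeasurable.aemeasurable_map_kernel (h : UnivMeasurable fun x => (κ x : Measure Y))
    (he : Measurable (Function.uncurry e)) (μ : Measure X) [IsProbabilityMeasure μ] :
    AEMeasurable (fun x => (κ x : Measure Y).map (e x)) μ := by
  obtain ⟨κ', hκ', hae⟩ := h.exists_kernel_ae_eq μ
  refine ⟨_, measurable_map_kernel hκ' he, ?_⟩
  filter_upwards [hae] with x hx
  rw [hx]

theorem UnivMeasurable.isProbabilityMeasure_bind (h : UnivMeasurable fun x => (κ x : Measure Y))
    (he : Measurable (Function.uncurry e)) (μ : Measure X) [IsProbabilityMeasure μ] :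
    IsProbabilityMeasure (μ.bind fun x => (κ x : Measure Y).map (e x)) := by
  constructor
  rw [Measure.bind_apply MeasurableSet.univ (h.aemeasurable_map_kernel he μ)]
  have : ∀ x, (κ x : Measure Y).map (e x) univ = 1 := fun x => by
    have hex : Measurable (e x) := he.comp measurable_prodMk_left
    rw [Measure.map_apply hex MeasurableSet.univ]
    simp
  simp [this]

theorem UnivMeasurable.ae_ae_of_ae_bind (h : UnivMeasurable fun x => (κ x : Measure Y))
    (he : Measurable (Function.uncurry e)) {μ : Measure X} [IsProbabilityMeasure μ] {p : Z → Prop}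
    (hp : ∀ᵐ z ∂(μ.bind fun x => (κ x : Measure Y).map (e x)), p z) :
    ∀ᵐ x ∂μ, ∀ᵐ y ∂(κ x : Measure Y), p (e x y) := by
  filter_upwards [Measure.ae_ae_of_ae_bind (h.aemeasurable_map_kernel he μ) hp] with x hx
  exact ae_of_ae_map (he.comp measurable_prodMk_left).aemeasurable hx

theorem UnivMeasurable.lintegral_bind (h : UnivMeasurable fun x => (κ x : Measure Y))
    (he : Measurable (Function.uncurry e)) (μ : Measure X) [IsProbabilityMeasure μ]
    {f : Z → ℝ≥0∞} (hf : UnivMeasurable f) :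
    ∫⁻ z, f z ∂(μ.bind fun x => (κ x : Measure Y).map (e x)) =
      ∫⁻ x, ∫⁻ y, f (e x y) ∂(κ x : Measure Y) ∂μ := by
  have := h.isProbabilityMeasure_bind he μ
  rw [Measure.lintegral_bind (h.aemeasurable_map_kernel he μ) (hf.aemeasurable _)]
  refine lintegral_congr fun x => ?_
  have hex : Measurable (e x) := he.comp measurable_prodMk_left
  have := Measure.isProbabilityMeasure_map (μ := (κ x : Measure Y)) hex.aemeasurable
  exact lintegral_map' (hf.aemeasurable _) hex.aemeasurable

theorem UnivMeasurable.lintegral_kernel (h : UnivMeasurable fun x => (κ x : Measure Y))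
    (he : Measurable (Function.uncurry e)) {f : Z → ℝ≥0∞} (hf : UnivMeasurable f) :
    UnivMeasurable fun x => ∫⁻ y, f (e x y) ∂(κ x : Measure Y) := by
  refine univMeasurable_of_aemeasurable fun μ hμ => ?_
  have := h.isProbabilityMeasure_bind he μ
  have hf' := hf.aemeasurable (μ.bind fun x => (κ x : Measure Y).map (e x))
  obtain ⟨κ', hκ', hae⟩ := h.exists_kernel_ae_eq μ
  have hm := (Measure.measurable_lintegral hf'.measurable_mk).comp (measurable_map_kernel hκ' he)
  refine ⟨_, hm, ?_⟩
  filter_upwards [hae, h.ae_ae_of_ae_bind he hf'.ae_eq_mk] with x hx hx'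
  have hex : Measurable (e x) := he.comp measurable_prodMk_left
  rw [lintegral_congr_ae hx', Function.comp_apply, lintegral_map hf'.measurable_mk hex, hx]

theorem UnivMeasurable.kernel_section (h : UnivMeasurable fun x => (κ x : Measure Y))
    (he : Measurable (Function.uncurry e)) {s : Set Z} (hs : UnivMeasurableSet s) :
    UnivMeasurable fun x => (κ x : Measure Y) {y | e x y ∈ s} := by
  have hf : UnivMeasurable (s.indicator (fun _ => (1 : ℝ≥0∞))) :=
    Measurable.indicator (m := univComp Z) measurable_const hs
  convert h.lintegral_kernel he hf using 2 with x
  have h1 : NullMeasurableSet {y | e x y ∈ s} (κ x : Measure Y) :=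
    hs.preimage_measurable (f := e x) (he.comp measurable_prodMk_left) _ inferInstance
  rw [← lintegral_indicator_one₀ h1]
  rfl

theorem UnivMeasurable.ae_bind_iff (h : UnivMeasurable fun x => (κ x : Measure Y))
    (he : Measurable (Function.uncurry e)) {μ : Measure X} [IsProbabilityMeasure μ] {s : Set Z}
    (hs : UnivMeasurableSet s) :
    (∀ᵐ z ∂(μ.bind fun x => (κ x : Measure Y).map (e x)), z ∈ s) ↔
    ∀ᵐ x ∂μ, ∀ᵐ y ∂(κ x : Measure Y), e x y ∈ s := by
  refine ⟨h.ae_ae_of_ae_bind he, fun hae => ?_⟩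
  have := h.isProbabilityMeasure_bind he μ
  have hf : UnivMeasurable (sᶜ.indicator (fun _ => (1 : ℝ≥0∞))) :=
    Measurable.indicator (m := univComp Z) measurable_const hs.compl
  have h1 := h.lintegral_bind he μ hf
  have h2 : NullMeasurableSet sᶜ (μ.bind fun x => (κ x : Measure Y).map (e x)) :=
    hs.compl _ inferInstance
  change ∫⁻ z, sᶜ.indicator 1 z ∂_ = _ at h1
  rw [lintegral_indicator_one₀ h2] at h1
  rw [ae_iff]
  change (μ.bind fun x => (κ x : Measure Y).map (e x)) sᶜ = 0
  rw [h1, lintegral_eq_zero_iff' ((h.lintegral_kernel he hf).aemeasurable μ)]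
  filter_upwards [hae] with x hx
  have : (fun y => sᶜ.indicator (fun _ => (1 : ℝ≥0∞)) (e x y)) =ᵐ[(κ x : Measure Y)] 0 := by
    filter_upwards [hx] with y hy
    simp [hy]
  rw [lintegral_congr_ae this]
  simp

end Kernel

/-! ### Analytic sets -/

section Analytic

/-- The compact box of sequences whose first `n` terms are bounded by those of `α`. -/
def seqBox (α : ℕ → ℕ) (n : ℕ) : Set (ℕ → ℕ) := {β | ∀ i < n, β i ≤ α i}

theorem seqBox_congr {α β : ℕ → ℕ} {n : ℕ} (h : ∀ i < n, α i = β i) : seqBox α n = seqBox β n := by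
  ext γ
  exact forall₂_congr fun i hi => by rw [h i hi]

theorem seqBox_antitone (α : ℕ → ℕ) : Antitone (seqBox α) :=
  fun _ _ hmn _ hβ i hi => hβ i (hi.trans_le hmn)

theorem iInter_closure_image_seqBox_subset {X : Type*} [TopologicalSpace X] [T2Space X]
    {f : (ℕ → ℕ) → X} (hf : Continuous f) (α : ℕ → ℕ) :
    ⋂ n, closure (f '' seqBox α n) ⊆ range f := by
  intro x hx
  by_contra hxf
  let C : Set (ℕ → ℕ) := {β | ∀ i, β i ≤ α i}
  have hC : IsCompact C := by
    have : C = Set.pi univ fun i => Set.Iic (α i) := by ext; simp [C, Pi.le_def]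
    rw [this]
    exact isCompact_univ_pi fun i => (Set.finite_Iic (α i)).isCompact
  have hd : Disjoint (f '' C) {x} := by
    rw [Set.disjoint_singleton_right]
    rintro ⟨β, -, rfl⟩
    exact hxf ⟨β, rfl⟩
  obtain ⟨U, V, hU, hV, hCU, hxV, hUV⟩ :=
    SeparatedNhds.of_isCompact_isCompact (hC.image hf) isCompact_singleton hd
  have hxV' : x ∈ V := hxV rfl
  have hex : ∀ n, ∃ β, β ∈ seqBox α n ∧ f β ∈ V := fun n => by
    have := mem_iInter.1 hx n
    obtain ⟨y, hyV, β, hβ, rfl⟩ := mem_closure_iff.1 this V hV hxV'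
    exact ⟨β, hβ, hyV⟩
  choose β hβ hβV using hex
  let γ : ℕ → ℕ → ℕ := fun n i => min (β n i) (α i)
  have hγ : ∀ n, γ n ∈ C := fun n i => min_le_right _ _
  obtain ⟨c, hcC, φ, hφ, hlim⟩ := hC.tendsto_subseq hγ
  have hlim' : Filter.Tendsto (β ∘ φ) Filter.atTop (nhds c) := by
    rw [tendsto_pi_nhds] at hlim ⊢
    intro i
    refine (hlim i).congr' ?_
    filter_upwards [Filter.eventually_gt_atTop i] with n hn
    have : i < φ n := hn.trans_le (hφ.id_le n)
    simp only [γ, Function.comp_apply]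
    exact min_eq_left (hβ _ i this)
  have hfc : f c ∈ U := hCU ⟨c, hcC, rfl⟩
  have h1 := (hf.tendsto c).comp hlim'
  obtain ⟨n, hn⟩ := (h1.eventually (hU.mem_nhds hfc)).exists
  exact Set.disjoint_left.1 hUV hn (hβV _)

theorem exists_lt_measure_image_seqBox {X : Type*} [MeasurableSpace X] (f : (ℕ → ℕ) → X)
    (μ : Measure X) {r : ℝ≥0∞} (hr : r < μ (range f)) :
    ∃ α : ℕ → ℕ, ∀ n, r < μ (f '' seqBox α n) := by
  have step : ∀ (n : ℕ) (α : ℕ → ℕ), r < μ (f '' seqBox α n) →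
      ∃ α', r < μ (f '' seqBox α' (n + 1)) ∧ ∀ i < n, α' i = α i := by
    intro n α h
    let g : ℕ → Set X := fun k => f '' seqBox (Function.update α n k) (n + 1)
    have hg : Monotone g := by
      intro k l hkl
      refine image_mono fun β hβ i hi => (hβ i hi).trans ?_
      by_cases hin : i = n
      · subst hin; simpa using hkl
      · simp [hin]
    have hU : f '' seqBox α n ⊆ ⋃ k, g k := by
      rintro _ ⟨β, hβ, rfl⟩
      refine mem_iUnion.2 ⟨β n, β, fun i hi => ?_, rfl⟩
      by_cases hin : i = n
      · subst hin; simp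
      · simpa [hin] using hβ i (by omega)
    have h1 : r < μ (⋃ k, g k) := h.trans_le (measure_mono hU)
    rw [hg.measure_iUnion] at h1
    obtain ⟨k, hk⟩ := lt_iSup_iff.1 h1
    exact ⟨_, hk, fun i hi => by simp [hi.ne]⟩
  choose! nx hnx hnx' using step
  let A : ℕ → ℕ → ℕ := fun n => Nat.rec (fun _ => 0) (fun n α => nx n α) n
  have hA : ∀ n, r < μ (f '' seqBox (A n) n) := by
    intro n
    induction n with
    | zero => simpa [seqBox] using hr
    | succ n ih => exact hnx n (A n) ih
  have hA' : ∀ n i, i < n → A n i = A (i + 1) i := by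
    intro n
    induction n with
    | zero => intro i hi; omega
    | succ n ih =>
      intro i hi
      rcases Nat.lt_succ_iff_lt_or_eq.1 hi with h | rfl
      · rw [← ih i h]; exact hnx' n (A n) (hA n) i h
      · rfl
  refine ⟨fun i => A (i + 1) i, fun n => ?_⟩
  rw [seqBox_congr (β := A n) fun i hi => (hA' n i hi).symm]
  exact hA n

theorem exists_le_measure_iInter_closure {X : Type*} [TopologicalSpace X] [MeasurableSpace X]
    [OpensMeasurableSpace X] (f : (ℕ → ℕ) → X) (μ : Measure X) [IsFiniteMeasure μ] {r : ℝ≥0∞}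
    (hr : r < μ (range f)) : ∃ α : ℕ → ℕ, r ≤ μ (⋂ n, closure (f '' seqBox α n)) := by
  obtain ⟨α, hα⟩ := exists_lt_measure_image_seqBox f μ hr
  refine ⟨α, ?_⟩
  rw [Antitone.measure_iInter]
  · exact le_iInf fun n => (hα n).le.trans (measure_mono subset_closure)
  · exact fun m n h => closure_mono (image_mono (seqBox_antitone α h))
  · exact fun n => isClosed_closure.measurableSet.nullMeasurableSet
  · exact ⟨0, measure_ne_top _ _⟩

theorem MeasureTheory.AnalyticSet.univMeasurableSet {X : Type*} [TopologicalSpace X] [T2Space X]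
    [MeasurableSpace X] [OpensMeasurableSpace X] {A : Set X} (hA : AnalyticSet A) :
    UnivMeasurableSet A := by
  intro μ hμ
  rw [AnalyticSet] at hA
  rcases hA with rfl | ⟨f, hf, rfl⟩
  · exact MeasurableSet.empty.nullMeasurableSet
  rcases eq_or_ne (μ (range f)) 0 with h0 | h0
  · exact NullMeasurableSet.of_null h0
  obtain ⟨r, -, hr, hlim⟩ := exists_seq_strictMono_tendsto' (pos_iff_ne_zero.2 h0)
  choose α hα using fun n => exists_le_measure_iInter_closure f μ (hr n).2
  let B : Set X := ⋃ k, ⋂ n, closure (f '' seqBox (α k) n)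
  have hB : MeasurableSet B :=
    MeasurableSet.iUnion fun k => MeasurableSet.iInter fun n => isClosed_closure.measurableSet
  have hBf : B ⊆ range f := iUnion_subset fun k => iInter_closure_image_seqBox_subset hf _
  have hle : μ (range f) ≤ μ B :=
    le_of_tendsto' hlim fun k => (hα k).trans (measure_mono (subset_iUnion_of_subset k subset_rfl))
  exact hB.nullMeasurableSet.congr
    (ae_eq_of_subset_of_measure_ge hBf hle hB.nullMeasurableSet (measure_ne_top _ _))

theorem Continuous.measurable_coe_probabilityMeasure {X Y : Type*} [TopologicalSpace X]
    [MeasurableSpace X] [OpensMeasurableSpace X] [TopologicalSpace Y] [HasOuterApproxClosed Y]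
    [MeasurableSpace Y] [BorelSpace Y] {ψ : X → ProbabilityMeasure Y} (hψ : Continuous ψ) :
    Measurable fun x => (ψ x : Measure Y) := by
  refine Measurable.measure_of_isPiSystem_of_isProbabilityMeasure
    (S := {F : Set Y | IsClosed F}) ?_ isPiSystem_isClosed ?_
  · rw [BorelSpace.measurable_eq (α := Y), borel_eq_generateFrom_isClosed]
  intro F hF
  have hF' : IsClosed F := hF
  refine measurable_of_tendsto_metrizable
    (f := fun n x => ∫⁻ y, hF'.apprSeq n y ∂(ψ x : Measure Y)) (fun n => ?_) ?_
  · exact ((ProbabilityMeasure.continuous_lintegral_boundedContinuousFunction _).comp hψ).measurable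
  · rw [tendsto_pi_nhds]
    exact fun x => HasOuterApproxClosed.tendsto_lintegral_apprSeq hF' _

end Analytic

section Selection

theorem measurableSet_mem_closure_image_seqBox {Z : Type*} [TopologicalSpace Z] [MeasurableSpace Z]
    [OpensMeasurableSpace Z] (f : (ℕ → ℕ) → Z) (n : ℕ) :
    MeasurableSet {p : Z × (ℕ → ℕ) | p.1 ∈ closure (f '' seqBox p.2 n)} := by
  have h : {p : Z × (ℕ → ℕ) | p.1 ∈ closure (f '' seqBox p.2 n)} =
      ⋃ l : Fin n → ℕ, closure (f '' {β | ∀ i : Fin n, β i ≤ l i}) ×ˢ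
        {α : ℕ → ℕ | (fun i : Fin n => α i) = l} := by
    ext ⟨z, α⟩
    have h1 : ∀ l : Fin n → ℕ, (fun i : Fin n => α i) = l →
        {β : ℕ → ℕ | ∀ i : Fin n, β i ≤ l i} = seqBox α n := by
      rintro _ rfl
      ext β
      exact ⟨fun h i hi => h ⟨i, hi⟩, fun h i => h i i.2⟩
    simp only [mem_iUnion, mem_prod, Set.mem_ofPred_eq]
    constructor
    · intro hz
      exact ⟨_, by rw [h1 _ rfl]; exact hz, rfl⟩
    · rintro ⟨l, hz, hl⟩
      rwa [h1 l hl] at hz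
  rw [h]
  refine MeasurableSet.iUnion fun l => isClosed_closure.measurableSet.prod ?_
  have : Measurable fun α : ℕ → ℕ => fun i : Fin n => α i :=
    measurable_pi_lambda _ fun i => measurable_pi_apply _
  exact this (MeasurableSet.singleton l)

/-- Positivity of the measure of an analytic section is an analytic condition. -/
theorem MeasureTheory.AnalyticSet.setOf_section_ne_zero {X Y Z : Type*} [TopologicalSpace X]
    [TopologicalSpace Y] [PolishSpace Y] [MeasurableSpace Y] [BorelSpace Y]
    [TopologicalSpace Z] [T2Space Z] [MeasurableSpace Z] [BorelSpace Z]
    {e : X → Y → Z} (he : Continuous (Function.uncurry e))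
    {G : Set (X × ProbabilityMeasure Y)} (hG : AnalyticSet G) {A : Set Z} (hA : AnalyticSet A) :
    AnalyticSet {p : X × ProbabilityMeasure Y |
      p ∈ G ∧ (p.2 : Measure Y) {y | e p.1 y ∈ A} ≠ 0} := by
  rw [AnalyticSet] at hG hA
  rcases hA with rfl | ⟨f, hf, rfl⟩
  · simpa using analyticSet_empty
  rcases hG with rfl | ⟨ψ, hψ, rfl⟩
  · simpa using analyticSet_empty
  let C : (ℕ → ℕ) → Set Z := fun α => ⋂ n, closure (f '' seqBox α n)
  let D : Set ((ℕ → ℕ) × (ℕ → ℕ)) :=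
    {q | ((ψ q.1).2 : Measure Y) {y | e (ψ q.1).1 y ∈ C q.2} ≠ 0}
  have hD : MeasurableSet D := by
    let k : ProbabilityTheory.Kernel ((ℕ → ℕ) × (ℕ → ℕ)) Y :=
      ⟨fun q => ((ψ q.1).2 : Measure Y),
        (Continuous.measurable_coe_probabilityMeasure (continuous_snd.comp hψ)).comp measurable_fst⟩
    have : ProbabilityTheory.IsMarkovKernel k :=
      ⟨fun q => inferInstanceAs (IsProbabilityMeasure ((ψ q.1).2 : Measure Y))⟩
    have hs : MeasurableSet {p : ((ℕ → ℕ) × (ℕ → ℕ)) × Y | e (ψ p.1.1).1 p.2 ∈ C p.1.2} := by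
      have h1 : Measurable fun p : ((ℕ → ℕ) × (ℕ → ℕ)) × Y => (e (ψ p.1.1).1 p.2, p.1.2) := by
        refine Measurable.prodMk (Continuous.measurable ?_) (by fun_prop)
        exact he.comp (Continuous.prodMk (by fun_prop) continuous_snd)
      have h2 : MeasurableSet {p : Z × (ℕ → ℕ) | p.1 ∈ C p.2} := by
        have : {p : Z × (ℕ → ℕ) | p.1 ∈ C p.2} =
            ⋂ n, {p : Z × (ℕ → ℕ) | p.1 ∈ closure (f '' seqBox p.2 n)} := by
          ext p; simp [C]
        rw [this]
        exact MeasurableSet.iInter fun n => measurableSet_mem_closure_image_seqBox f n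
      exact h1 h2
    have := ProbabilityTheory.Kernel.measurable_kernel_prodMk_left (κ := k) hs
    exact this (MeasurableSet.singleton (0 : ℝ≥0∞)).compl
  have hDG : {p : X × ProbabilityMeasure Y |
      p ∈ range ψ ∧ (p.2 : Measure Y) {y | e p.1 y ∈ range f} ≠ 0} = (ψ ∘ Prod.fst) '' D := by
    ext p
    constructor
    · rintro ⟨⟨γ, rfl⟩, hp⟩
      have hex : Continuous (e (ψ γ).1) := he.comp (Continuous.prodMk_right _)
      let ν := ((ψ γ).2 : Measure Y).map (e (ψ γ).1)
      have hν : IsProbabilityMeasure ν :=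
        Measure.isProbabilityMeasure_map hex.measurable.aemeasurable
      have h0 : 0 < ν (range f) := (pos_iff_ne_zero.2 hp).trans_le
        (Measure.le_map_apply hex.measurable.aemeasurable _)
      obtain ⟨r, hr0, hr⟩ := exists_between h0
      obtain ⟨α, hα⟩ := exists_le_measure_iInter_closure f ν hr
      rw [Measure.map_apply hex.measurable
        (MeasurableSet.iInter fun n => isClosed_closure.measurableSet)] at hα
      exact ⟨(γ, α), (hr0.trans_le hα).ne', rfl⟩
    · rintro ⟨⟨γ, α⟩, hq, rfl⟩
      refine ⟨⟨γ, rfl⟩, fun h0 => hq (measure_mono_null ?_ h0)⟩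
      exact fun y hy => iInter_closure_image_seqBox_subset hf α hy
  rw [hDG]
  exact hD.analyticSet.image_of_continuous (hψ.comp continuous_fst)

/-- Jankov-von Neumann uniformization. -/
theorem exists_univMeasurable_section {X : Type*} [TopologicalSpace X] [T2Space X]
    [MeasurableSpace X] [OpensMeasurableSpace X] {f : (ℕ → ℕ) → X} (hf : Continuous f) :
    ∃ g : X → ℕ → ℕ, UnivMeasurable g ∧ ∀ x ∈ range f, f (g x) = x := by
  have hG : ∀ l : List ℕ, ∀ k : ℕ,
      UnivMeasurableSet (f '' {β | PiNat.res β (l.length + 1) = k :: l}) := by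
    intro l k
    refine AnalyticSet.univMeasurableSet (AnalyticSet.image_of_continuous ?_ hf)
    refine MeasurableSet.analyticSet (IsOpen.measurableSet ?_)
    rw [isOpen_iff_mem_nhds]
    intro β hβ
    refine Filter.mem_of_superset
      ((PiNat.isOpen_cylinder (fun _ => ℕ) β (l.length + 1)).mem_nhds (PiNat.self_mem_cylinder _ _))
      fun γ hγ => ?_
    rw [PiNat.cylinder_eq_res] at hγ
    exact Eq.trans hγ hβ
  choose idx hidx hidx' using fun l : List ℕ => exists_univMeasurable_index _ (hG l)
  let L : ℕ → X → List ℕ := fun n x => Nat.rec [] (fun _ l => idx l x :: l) n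
  have hLs : ∀ n x, L (n + 1) x = idx (L n x) x :: L n x := fun _ _ => rfl
  have hL : ∀ n l, UnivMeasurableSet {x | L n x = l} := by
    intro n
    induction n with
    | zero =>
      intro l
      exact @MeasurableSet.const X (univComp X) ([] = l)
    | succ n ih =>
      intro l
      cases l with
      | nil =>
        have : {x | L (n + 1) x = []} = ∅ := by ext x; simp [hLs]
        rw [this]
        exact MeasurableSet.empty.univMeasurableSet
      | cons k l =>
        have : {x | L (n + 1) x = k :: l} = {x | L n x = l} ∩ {x | idx l x = k} := by
          ext x
          simp only [hLs, Set.mem_ofPred_eq, List.cons.injEq, mem_inter_iff]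
          constructor
          · rintro ⟨rfl, rfl⟩; exact ⟨rfl, rfl⟩
          · rintro ⟨rfl, rfl⟩; exact ⟨rfl, rfl⟩
        rw [this]
        exact MeasurableSet.inter (ih l) (hidx l k)
  have hres : ∀ n x, PiNat.res (fun n => idx (L n x) x) n = L n x := by
    intro n x
    induction n with
    | zero => rfl
    | succ n ih => rw [PiNat.res_succ, ih]
  refine ⟨fun x n => idx (L n x) x, ?_, ?_⟩
  · refine @measurable_pi_lambda _ _ _ (univComp X) _ _ fun n => ?_
    refine UnivMeasurable.glue (hL n) fun l => ?_
    exact @measurable_to_countable' ℕ X _ _ (univComp X) _ fun k => hidx l k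
  · intro x hx
    have key : ∀ n, ∃ β, PiNat.res β n = L n x ∧ f β = x := by
      intro n
      induction n with
      | zero =>
        obtain ⟨β, hβ⟩ := hx
        exact ⟨β, rfl, hβ⟩
      | succ n ih =>
        obtain ⟨β, hβ, hβx⟩ := ih
        have hlen : (L n x).length = n := by rw [← hβ, PiNat.res_length]
        have := hidx' (L n x) x ⟨β n, β, by
          rw [Set.mem_ofPred_eq, hlen, PiNat.res_succ, hβ], hβx⟩
        obtain ⟨γ, hγ, hγx⟩ := this
        rw [Set.mem_ofPred_eq, hlen] at hγ
        exact ⟨γ, hγ, hγx⟩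
    choose β hβ hβx using key
    have hlim : Filter.Tendsto β Filter.atTop (nhds fun n => idx (L n x) x) := by
      rw [tendsto_pi_nhds]
      intro i
      refine tendsto_const_nhds.congr' ?_
      filter_upwards [Filter.eventually_gt_atTop i] with n hn
      have h1 : PiNat.res (β n) n = PiNat.res (fun n => idx (L n x) x) n := by rw [hβ, hres]
      exact (PiNat.res_eq_res.1 h1 hn).symm
    refine tendsto_nhds_unique ((hf.tendsto _).comp hlim) ?_
    refine tendsto_const_nhds.congr fun n => (hβx n).symm

theorem MeasureTheory.AnalyticSet.exists_selection {Y W : Type*} [TopologicalSpace Y] [T2Space Y]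
    [MeasurableSpace Y] [OpensMeasurableSpace Y] [TopologicalSpace W] {E : Set (Y × W)}
    (hE : AnalyticSet E) (hne : E.Nonempty) :
    ∃ (s : Y → ℕ → ℕ) (φ : (ℕ → ℕ) → W), UnivMeasurable s ∧ Continuous φ ∧
      ∀ y, (∃ w, (y, w) ∈ E) → (y, φ (s y)) ∈ E := by
  rw [AnalyticSet] at hE
  rcases hE with rfl | ⟨ψ, hψ, rfl⟩
  · simp at hne
  obtain ⟨g, hg, hgs⟩ := exists_univMeasurable_section (continuous_fst.comp hψ)
  refine ⟨g, fun β => (ψ β).2, hg, continuous_snd.comp hψ, ?_⟩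
  rintro y ⟨w, β, hβ⟩
  have h := hgs y ⟨β, by simp [hβ]⟩
  exact ⟨g y, Prod.ext h rfl⟩

theorem MeasureTheory.AnalyticSet.exists_univMeasurable_selection {Y W : Type*}
    [TopologicalSpace Y] [T2Space Y]
    [MeasurableSpace Y] [OpensMeasurableSpace Y] [TopologicalSpace W] [MeasurableSpace W]
    [BorelSpace W] [Nonempty W] {E : Set (Y × W)} (hE : AnalyticSet E) :
    ∃ g : Y → W, UnivMeasurable g ∧ ∀ y, (∃ w, (y, w) ∈ E) → (y, g y) ∈ E := by
  rcases E.eq_empty_or_nonempty with rfl | hne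
  · exact ⟨fun _ => Classical.arbitrary W, measurable_const.univMeasurable, by simp⟩
  obtain ⟨s, φ, hs, hφ, h⟩ := hE.exists_selection hne
  exact ⟨fun y => φ (s y), hφ.measurable.comp_univMeasurable hs, h⟩

theorem MeasureTheory.AnalyticSet.exists_kernel_selection {X Y : Type*} [TopologicalSpace X]
    [T2Space X] [MeasurableSpace X] [OpensMeasurableSpace X] [TopologicalSpace Y]
    [HasOuterApproxClosed Y] [MeasurableSpace Y] [BorelSpace Y] [Nonempty Y]
    {E : Set (X × ProbabilityMeasure Y)} (hE : AnalyticSet E) :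
    ∃ p : X → ProbabilityMeasure Y, UnivMeasurable (fun x => (p x : Measure Y)) ∧
      ∀ x, (∃ P, (x, P) ∈ E) → (x, p x) ∈ E := by
  rcases E.eq_empty_or_nonempty with rfl | hne
  · exact ⟨fun _ => ⟨Measure.dirac (Classical.arbitrary Y), inferInstance⟩,
      measurable_const.univMeasurable, by simp⟩
  obtain ⟨s, φ, hs, hφ, h⟩ := hE.exists_selection hne
  exact ⟨fun y => φ (s y), hφ.measurable_coe_probabilityMeasure.comp_univMeasurable hs, h⟩

end Selection

/-! ### Product measures -/

section Product

variable {Ω₁ : Type*}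

/-- Appending a coordinate. -/
def snocFn {t : ℕ} (ω : Fin t → Ω₁) (y : Ω₁) : Fin (t + 1) → Ω₁ := Fin.snoc ω y

theorem proj_comp_proj {T s t : ℕ} (hs : s ≤ T) (ht : t ≤ s) :
    proj s t ht ∘ proj (Ω₁ := Ω₁) T s hs = proj T t (ht.trans hs) := rfl

theorem proj_snocFn {t : ℕ} (ω : Fin t → Ω₁) (y : Ω₁) :
    proj (t + 1) t t.le_succ (snocFn ω y) = ω := by
  funext i
  exact Fin.snoc_castSucc (α := fun _ => Ω₁) y ω i

theorem continuous_snocFn [TopologicalSpace Ω₁] {t : ℕ} :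
    Continuous (Function.uncurry (snocFn (Ω₁ := Ω₁) (t := t))) := by
  refine continuous_pi fun i => ?_
  refine Fin.lastCases ?_ (fun i => ?_) i
  · simpa [Function.uncurry_def, snocFn] using continuous_snd
  · simpa [Function.uncurry_def, snocFn] using
      (by fun_prop : Continuous fun a : (Fin t → Ω₁) × Ω₁ => a.1 i)

variable [MeasurableSpace Ω₁]

theorem measurable_proj {T t : ℕ} (ht : t ≤ T) : Measurable (proj (Ω₁ := Ω₁) T t ht) :=
  measurable_pi_lambda _ fun _ => measurable_pi_apply _

theorem measurable_snocFn {t : ℕ} :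
    Measurable (Function.uncurry (snocFn (Ω₁ := Ω₁) (t := t))) := by
  refine measurable_pi_lambda _ fun i => ?_
  refine Fin.lastCases ?_ (fun i => ?_) i
  · simpa [Function.uncurry_def, snocFn] using measurable_snd
  · simpa [Function.uncurry_def, snocFn] using
      (by fun_prop : Measurable fun a : (Fin t → Ω₁) × Ω₁ => a.1 i)

/-- A family of probability kernels. -/
abbrev KernelFamily (Ω₁ : Type*) [MeasurableSpace Ω₁] :=
  (t : ℕ) → (Fin t → Ω₁) → ProbabilityMeasure Ω₁

/-- The product measure of a family of probability kernels. -/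
abbrev prodProb (P : KernelFamily Ω₁) (T : ℕ) : Measure (Fin T → Ω₁) :=
  prodMeas (fun t ω => (P t ω : Measure Ω₁)) T

theorem prodProb_succ (P : KernelFamily Ω₁) (T : ℕ) :
    prodProb P (T + 1) = (prodProb P T).bind fun ω => (P T ω : Measure Ω₁).map (snocFn ω) := rfl

/-- The kernels up to time `T` are universally measurable. -/
def UnivKernels (P : KernelFamily Ω₁) (T : ℕ) : Prop :=
  ∀ t, t < T → UnivMeasurable fun ω => (P t ω : Measure Ω₁)

theorem UnivKernels.mono {P : KernelFamily Ω₁} {s T : ℕ} (h : UnivKernels P T) (hs : s ≤ T) :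
    UnivKernels P s := fun t ht => h t (ht.trans_le hs)

theorem prodProb_congr {P P' : KernelFamily Ω₁} {T : ℕ} (h : ∀ t < T, P t = P' t) :
    prodProb P T = prodProb P' T := by
  induction T with
  | zero => rfl
  | succ T ih =>
    rw [prodProb_succ, prodProb_succ, ih fun t ht => h t (ht.trans T.lt_succ_self),
      h T T.lt_succ_self]

/-- The kernels up to time `T` are universally measurable selectors of `𝒬`. -/
def IsSelector (𝒬 : (t : ℕ) → (Fin t → Ω₁) → Set (ProbabilityMeasure Ω₁))
    (P : KernelFamily Ω₁) (T : ℕ) : Prop :=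
  ∀ t, t < T → UnivMeasurable (fun ω => (P t ω : Measure Ω₁)) ∧ ∀ ω, P t ω ∈ 𝒬 t ω

variable {𝒬 : (t : ℕ) → (Fin t → Ω₁) → Set (ProbabilityMeasure Ω₁)} {P : KernelFamily Ω₁}
  {s t T : ℕ}

theorem IsSelector.univKernels (h : IsSelector 𝒬 P T) : UnivKernels P T := fun t ht => (h t ht).1

theorem IsSelector.mono (h : IsSelector 𝒬 P T) (hs : s ≤ T) : IsSelector 𝒬 P s :=
  fun t ht => h t (ht.trans_le hs)

theorem IsSelector.prodProb_mem (h : IsSelector 𝒬 P T) : prodProb P T ∈ ProdSet 𝒬 T := ⟨P, h, rfl⟩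

theorem forall_mem_prodSet {p : Measure (Fin T → Ω₁) → Prop} :
    (∀ μ ∈ ProdSet 𝒬 T, p μ) ↔ ∀ P, IsSelector 𝒬 P T → p (prodProb P T) := by
  constructor
  · exact fun h P hP => h _ hP.prodProb_mem
  · rintro h _ ⟨P, hP, rfl⟩
    exact h P hP

/-- Extending a selector by one step. -/
theorem IsSelector.exists_succ (h : IsSelector 𝒬 P t) {κ : (Fin t → Ω₁) → ProbabilityMeasure Ω₁}
    (hκ : UnivMeasurable fun ω => (κ ω : Measure Ω₁)) (hκ𝒬 : ∀ ω, κ ω ∈ 𝒬 t ω) :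
    ∃ P', IsSelector 𝒬 P' (t + 1) ∧ prodProb P' t = prodProb P t ∧ P' t = κ := by
  classical
  refine ⟨Function.update P t κ, fun s hs => ?_, prodProb_congr fun s hs => ?_, by simp⟩
  · rcases Nat.lt_succ_iff_lt_or_eq.1 hs with h1 | rfl
    · rw [Function.update_of_ne h1.ne]
      exact h s h1
    · simpa using ⟨hκ, hκ𝒬⟩
  · rw [Function.update_of_ne hs.ne]

theorem IsSelector.exists_extend (h : IsSelector 𝒬 P t) {P₀ : KernelFamily Ω₁}
    (h₀ : IsSelector 𝒬 P₀ T) : ∃ P', IsSelector 𝒬 P' T ∧ prodProb P' t = prodProb P t := by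
  classical
  refine ⟨fun s => if s < t then P s else P₀ s, fun s hs => ?_, prodProb_congr fun s hs => ?_⟩
  · by_cases hst : s < t
    · simpa [hst] using h s hst
    · simpa [hst] using h₀ s hs
  · simp [hs]

/-- A property holding quasi-surely with respect to all selectors up to time `t`. -/
def QuasiSurely (𝒬 : (t : ℕ) → (Fin t → Ω₁) → Set (ProbabilityMeasure Ω₁)) (t : ℕ)
    (p : (Fin t → Ω₁) → Prop) : Prop :=
  ∀ μ ∈ ProdSet 𝒬 t, ∀ᵐ ω ∂μ, p ω

theorem QuasiSurely.ae_prodProb {p : (Fin t → Ω₁) → Prop} (hp : QuasiSurely 𝒬 t p)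
    (h : IsSelector 𝒬 P t) : ∀ᵐ ω ∂prodProb P t, p ω := hp _ h.prodProb_mem

theorem exists_isSelector [TopologicalSpace Ω₁] [PolishSpace Ω₁] [BorelSpace Ω₁] [Nonempty Ω₁]
    (h𝒬ne : ∀ t, t < T → ∀ ω, (𝒬 t ω).Nonempty)
    (h𝒬graph : ∀ t, t < T →
      AnalyticSet {p : (Fin t → Ω₁) × ProbabilityMeasure Ω₁ | p.2 ∈ 𝒬 t p.1}) :
    ∃ P, IsSelector 𝒬 P T := by
  classical
  have : ∀ t, ∃ κ : (Fin t → Ω₁) → ProbabilityMeasure Ω₁, t < T →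
      UnivMeasurable (fun ω => (κ ω : Measure Ω₁)) ∧ ∀ ω, κ ω ∈ 𝒬 t ω := by
    intro t
    by_cases ht : t < T
    · obtain ⟨κ, hκ, h⟩ := (h𝒬graph t ht).exists_kernel_selection
      exact ⟨κ, fun _ => ⟨hκ, fun ω => h ω (h𝒬ne t ht ω)⟩⟩
    · exact ⟨fun _ => ⟨Measure.dirac (Classical.arbitrary Ω₁), inferInstance⟩, fun h => absurd h ht⟩
  choose P hP using this
  exact ⟨P, hP⟩

variable [MeasurableSpace.CountablyGenerated Ω₁]

theorem UnivKernels.isProbabilityMeasure {P : KernelFamily Ω₁} {T : ℕ} (h : UnivKernels P T) :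
    IsProbabilityMeasure (prodProb P T) := by
  induction T with
  | zero => exact Measure.dirac.isProbabilityMeasure
  | succ T ih =>
    have := ih (h.mono T.le_succ)
    exact (h T T.lt_succ_self).isProbabilityMeasure_bind measurable_snocFn _

theorem UnivKernels.ae_succ_iff {P : KernelFamily Ω₁} {T : ℕ} (h : UnivKernels P (T + 1))
    {s : Set (Fin (T + 1) → Ω₁)} (hs : UnivMeasurableSet s) :
    (∀ᵐ ω ∂prodProb P (T + 1), ω ∈ s) ↔
      ∀ᵐ ω ∂prodProb P T, ∀ᵐ y ∂(P T ω : Measure Ω₁), snocFn ω y ∈ s := by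
  have := (h.mono T.le_succ).isProbabilityMeasure
  exact (h T T.lt_succ_self).ae_bind_iff measurable_snocFn hs

theorem UnivKernels.ae_ae_of_ae_succ {P : KernelFamily Ω₁} {T : ℕ} (h : UnivKernels P (T + 1))
    {p : (Fin (T + 1) → Ω₁) → Prop} (hp : ∀ᵐ ω ∂prodProb P (T + 1), p ω) :
    ∀ᵐ ω ∂prodProb P T, ∀ᵐ y ∂(P T ω : Measure Ω₁), p (snocFn ω y) := by
  have := (h.mono T.le_succ).isProbabilityMeasure
  exact (h T T.lt_succ_self).ae_ae_of_ae_bind measurable_snocFn hp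

theorem UnivKernels.lintegral_succ {P : KernelFamily Ω₁} {T : ℕ} (h : UnivKernels P (T + 1))
    {f : (Fin (T + 1) → Ω₁) → ℝ≥0∞} (hf : UnivMeasurable f) :
    ∫⁻ ω, f ω ∂prodProb P (T + 1) =
      ∫⁻ ω, ∫⁻ y, f (snocFn ω y) ∂(P T ω : Measure Ω₁) ∂prodProb P T := by
  have := (h.mono T.le_succ).isProbabilityMeasure
  exact (h T T.lt_succ_self).lintegral_bind measurable_snocFn _ hf

theorem UnivKernels.map_proj_succ {P : KernelFamily Ω₁} {T : ℕ} (h : UnivKernels P (T + 1)) :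
    (prodProb P (T + 1)).map (proj (T + 1) T T.le_succ) = prodProb P T := by
  ext s hs
  rw [Measure.map_apply (measurable_proj _) hs, ← lintegral_indicator_one (measurable_proj _ hs),
    h.lintegral_succ (measurable_one.indicator (measurable_proj _ hs)).univMeasurable,
    ← lintegral_indicator_one hs]
  refine lintegral_congr fun ω => ?_
  have : ∀ y, (proj (T + 1) T T.le_succ ⁻¹' s).indicator (1 : (Fin (T + 1) → Ω₁) → ℝ≥0∞)
      (snocFn ω y) = s.indicator 1 ω := fun y => by
    have h1 : snocFn ω y ∈ proj (T + 1) T T.le_succ ⁻¹' s ↔ ω ∈ s := by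
      rw [mem_preimage, proj_snocFn]
    by_cases hω : ω ∈ s
    · rw [indicator_of_mem (h1.2 hω), indicator_of_mem hω]; rfl
    · rw [indicator_of_notMem (mt h1.1 hω), indicator_of_notMem hω]
  simp [this]

theorem UnivKernels.map_proj {P : KernelFamily Ω₁} {T t : ℕ} (h : UnivKernels P T) (ht : t ≤ T) :
    (prodProb P T).map (proj T t ht) = prodProb P t := by
  induction T, ht using Nat.le_induction with
  | base => exact Measure.map_id
  | succ T ht ih =>
    rw [← proj_comp_proj T.le_succ ht, ← Measure.map_map (measurable_proj _) (measurable_proj _),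
      h.map_proj_succ, ih (h.mono T.le_succ)]

theorem UnivKernels.ae_proj {P : KernelFamily Ω₁} {T t : ℕ} (h : UnivKernels P T) (ht : t ≤ T)
    {p : (Fin t → Ω₁) → Prop} (hp : ∀ᵐ ω ∂prodProb P t, p ω) :
    ∀ᵐ ω ∂prodProb P T, p (proj T t ht ω) := by
  rw [← h.map_proj ht] at hp
  exact ae_of_ae_map (measurable_proj _).aemeasurable hp

theorem UnivKernels.absolutelyContinuous {P P' : KernelFamily Ω₁} {T : ℕ} (h : UnivKernels P T)
    (h' : UnivKernels P' T) (hac : ∀ t < T, ∀ ω, (P t ω : Measure Ω₁) ≪ P' t ω) :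
    prodProb P T ≪ prodProb P' T := by
  induction T with
  | zero => exact Measure.AbsolutelyContinuous.rfl
  | succ T ih =>
    have ih' := ih (h.mono T.le_succ) (h'.mono T.le_succ) fun t ht =>
      hac t (ht.trans T.lt_succ_self)
    refine Measure.AbsolutelyContinuous.mk fun s hs hs0 => ?_
    have h0 : ∀ᵐ ω ∂prodProb P' (T + 1), ω ∈ sᶜ := by simpa [ae_iff] using hs0
    rw [h'.ae_succ_iff hs.compl.univMeasurableSet] at h0
    have h1 : ∀ᵐ ω ∂prodProb P (T + 1), ω ∈ sᶜ := by
      rw [h.ae_succ_iff hs.compl.univMeasurableSet]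
      filter_upwards [ih'.ae_le h0] with ω hω
      exact (hac T T.lt_succ_self ω).ae_le hω
    simpa [ae_iff] using h1

theorem QuasiSurely.ae_ae {p : (Fin (t + 1) → Ω₁) → Prop} (hp : QuasiSurely 𝒬 (t + 1) p)
    (h : IsSelector 𝒬 P t) {κ : (Fin t → Ω₁) → ProbabilityMeasure Ω₁}
    (hκ : UnivMeasurable fun ω => (κ ω : Measure Ω₁)) (hκ𝒬 : ∀ ω, κ ω ∈ 𝒬 t ω) :
    ∀ᵐ ω ∂prodProb P t, ∀ᵐ y ∂(κ ω : Measure Ω₁), p (snocFn ω y) := by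
  obtain ⟨P', hP', h1, rfl⟩ := h.exists_succ hκ hκ𝒬
  rw [← h1]
  exact hP'.univKernels.ae_ae_of_ae_succ (hp.ae_prodProb hP')

end Product

/-! ### Cones in finite dimension -/

section Cones

variable {d : ℕ}

/-- The dual cone as a pointed cone. -/
def dualPointedCone (C : Set (Fin d → ℝ)) : PointedCone ℝ (Fin d → ℝ) where
  carrier := dualCone C
  add_mem' {a b} ha hb x hx := by
    have : x ⬝ᵥ (a + b) = x ⬝ᵥ a + x ⬝ᵥ b := dotProduct_add _ _ _
    exact (add_nonneg (ha x hx) (hb x hx)).trans_eq this.symm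
  zero_mem' x _ := (dotProduct_zero x).ge
  smul_mem' c a ha x hx := by
    have : x ⬝ᵥ (c • a) = (c : ℝ) * x ⬝ᵥ a := dotProduct_smul (c : ℝ) x a
    exact (mul_nonneg c.2 (ha x hx)).trans_eq this.symm

theorem coe_dualPointedCone (C : Set (Fin d → ℝ)) : (dualPointedCone C : Set _) = dualCone C := rfl

theorem mem_dualCone {C : Set (Fin d → ℝ)} {y : Fin d → ℝ} :
    y ∈ dualCone C ↔ ∀ x ∈ C, 0 ≤ x ⬝ᵥ y := Iff.rfl

/-- A fixed dense sequence in `ℝ^d`. -/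
def densePt (d : ℕ) : ℕ → Fin d → ℝ := TopologicalSpace.denseSeq _

/-- The pointed cone generated by the dense points with indices in `J`. -/
def coneHull (d : ℕ) (J : Set ℕ) : PointedCone ℝ (Fin d → ℝ) :=
  PointedCone.hull ℝ (densePt d '' J)

/-- The interior of the cone generated by the dense points with indices in `J`. -/
def openHull (d : ℕ) (J : Set ℕ) : Set (Fin d → ℝ) := interior (coneHull d J)

/-- An open convex cone, not necessarily containing the origin. -/
structure IsOpenCone (S : Set (Fin d → ℝ)) : Prop where
  isOpen : IsOpen S
  add_mem : ∀ ⦃x⦄, x ∈ S → ∀ ⦃y⦄, y ∈ S → x + y ∈ S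
  smul_mem : ∀ ⦃c : ℝ⦄, 0 < c → ∀ ⦃x⦄, x ∈ S → c • x ∈ S

theorem IsOpenCone.convex {S : Set (Fin d → ℝ)} (h : IsOpenCone S) : Convex ℝ S := by
  rw [convex_iff_forall_pos]
  exact fun x hx y hy a b ha hb _ => h.add_mem (h.smul_mem ha hx) (h.smul_mem hb hy)

theorem IsOpenCone.add_smul_mem {S : Set (Fin d → ℝ)} (h : IsOpenCone S) {x y : Fin d → ℝ}
    (hx : x ∈ S) (hy : y ∈ S) {c : ℝ} (hc : 0 ≤ c) : x + c • y ∈ S := by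
  rcases hc.eq_or_lt with rfl | hc
  · simpa using hx
  · exact h.add_mem hx (h.smul_mem hc hy)

theorem IsOpenCone.inter {S S' : Set (Fin d → ℝ)} (h : IsOpenCone S) (h' : IsOpenCone S') :
    IsOpenCone (S ∩ S') where
  isOpen := h.isOpen.inter h'.isOpen
  add_mem _ hx _ hy := ⟨h.add_mem hx.1 hy.1, h'.add_mem hx.2 hy.2⟩
  smul_mem _ hc _ hx := ⟨h.smul_mem hc hx.1, h'.smul_mem hc hx.2⟩

theorem PointedCone.isOpenCone_interior (C : PointedCone ℝ (Fin d → ℝ)) :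
    IsOpenCone (interior (C : Set (Fin d → ℝ))) where
  isOpen := isOpen_interior
  smul_mem c hc x hx := by
    have h1 : c • interior (C : Set (Fin d → ℝ)) ⊆ C := by
      rintro _ ⟨y, hy, rfl⟩
      exact PointedCone.smul_mem C hc.le (interior_subset hy)
    exact interior_maximal h1 (isOpen_interior.smul₀ hc.ne') ⟨x, hx, rfl⟩
  add_mem x hx y hy := by
    have h1 : y +ᵥ interior (C : Set (Fin d → ℝ)) ⊆ C := by
      rintro _ ⟨z, hz, rfl⟩
      exact C.add_mem (interior_subset hy) (interior_subset hz)
    exact interior_maximal h1 (isOpen_interior.vadd y) ⟨x, hx, add_comm y x⟩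

theorem isOpenCone_openHull (J : Set ℕ) : IsOpenCone (openHull d J) :=
  (coneHull d J).isOpenCone_interior

theorem isOpenCone_interior_dualCone (C : Set (Fin d → ℝ)) :
    IsOpenCone (interior (dualCone C)) := (dualPointedCone C).isOpenCone_interior

theorem coneHull_mono {J J' : Set ℕ} (h : J ⊆ J') : coneHull d J ≤ coneHull d J' :=
  Submodule.span_mono (image_mono h)

theorem openHull_mono {J J' : Set ℕ} (h : J ⊆ J') : openHull d J ⊆ openHull d J' :=
  interior_mono (coneHull_mono h)

theorem densePt_mem_coneHull {J : Set ℕ} {n : ℕ} (hn : n ∈ J) : densePt d n ∈ coneHull d J :=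
  Submodule.subset_span (mem_image_of_mem _ hn)

theorem coneHull_le {J : Set ℕ} {C : PointedCone ℝ (Fin d → ℝ)} (h : ∀ n ∈ J, densePt d n ∈ C) :
    coneHull d J ≤ C := by
  refine Submodule.span_le.2 ?_
  rintro _ ⟨n, hn, rfl⟩
  exact h n hn

theorem exists_finset_mem_coneHull {J : Set ℕ} {x : Fin d → ℝ} (hx : x ∈ coneHull d J) :
    ∃ F : Finset ℕ, ↑F ⊆ J ∧ x ∈ coneHull d F := by
  classical
  obtain ⟨T, hT, hxT⟩ := Submodule.mem_span_finite_of_mem_span hx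
  obtain ⟨F, hFJ, rfl⟩ := Finset.subset_set_image_iff.1 hT
  exact ⟨F, hFJ, by simpa [coneHull] using hxT⟩

theorem exists_finset_mem_openHull {J : Set ℕ} {z : Fin d → ℝ} (hz : z ∈ openHull d J) :
    ∃ F : Finset ℕ, ↑F ⊆ J ∧ z ∈ openHull d F := by
  classical
  obtain ⟨b, hb, hbJ⟩ := exists_mem_interior_convexHull_affineBasis
    (isOpen_interior.mem_nhds hz)
  have hb' : ∀ i, b i ∈ coneHull d J := fun i =>
    interior_subset (hbJ (subset_convexHull ℝ _ (mem_range_self i)))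
  choose F hFJ hF using fun i => exists_finset_mem_coneHull (hb' i)
  refine ⟨Finset.univ.biUnion F, by simpa using hFJ, interior_mono ?_ hb⟩
  refine convexHull_min ?_ (PointedCone.convex _)
  rintro _ ⟨i, rfl⟩
  exact coneHull_mono (by exact_mod_cast Finset.subset_biUnion_of_mem F (Finset.mem_univ i)) (hF i)

theorem mem_openHull_iff {J : Set ℕ} {z : Fin d → ℝ} :
    z ∈ openHull d J ↔ ∃ F : Finset ℕ, ↑F ⊆ J ∧ z ∈ openHull d F :=
  ⟨exists_finset_mem_openHull, fun ⟨_, h, hz⟩ => openHull_mono h hz⟩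

theorem exists_densePt_mem {O : Set (Fin d → ℝ)} (hO : IsOpen O) (hne : O.Nonempty) :
    ∃ n, densePt d n ∈ O := by
  obtain ⟨_, hx, n, rfl⟩ := (TopologicalSpace.denseRange_denseSeq (Fin d → ℝ)).inter_open_nonempty
    O hO hne
  exact ⟨n, hx⟩

theorem subset_openHull {O : Set (Fin d → ℝ)} (hO : IsOpen O) :
    O ⊆ openHull d {n | densePt d n ∈ O} := by
  rcases O.eq_empty_or_nonempty with rfl | hne
  · exact empty_subset _
  set C : Set (Fin d → ℝ) := ↑(coneHull d {n | densePt d n ∈ O}) with hC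
  have hCc : Convex ℝ C := PointedCone.convex _
  have hOC : O ⊆ closure C := by
    have h1 := (TopologicalSpace.denseRange_denseSeq (Fin d → ℝ)).open_subset_closure_inter hO
    refine h1.trans (closure_mono ?_)
    rintro _ ⟨hx, n, rfl⟩
    exact densePt_mem_coneHull hx
  have hint : (interior C).Nonempty := by
    rw [hCc.interior_nonempty_iff_affineSpan_eq_top, eq_top_iff,
      ← hO.affineSpan_eq_top hne, affineSpan_le]
    exact hOC.trans (closure_minimal (subset_affineSpan ℝ C)
      (AffineSubspace.closed_of_finiteDimensional _))
  calc O ⊆ interior (closure C) := interior_maximal hOC hO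
    _ = interior C := hCc.interior_closure_eq_interior_of_nonempty_interior hint

theorem openHull_setOf_densePt_mem (C : PointedCone ℝ (Fin d → ℝ)) :
    openHull d {n | densePt d n ∈ C} = interior (C : Set (Fin d → ℝ)) :=
  (interior_mono (coneHull_le fun _ hn => hn)).antisymm
    ((subset_openHull isOpen_interior).trans (openHull_mono fun _ hn =>
      interior_subset (s := (C : Set (Fin d → ℝ))) hn))

/-- Every continuous linear functional on `ℝ^d` is a dot product. -/
theorem exists_eq_dotProduct (f : (Fin d → ℝ) →ₗ[ℝ] ℝ) : ∃ y, ∀ x, f x = x ⬝ᵥ y := by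
  refine ⟨fun i => f fun j => if i = j then 1 else 0, fun x => ?_⟩
  rw [f.pi_apply_eq_sum_univ x]
  rfl

theorem continuous_dotProduct_right (x : Fin d → ℝ) : Continuous fun y => x ⬝ᵥ y := by
  unfold dotProduct
  fun_prop

/-- A solvency cone. -/
structure IsSolvencyCone (K : Set (Fin d → ℝ)) : Prop where
  isClosed : IsClosed K
  convex : Convex ℝ K
  smul_mem : ∀ c : ℝ, 0 ≤ c → ∀ x ∈ K, c • x ∈ K
  orthant_subset : {x : Fin d → ℝ | ∀ i, 0 ≤ x i} ⊆ K

theorem IsSolvencyCone.zero_mem {K : Set (Fin d → ℝ)} (h : IsSolvencyCone K) : 0 ∈ K :=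
  h.orthant_subset fun _ => le_rfl

theorem IsSolvencyCone.add_mem {K : Set (Fin d → ℝ)} (h : IsSolvencyCone K) {x y : Fin d → ℝ}
    (hx : x ∈ K) (hy : y ∈ K) : x + y ∈ K := by
  have h1 := h.convex hx hy (by norm_num : (0 : ℝ) ≤ 1 / 2) (by norm_num : (0 : ℝ) ≤ 1 / 2)
    (by norm_num)
  have h2 := h.smul_mem 2 (by norm_num) _ h1
  rwa [smul_add, smul_smul, smul_smul, mul_one_div_cancel two_ne_zero, one_smul, one_smul] at h2

/-- The bipolar theorem. -/
theorem IsSolvencyCone.mem_of_forall_dualCone {K : Set (Fin d → ℝ)} (h : IsSolvencyCone K)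
    {x : Fin d → ℝ} (hx : ∀ y ∈ dualCone K, 0 ≤ x ⬝ᵥ y) : x ∈ K := by
  by_contra hxK
  obtain ⟨f, u, hfx, hfK⟩ := geometric_hahn_banach_point_closed h.convex h.isClosed hxK
  obtain ⟨y, hy⟩ := exists_eq_dotProduct f.toLinearMap
  have hu : u < 0 := by simpa using hfK 0 h.zero_mem
  have hyK : y ∈ dualCone K := by
    intro k hk
    change 0 ≤ k ⬝ᵥ y
    rw [← hy k]
    by_contra! hneg
    have hneg' : f k < 0 := hneg
    have h1 := hfK _ (h.smul_mem (u / f k) (div_nonneg_of_nonpos hu.le hneg'.le) k hk)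
    rw [map_smul, smul_eq_mul, div_mul_cancel₀ _ hneg'.ne] at h1
    exact lt_irrefl _ h1
  have h1 := hx y hyK
  rw [← hy x] at h1
  exact absurd (hfx.trans hu) (not_lt.2 h1)

/-- Nonnegativity on the interior of a convex set extends to the set. -/
theorem dotProduct_nonneg_of_interior {C : Set (Fin d → ℝ)} (hC : Convex ℝ C)
    (hne : (interior C).Nonempty) {x : Fin d → ℝ} (h : ∀ y ∈ interior C, 0 ≤ x ⬝ᵥ y) :
    ∀ y ∈ C, 0 ≤ x ⬝ᵥ y := by
  intro y hy
  have h1 : y ∈ closure (interior C) := by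
    rw [hC.closure_interior_eq_closure_of_nonempty_interior hne]
    exact subset_closure hy
  exact closure_minimal (t := {y | 0 ≤ x ⬝ᵥ y}) h
    (isClosed_le continuous_const (continuous_dotProduct_right x)) h1

theorem IsSolvencyCone.mem_of_forall_interior {K : Set (Fin d → ℝ)} (h : IsSolvencyCone K)
    (hne : (interior (dualCone K)).Nonempty)
    {x : Fin d → ℝ} (hx : ∀ y ∈ interior (dualCone K), 0 ≤ x ⬝ᵥ y) : x ∈ K :=
  h.mem_of_forall_dualCone
    (dotProduct_nonneg_of_interior (dualPointedCone K).convex hne hx)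

theorem dotProduct_nonneg_of_densePt {O : Set (Fin d → ℝ)} (hO : IsOpen O) {x : Fin d → ℝ}
    (h : ∀ n, densePt d n ∈ O → 0 ≤ x ⬝ᵥ densePt d n) : ∀ y ∈ O, 0 ≤ x ⬝ᵥ y := by
  intro y hy
  have h1 := (TopologicalSpace.denseRange_denseSeq (Fin d → ℝ)).open_subset_closure_inter hO hy
  refine closure_minimal (t := {y | 0 ≤ x ⬝ᵥ y}) ?_
    (isClosed_le continuous_const (continuous_dotProduct_right x)) h1
  rintro _ ⟨hx, n, rfl⟩
  exact h n hx

theorem eq_zero_of_dotProduct_interior_dualCone {K : Set (Fin d → ℝ)} {z x : Fin d → ℝ}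
    (hz : z ∈ interior (dualCone K)) (hx : x ∈ K) (h0 : x ⬝ᵥ z = 0) : x = 0 := by
  have hc : Filter.Tendsto (fun ε : ℝ => z - ε • x) (nhdsWithin 0 (Set.Ioi 0)) (nhds z) := by
    have : Continuous fun ε : ℝ => z - ε • x := by fun_prop
    simpa using (this.tendsto 0).mono_left nhdsWithin_le_nhds
  obtain ⟨ε, hε, hε0⟩ := ((hc.eventually (mem_interior_iff_mem_nhds.1 hz)).and
    self_mem_nhdsWithin).exists
  have h1 : 0 ≤ x ⬝ᵥ (z - ε • x) := hε x hx
  rw [dotProduct_sub, h0, dotProduct_smul, smul_eq_mul] at h1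
  have h2 : 0 ≤ x ⬝ᵥ x := by simpa using dotProduct_star_self_nonneg x
  have h3 : x ⬝ᵥ x ≤ 0 := by
    have hε0' : 0 < ε := hε0
    by_contra! hpos
    nlinarith [mul_pos hε0' hpos]
  exact dotProduct_self_eq_zero.1 (le_antisymm h3 h2)

theorem eq_zero_of_mem_neg_mem {K : Set (Fin d → ℝ)} (hne : (interior (dualCone K)).Nonempty)
    {x : Fin d → ℝ} (hx : x ∈ K) (hx' : -x ∈ K) : x = 0 := by
  obtain ⟨z, hz⟩ := hne
  refine eq_zero_of_dotProduct_interior_dualCone hz hx (le_antisymm ?_ (interior_subset hz x hx))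
  have := mem_dualCone.1 (interior_subset hz) _ hx'
  rw [neg_dotProduct] at this
  linarith

theorem IsSolvencyCone.dualCone_nonneg {K : Set (Fin d → ℝ)} (h : IsSolvencyCone K)
    {z : Fin d → ℝ} (hz : z ∈ dualCone K) (i : Fin d) : 0 ≤ z i := by
  classical
  have := mem_dualCone.1 hz (Pi.single i 1) (h.orthant_subset fun j => by
    by_cases hj : j = i
    · subst hj; simp
    · simp [hj])
  simpa using this

theorem coneHull_interior_nonneg {J : Set ℕ} (hne : (openHull d J).Nonempty) {x : Fin d → ℝ}
    (h : ∀ y ∈ openHull d J, 0 ≤ x ⬝ᵥ y) : ∀ n ∈ J, 0 ≤ x ⬝ᵥ densePt d n := fun _ hn =>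
  dotProduct_nonneg_of_interior (PointedCone.convex _) hne h _ (densePt_mem_coneHull hn)

/-- Separation of the interior of a dual cone from an open hull. -/
theorem IsSolvencyCone.exists_separating {K : Set (Fin d → ℝ)} (h : IsSolvencyCone K) {J : Set ℕ}
    (hne : (interior (dualCone K)).Nonempty) (hJ : (openHull d J).Nonempty)
    (hdisj : Disjoint (interior (dualCone K)) (openHull d J)) :
    ∃ x : Fin d → ℝ, x ≠ 0 ∧ -x ∈ K ∧ ∀ n ∈ J, 0 ≤ x ⬝ᵥ densePt d n := by
  have hA := isOpenCone_interior_dualCone K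
  have hB := isOpenCone_openHull (d := d) J
  obtain ⟨f, u, hfA, hfB⟩ := geometric_hahn_banach_open hA.convex hA.isOpen hB.convex hdisj
  obtain ⟨x, hx⟩ := exists_eq_dotProduct f.toLinearMap
  have hx' : ∀ y, f y = x ⬝ᵥ y := fun y => (hx y).trans (dotProduct_comm _ _)
  have hlim : ∀ y, Filter.Tendsto (fun c : ℝ => f (c • y)) (nhdsWithin 0 (Set.Ioi 0)) (nhds 0) := by
    intro y
    have : Continuous fun c : ℝ => f (c • y) := by fun_prop
    simpa using (this.tendsto 0).mono_left nhdsWithin_le_nhds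
  obtain ⟨a, ha⟩ := hne
  obtain ⟨b, hb⟩ := hJ
  have hu0 : 0 ≤ u := le_of_tendsto (hlim a) (by
    filter_upwards [self_mem_nhdsWithin] with c hc
    exact (hfA _ (hA.smul_mem hc ha)).le)
  have hu1 : u ≤ 0 := ge_of_tendsto (hlim b) (by
    filter_upwards [self_mem_nhdsWithin] with c hc
    exact hfB _ (hB.smul_mem hc hb))
  have hu : u = 0 := le_antisymm hu1 hu0
  subst hu
  refine ⟨x, ?_, h.mem_of_forall_interior ⟨a, ha⟩ fun y hy => ?_,
    coneHull_interior_nonneg ⟨b, hb⟩ fun y hy => (hfB y hy).trans_eq (hx' y)⟩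
  · rintro rfl
    simpa [hx'] using hfA a ha
  · rw [neg_dotProduct, ← hx' y]
    exact neg_nonneg.2 (hfA y hy).le

/-- The dual of an intersection of cones with intersecting interiors is the sum of the duals. -/
theorem IsSolvencyCone.exists_add_of_nonneg {K : Set (Fin d → ℝ)} (h : IsSolvencyCone K) {J : Set ℕ}
    (hne : (interior (dualCone K) ∩ openHull d J).Nonempty) {v : Fin d → ℝ}
    (hv : ∀ y ∈ interior (dualCone K) ∩ openHull d J, 0 ≤ v ⬝ᵥ y) :
    ∃ k ∈ K, ∀ n ∈ J, 0 ≤ (v - k) ⬝ᵥ densePt d n := by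
  obtain ⟨z, hzA, hzB⟩ := hne
  have hv' : ∀ y, y ∈ dualCone K → y ∈ coneHull d J → 0 ≤ v ⬝ᵥ y := by
    intro y hyA hyB
    rw [openHull, ← interior_inter] at hv
    exact dotProduct_nonneg_of_interior
      (C := dualCone K ∩ coneHull d J)
      ((dualPointedCone K).convex.inter (PointedCone.convex _))
      ⟨z, by rw [interior_inter]; exact ⟨hzA, hzB⟩⟩ hv y ⟨hyA, hyB⟩
  let s : PointedCone ℝ ((Fin d → ℝ) × (Fin d → ℝ)) := (dualPointedCone K).prod (coneHull d J)
  let D : Submodule ℝ ((Fin d → ℝ) × (Fin d → ℝ)) :=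
    LinearMap.ker (LinearMap.fst ℝ (Fin d → ℝ) (Fin d → ℝ) - LinearMap.snd ℝ _ _)
  have hD : ∀ p, p ∈ D ↔ p.1 = p.2 := fun p => by simp [D, sub_eq_zero]
  let L : (Fin d → ℝ) →ₗ[ℝ] ℝ :=
    { toFun := fun y => v ⬝ᵥ y
      map_add' := dotProduct_add v
      map_smul' := fun c y => dotProduct_smul c v y }
  let f : ((Fin d → ℝ) × (Fin d → ℝ)) →ₗ.[ℝ] ℝ :=
    ⟨D, L ∘ₗ LinearMap.fst ℝ _ _ ∘ₗ D.subtype⟩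
  obtain ⟨g, hgf, hgs⟩ := riesz_extension s f
    (by
      rintro ⟨⟨x, y⟩, hxy⟩ ⟨hx, hy⟩
      obtain rfl : x = y := (hD _).1 hxy
      exact hv' x hx hy)
    (by
      rintro ⟨x, y⟩
      have hlim : ∀ w : Fin d → ℝ, Filter.Tendsto (fun ε : ℝ => z + ε • w)
          (nhdsWithin 0 (Set.Ioi 0)) (nhds z) := by
        intro w
        have : Continuous fun ε : ℝ => z + ε • w := by fun_prop
        simpa using (this.tendsto 0).mono_left nhdsWithin_le_nhds
      obtain ⟨ε, ⟨hε1, hε2⟩, hε⟩ := (((hlim x).eventually (mem_interior_iff_mem_nhds.1 hzA)).and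
        ((hlim y).eventually (mem_interior_iff_mem_nhds.1 hzB))).and self_mem_nhdsWithin |>.exists
      have hε0 : 0 < ε := hε
      have key : ∀ w : Fin d → ℝ, ε⁻¹ • z + w = ε⁻¹ • (z + ε • w) := fun w => by
        rw [smul_add, smul_smul, inv_mul_cancel₀ hε0.ne', one_smul]
      refine ⟨⟨(ε⁻¹ • z, ε⁻¹ • z), (hD _).2 rfl⟩, ?_, ?_⟩
      · change ε⁻¹ • z + x ∈ dualPointedCone K
        rw [key]
        exact PointedCone.smul_mem _ (inv_nonneg.2 hε0.le) hε1
      · change ε⁻¹ • z + y ∈ coneHull d J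
        rw [key]
        exact PointedCone.smul_mem _ (inv_nonneg.2 hε0.le) hε2)
  obtain ⟨k, hk⟩ := exists_eq_dotProduct (g ∘ₗ LinearMap.inl ℝ _ _)
  refine ⟨k, h.mem_of_forall_dualCone fun y hy => ?_, fun n hn => ?_⟩
  · rw [dotProduct_comm, ← hk y]
    exact hgs _ ⟨hy, (coneHull d J).zero_mem⟩
  · have h1 : g (densePt d n, densePt d n) = v ⬝ᵥ densePt d n :=
      hgf ⟨(densePt d n, densePt d n), (hD _).2 rfl⟩
    have h2 : g (densePt d n, densePt d n) =
        g (densePt d n, 0) + g (0, densePt d n) := by rw [← map_add]; simp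
    have h3 : g (densePt d n, 0) = densePt d n ⬝ᵥ k := hk _
    have h4 : 0 ≤ g (0, densePt d n) :=
      hgs _ ⟨(dualPointedCone K).zero_mem, densePt_mem_coneHull hn⟩
    rw [sub_dotProduct, dotProduct_comm k]
    linarith

end Cones

/-! ### The sets of continuation prices -/

section Market

variable {Ω₁ : Type*} [MeasurableSpace Ω₁] {d : ℕ}

/-- The set `A` is charged by some one-step model at `ω`. -/
def Charged {t : ℕ} (𝒬 : (t : ℕ) → (Fin t → Ω₁) → Set (ProbabilityMeasure Ω₁))
    (A : Set (Fin (t + 1) → Ω₁)) (ω : Fin t → Ω₁) : Prop :=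
  ∃ P ∈ 𝒬 t ω, (P : Measure Ω₁) {y | snocFn ω y ∈ A} ≠ 0

/-- The prices at time `t` that extend to price systems over the next `k` periods. -/
def priceSet (𝒬 : (t : ℕ) → (Fin t → Ω₁) → Set (ProbabilityMeasure Ω₁))
    (K : (t : ℕ) → (Fin t → Ω₁) → Set (Fin d → ℝ)) :
    ℕ → (t : ℕ) → (Fin t → Ω₁) → Set (Fin d → ℝ)
  | 0, t, ω => interior (dualCone (K t ω))
  | k + 1, t, ω => interior (dualCone (K t ω)) ∩
      openHull d {n | Charged 𝒬 {ω' | densePt d n ∈ priceSet 𝒬 K k (t + 1) ω'} ω}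

/-- The dense points charged at the next date. -/
def chargedSet (𝒬 : (t : ℕ) → (Fin t → Ω₁) → Set (ProbabilityMeasure Ω₁))
    (K : (t : ℕ) → (Fin t → Ω₁) → Set (Fin d → ℝ)) (k t : ℕ) (ω : Fin t → Ω₁) : Set ℕ :=
  {n | Charged 𝒬 {ω' | densePt d n ∈ priceSet 𝒬 K k (t + 1) ω'} ω}

theorem priceSet_succ (𝒬 : (t : ℕ) → (Fin t → Ω₁) → Set (ProbabilityMeasure Ω₁))
    (K : (t : ℕ) → (Fin t → Ω₁) → Set (Fin d → ℝ)) (k t : ℕ) (ω : Fin t → Ω₁) :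
    priceSet 𝒬 K (k + 1) t ω =
      interior (dualCone (K t ω)) ∩ openHull d (chargedSet 𝒬 K k t ω) := rfl

/-- The standing assumptions on the models and the solvency cones. -/
structure IsMarket [TopologicalSpace Ω₁]
    [OpensMeasurableSpace Ω₁] (𝒬 : (t : ℕ) → (Fin t → Ω₁) → Set (ProbabilityMeasure Ω₁))
    (K : (t : ℕ) → (Fin t → Ω₁) → Set (Fin d → ℝ)) (T : ℕ) : Prop where
  nonempty : ∀ t, t < T → ∀ ω, (𝒬 t ω).Nonempty
  convex : ∀ t, t < T → ∀ ω, ConvexProb (𝒬 t ω)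
  graph : ∀ t, t < T → AnalyticSet {p : (Fin t → Ω₁) × ProbabilityMeasure Ω₁ | p.2 ∈ 𝒬 t p.1}
  solvency : ∀ t, t ≤ T → ∀ ω, IsSolvencyCone (K t ω)
  dualGraph : ∀ t, t ≤ T → AnalyticSet {p : (Fin t → Ω₁) × (Fin d → ℝ) | p.2 ∈ dualCone (K t p.1)}

variable {𝒬 : (t : ℕ) → (Fin t → Ω₁) → Set (ProbabilityMeasure Ω₁)}
  {K : (t : ℕ) → (Fin t → Ω₁) → Set (Fin d → ℝ)} {T : ℕ}

theorem isOpenCone_priceSet (k t : ℕ) (ω : Fin t → Ω₁) : IsOpenCone (priceSet 𝒬 K k t ω) := by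
  cases k with
  | zero => exact isOpenCone_interior_dualCone _
  | succ k => exact (isOpenCone_interior_dualCone _).inter (isOpenCone_openHull _)

theorem priceSet_subset (k t : ℕ) (ω : Fin t → Ω₁) :
    priceSet 𝒬 K k t ω ⊆ interior (dualCone (K t ω)) := by
  cases k with
  | zero => exact subset_rfl
  | succ k => exact inter_subset_left

theorem not_mem_chargedSet {k t n : ℕ} {ω : Fin t → Ω₁} {P : ProbabilityMeasure Ω₁}
    (hP : P ∈ 𝒬 t ω) (hn : n ∉ chargedSet 𝒬 K k t ω) :
    ∀ᵐ y ∂(P : Measure Ω₁), densePt d n ∉ priceSet 𝒬 K k (t + 1) (snocFn ω y) := by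
  by_contra h
  refine hn ⟨P, hP, fun h0 => h ?_⟩
  rw [ae_iff]
  simpa using h0

theorem ae_mem_chargedSet {k t : ℕ} {ω : Fin t → Ω₁} {P : ProbabilityMeasure Ω₁}
    (hP : P ∈ 𝒬 t ω) : ∀ᵐ y ∂(P : Measure Ω₁), ∀ n,
      densePt d n ∈ priceSet 𝒬 K k (t + 1) (snocFn ω y) → n ∈ chargedSet 𝒬 K k t ω := by
  rw [ae_all_iff]
  intro n
  by_cases hn : n ∈ chargedSet 𝒬 K k t ω
  · exact Filter.Eventually.of_forall fun _ _ => hn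
  · filter_upwards [not_mem_chargedSet hP hn] with y hy h
    exact absurd h hy

theorem analyticSet_mem_openHull {X : Type*} [TopologicalSpace X] [PolishSpace X]
    {A : ℕ → Set X} (hA : ∀ n, AnalyticSet (A n)) (z : Fin d → ℝ) :
    AnalyticSet {x | z ∈ openHull d {n | x ∈ A n}} := by
  classical
  have h : {x | z ∈ openHull d {n | x ∈ A n}} =
      ⋃ F : {F : Finset ℕ // z ∈ openHull d F}, ⋂ n : ℕ, if n ∈ F.1 then A n else univ := by
    ext x
    simp only [Set.mem_ofPred_eq, mem_iUnion, mem_iInter]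
    rw [mem_openHull_iff]
    constructor
    · rintro ⟨F, hF, hz⟩
      refine ⟨⟨F, hz⟩, fun n => ?_⟩
      split_ifs with hn
      · exact hF hn
      · trivial
    · rintro ⟨⟨F, hz⟩, h⟩
      refine ⟨F, fun n hn => ?_, hz⟩
      have := h n
      rwa [if_pos (by exact_mod_cast hn)] at this
  rw [h]
  refine AnalyticSet.iUnion fun F => AnalyticSet.iInter fun n => ?_
  split_ifs
  · exact hA n
  · exact isClosed_univ.analyticSet

section Topological

variable [TopologicalSpace Ω₁] [PolishSpace Ω₁] [BorelSpace Ω₁]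

theorem IsMarket.analyticSet_interior_dualCone (hM : IsMarket 𝒬 K T) {t : ℕ} (ht : t ≤ T)
    (z : Fin d → ℝ) : AnalyticSet {ω | z ∈ interior (dualCone (K t ω))} := by
  have h : ∀ n, AnalyticSet {ω : Fin t → Ω₁ | densePt d n ∈ dualCone (K t ω)} := fun n =>
    (hM.dualGraph t ht).preimage (f := fun ω => (ω, densePt d n)) (by fun_prop)
  convert analyticSet_mem_openHull h z using 3 with ω
  rw [← coe_dualPointedCone, ← openHull_setOf_densePt_mem]
  rfl

theorem IsMarket.analyticSet_charged (hM : IsMarket 𝒬 K T) {t : ℕ} (ht : t < T)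
    {A : Set (Fin (t + 1) → Ω₁)} (hA : AnalyticSet A) : AnalyticSet {ω | Charged 𝒬 A ω} := by
  convert (AnalyticSet.setOf_section_ne_zero (continuous_snocFn (Ω₁ := Ω₁) (t := t))
    (hM.graph t ht) hA).image_of_continuous continuous_fst using 1
  ext ω
  simp [Charged]

theorem IsMarket.analyticSet_priceSet (hM : IsMarket 𝒬 K T) {k : ℕ} : ∀ {t : ℕ}, t + k = T →
    ∀ z, AnalyticSet {ω | z ∈ priceSet 𝒬 K k t ω} := by
  induction k with
  | zero => exact fun ht z => hM.analyticSet_interior_dualCone (by omega) z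
  | succ k ih =>
    intro t ht z
    rw [show {ω | z ∈ priceSet 𝒬 K (k + 1) t ω} = {ω | z ∈ interior (dualCone (K t ω))} ∩
      {ω | z ∈ openHull d (chargedSet 𝒬 K k t ω)} from rfl]
    rw [inter_eq_iInter]
    refine AnalyticSet.iInter fun b => ?_
    cases b
    · exact analyticSet_mem_openHull
        (fun n => hM.analyticSet_charged (by omega) (ih (by omega) (densePt d n))) z
    · exact hM.analyticSet_interior_dualCone (by omega) z

theorem IsMarket.univMeasurableSet_mem_chargedSet (hM : IsMarket 𝒬 K T) {k t : ℕ}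
    (ht : t + (k + 1) = T) (n : ℕ) : UnivMeasurableSet {ω | n ∈ chargedSet 𝒬 K k t ω} :=
  (hM.analyticSet_charged (by omega)
    (hM.analyticSet_priceSet (by omega) (densePt d n))).univMeasurableSet

end Topological

theorem attainable_of_neg_mem (hK : ∀ t ≤ T, ∀ ω, IsSolvencyCone (K t ω)) {t : ℕ} (ht : t ≤ T)
    {g : (Fin t → Ω₁) → Fin d → ℝ} (hg : UnivMeasurable g) (hgK : ∀ ω, -g ω ∈ K t ω) :
    Attainable K t g := by
  classical
  refine ⟨fun s ω => if s = t then g ω else 0, fun s hs => ?_, fun ω => ?_⟩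
  · rcases hs.eq_or_lt with rfl | hs'
    · exact ⟨g, hg, hgK, fun ω => if_pos rfl⟩
    · refine ⟨fun _ => 0, measurable_const.univMeasurable, fun ω => ?_, fun ω => if_neg hs'.ne⟩
      rw [Set.mem_neg, neg_zero]
      exact (hK s (hs.trans ht) ω).zero_mem
  · simp

theorem Attainable.add (hK : ∀ t ≤ T, ∀ ω, IsSolvencyCone (K t ω)) {t : ℕ} (ht : t ≤ T)
    {f g : (Fin t → Ω₁) → Fin d → ℝ} (hf : Attainable K t f) (hg : Attainable K t g) :
    Attainable K t (f + g) := by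
  obtain ⟨ξ, hξ, hf⟩ := hf
  obtain ⟨η, hη, hg⟩ := hg
  refine ⟨ξ + η, fun s hs => ?_, fun ω => ?_⟩
  · obtain ⟨a, ha, haK, haξ⟩ := hξ s hs
    obtain ⟨b, hb, hbK, hbη⟩ := hη s hs
    refine ⟨a + b, Measurable.add (m := univComp _) ha hb, fun ω => ?_, fun ω => ?_⟩
    · rw [Set.mem_neg, Pi.add_apply, neg_add]
      exact (hK s (hs.trans ht) ω).add_mem (haK ω) (hbK ω)
    · simp [haξ, hbη]
  · simp [hf, hg, Finset.sum_add_distrib]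

theorem Attainable.proj_succ (hK : ∀ t ≤ T, ∀ ω, IsSolvencyCone (K t ω)) {t : ℕ} (ht : t + 1 ≤ T)
    {f : (Fin t → Ω₁) → Fin d → ℝ} (hf : Attainable K t f) :
    Attainable K (t + 1) fun ω => f (proj (t + 1) t t.le_succ ω) := by
  classical
  obtain ⟨ξ, hξ, hf⟩ := hf
  refine ⟨fun s ω => if s ≤ t then ξ s (proj (t + 1) t t.le_succ ω) else 0, fun s hs => ?_,
    fun ω => ?_⟩
  · by_cases hst : s ≤ t
    · obtain ⟨a, ha, haK, haξ⟩ := hξ s hst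
      refine ⟨a, ha, haK, fun ω => ?_⟩
      simp only [if_pos hst, haξ]
      rfl
    · refine ⟨fun _ => 0, measurable_const.univMeasurable, fun ω => ?_, fun ω => if_neg hst⟩
      rw [Set.mem_neg, neg_zero]
      exact (hK s (hs.trans ht) ω).zero_mem
  · rw [Finset.sum_range_succ]
    simp only [if_neg (by omega : ¬ t + 1 ≤ t), add_zero, hf]
    refine Finset.sum_congr rfl fun s hs => ?_
    rw [if_pos (by have := Finset.mem_range.1 hs; omega)]

end Market

/-! ### No-arbitrage and continuation prices -/

section Selection

variable {X : Type*} [MeasurableSpace X] {d : ℕ}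

theorem UnivMeasurable.prodMk {Y Z : Type*} [MeasurableSpace Y] [MeasurableSpace Z] {f : X → Y}
    {g : X → Z} (hf : UnivMeasurable f) (hg : UnivMeasurable g) :
    UnivMeasurable fun x => (f x, g x) :=
  Measurable.prodMk (m := univComp X) hf hg

theorem univMeasurable_indicator_seq {A : X → Set ℕ}
    (hA : ∀ n, UnivMeasurableSet {x | n ∈ A x}) :
    ∃ a : X → ℕ → Bool, UnivMeasurable a ∧ ∀ x n, a x n = true ↔ n ∈ A x := by
  classical
  refine ⟨fun x n => decide (n ∈ A x), ?_, fun x n => by simp⟩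
  refine @measurable_pi_lambda X ℕ (fun _ => Bool) (univComp X) _ _ fun n => ?_
  refine @measurable_to_bool X (univComp X) _ ?_
  have h : (fun x => decide (n ∈ A x)) ⁻¹' {true} = {x | n ∈ A x} := by
    ext x
    simp
  exact h ▸ hA n

/-- Universally measurable choice of a point satisfying countably many linear constraints. -/
theorem exists_univMeasurable_separating {A B : X → Set ℕ}
    (hA : ∀ n, UnivMeasurableSet {x | n ∈ A x}) (hB : ∀ n, UnivMeasurableSet {x | n ∈ B x})
    {v : X → Fin d → ℝ} (hv : UnivMeasurable v) {U : Set (Fin d → ℝ)} (hU : MeasurableSet U) :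
    ∃ g : X → Fin d → ℝ, UnivMeasurable g ∧ ∀ x,
      (∃ w ∈ U, (∀ n ∈ A x, 0 ≤ w ⬝ᵥ densePt d n) ∧ ∀ n ∈ B x, 0 ≤ (v x - w) ⬝ᵥ densePt d n) →
      g x ∈ U ∧ (∀ n ∈ A x, 0 ≤ g x ⬝ᵥ densePt d n) ∧
        ∀ n ∈ B x, 0 ≤ (v x - g x) ⬝ᵥ densePt d n := by
  obtain ⟨a, ha, haA⟩ := univMeasurable_indicator_seq hA
  obtain ⟨b, hb, hbB⟩ := univMeasurable_indicator_seq hB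
  let E : Set (((ℕ → Bool) × (ℕ → Bool) × (Fin d → ℝ)) × (Fin d → ℝ)) :=
    {p | p.2 ∈ U ∧ (∀ n, p.1.1 n = true → 0 ≤ p.2 ⬝ᵥ densePt d n) ∧
      ∀ n, p.1.2.1 n = true → 0 ≤ (p.1.2.2 - p.2) ⬝ᵥ densePt d n}
  have hE : MeasurableSet E := by
    have h1 : ∀ n, Measurable fun p : ((ℕ → Bool) × (ℕ → Bool) × (Fin d → ℝ)) × (Fin d → ℝ) =>
        p.2 ⬝ᵥ densePt d n := fun n => by unfold dotProduct; fun_prop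
    have h2 : ∀ n, Measurable fun p : ((ℕ → Bool) × (ℕ → Bool) × (Fin d → ℝ)) × (Fin d → ℝ) =>
        (p.1.2.2 - p.2) ⬝ᵥ densePt d n := fun n => by
      unfold dotProduct
      simp only [Pi.sub_apply]
      fun_prop
    refine (measurable_snd hU).inter (.inter ?_ ?_)
    · refine (MeasurableSet.iInter fun n => (MeasurableSet.imp (p := fun p :
        ((ℕ → Bool) × (ℕ → Bool) × (Fin d → ℝ)) × (Fin d → ℝ) => p.1.1 n = true)
        (q := fun p => 0 ≤ p.2 ⬝ᵥ densePt d n) ?_ ?_)).congr ?_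
      · exact measurableSet_eq_fun (by fun_prop) measurable_const
      · exact measurableSet_le measurable_const (h1 n)
      · ext p; simp only [mem_iInter]; rfl
    · refine (MeasurableSet.iInter fun n => (MeasurableSet.imp (p := fun p :
        ((ℕ → Bool) × (ℕ → Bool) × (Fin d → ℝ)) × (Fin d → ℝ) => p.1.2.1 n = true)
        (q := fun p => 0 ≤ (p.1.2.2 - p.2) ⬝ᵥ densePt d n) ?_ ?_)).congr ?_
      · exact measurableSet_eq_fun (by fun_prop) measurable_const
      · exact measurableSet_le measurable_const (h2 n)
      · ext p; simp only [mem_iInter]; rfl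
  have : PolishSpace (((ℕ → Bool) × (ℕ → Bool) × (Fin d → ℝ)) × (Fin d → ℝ)) := {}
  obtain ⟨g, hg, hgE⟩ := hE.analyticSet.exists_univMeasurable_selection
  refine ⟨_, hg.comp (ha.prodMk (hb.prodMk hv)), fun x ⟨w, hwU, hwA, hwB⟩ => ?_⟩
  obtain ⟨h1, h2, h3⟩ := hgE (a x, b x, v x) ⟨w, hwU, fun n hn => hwA n ((haA x n).1 hn),
    fun n hn => hwB n ((hbB x n).1 hn)⟩
  exact ⟨h1, fun n hn => h2 n ((haA x n).2 hn), fun n hn => h3 n ((hbB x n).2 hn)⟩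

theorem univMeasurableSet_forall_dotProduct_nonneg {A : X → Set ℕ}
    (hA : ∀ n, UnivMeasurableSet {x | n ∈ A x}) {f : X → Fin d → ℝ} (hf : UnivMeasurable f) :
    UnivMeasurableSet {x | ∀ n ∈ A x, 0 ≤ f x ⬝ᵥ densePt d n} := by
  have h : {x | ∀ n ∈ A x, 0 ≤ f x ⬝ᵥ densePt d n} =
      ⋂ n, ({x | n ∈ A x}ᶜ ∪ f ⁻¹' {y | 0 ≤ y ⬝ᵥ densePt d n}) := by
    ext x
    simp [imp_iff_not_or]
  rw [h]
  refine MeasurableSet.iInter fun n => (MeasurableSet.compl (hA n)).union (hf ?_)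
  exact measurableSet_le measurable_const (by unfold dotProduct; fun_prop)

end Selection

section NoArbitrage

variable {Ω₁ : Type*} [TopologicalSpace Ω₁] [PolishSpace Ω₁] [MeasurableSpace Ω₁] [BorelSpace Ω₁]
  {d : ℕ} {𝒬 : (t : ℕ) → (Fin t → Ω₁) → Set (ProbabilityMeasure Ω₁)}
  {K : (t : ℕ) → (Fin t → Ω₁) → Set (Fin d → ℝ)} {T : ℕ}

theorem IsMarket.univMeasurableSet_mem_dualCone (hM : IsMarket 𝒬 K T) {t : ℕ} (ht : t ≤ T)
    (n : ℕ) : UnivMeasurableSet {ω | n ∈ {n | densePt d n ∈ dualCone (K t ω)}} :=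
  ((hM.dualGraph t ht).preimage (f := fun ω => (ω, densePt d n))
    (by fun_prop)).univMeasurableSet

theorem IsMarket.univMeasurableSet_nonempty_interior (hM : IsMarket 𝒬 K T) {t : ℕ} (ht : t ≤ T) :
    UnivMeasurableSet {ω | (interior (dualCone (K t ω))).Nonempty} := by
  have h : {ω | (interior (dualCone (K t ω))).Nonempty} =
      ⋃ n, {ω | densePt d n ∈ interior (dualCone (K t ω))} := by
    ext ω
    simp only [Set.mem_ofPred_eq, mem_iUnion]
    exact ⟨exists_densePt_mem isOpen_interior, fun ⟨n, hn⟩ => ⟨_, hn⟩⟩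
  rw [h]
  exact MeasurableSet.iUnion fun n => (hM.analyticSet_interior_dualCone ht _).univMeasurableSet

/-- Universally measurable choice of a solvent portfolio satisfying linear constraints. -/
theorem IsMarket.exists_selection (hM : IsMarket 𝒬 K T) {t : ℕ} (ht : t ≤ T)
    {B : (Fin t → Ω₁) → Set ℕ} (hB : ∀ n, UnivMeasurableSet {x | n ∈ B x})
    {v : (Fin t → Ω₁) → Fin d → ℝ} (hv : UnivMeasurable v) {U : Set (Fin d → ℝ)}
    (hU : MeasurableSet U) :
    ∃ g : (Fin t → Ω₁) → Fin d → ℝ, UnivMeasurable g ∧ (∀ ω, g ω ∈ K t ω) ∧ ∀ ω,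
      (interior (dualCone (K t ω))).Nonempty →
      (∃ w ∈ U, w ∈ K t ω ∧ ∀ n ∈ B ω, 0 ≤ (v ω - w) ⬝ᵥ densePt d n) →
      g ω ∈ U ∧ ∀ n ∈ B ω, 0 ≤ (v ω - g ω) ⬝ᵥ densePt d n := by
  classical
  have hA := hM.univMeasurableSet_mem_dualCone ht
  obtain ⟨g, hg, hgE⟩ := exists_univMeasurable_separating hA hB hv hU
  have hS := (hM.univMeasurableSet_nonempty_interior ht).inter
    (univMeasurableSet_forall_dotProduct_nonneg hA hg)
  have hmem : ∀ ω, (interior (dualCone (K t ω))).Nonempty →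
      (∀ n, densePt d n ∈ dualCone (K t ω) → 0 ≤ g ω ⬝ᵥ densePt d n) → g ω ∈ K t ω :=
    fun ω hne h => (hM.solvency t ht ω).mem_of_forall_interior hne
      (dotProduct_nonneg_of_densePt isOpen_interior fun n hn => h n (interior_subset hn))
  refine ⟨_, Measurable.indicator (m := univComp _) hg hS, fun ω => ?_, fun ω hne hw => ?_⟩
  · rw [indicator_apply]
    split_ifs with h
    · exact hmem ω h.1 h.2
    · exact (hM.solvency t ht ω).zero_mem
  · obtain ⟨w, hwU, hwK, hwB⟩ := hw
    obtain ⟨h1, h2, h3⟩ := hgE ω ⟨w, hwU, fun n hn => hn w hwK, hwB⟩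
    have hmemS : ω ∈ {ω | (interior (dualCone (K t ω))).Nonempty} ∩
        {x | ∀ n ∈ {n | densePt d n ∈ dualCone (K t x)}, 0 ≤ g x ⬝ᵥ densePt d n} := ⟨hne, h2⟩
    rw [indicator_of_mem hmemS]
    exact ⟨h1, h3⟩

theorem IsMarket.quasiSurely_nonneg_priceSet (hM : IsMarket 𝒬 K T) {k t : ℕ}
    (ht : t + (k + 1) = T) {f : (Fin t → Ω₁) → Fin d → ℝ} (hf : UnivMeasurable f)
    (h : QuasiSurely 𝒬 t fun ω => ∀ n ∈ chargedSet 𝒬 K k t ω, 0 ≤ f ω ⬝ᵥ densePt d n) :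
    QuasiSurely 𝒬 (t + 1) fun ω => ∀ n, densePt d n ∈ priceSet 𝒬 K k (t + 1) ω →
      0 ≤ f (proj (t + 1) t t.le_succ ω) ⬝ᵥ densePt d n := by
  refine forall_mem_prodSet.2 fun P hP => ?_
  have hs : UnivMeasurableSet {ω | ∀ n ∈ {n | densePt d n ∈ priceSet 𝒬 K k (t + 1) ω},
      0 ≤ f (proj (t + 1) t t.le_succ ω) ⬝ᵥ densePt d n} :=
    univMeasurableSet_forall_dotProduct_nonneg
      (fun n => (hM.analyticSet_priceSet (by omega) (densePt d n)).univMeasurableSet)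
      (hf.comp_measurable (measurable_proj _))
  refine (hP.univKernels.ae_succ_iff hs).2 ?_
  filter_upwards [h.ae_prodProb (hP.mono t.le_succ)] with ω hω
  filter_upwards [ae_mem_chargedSet (K := K) (k := k) ((hP t t.lt_succ_self).2 ω)] with y hy n hn
  rw [proj_snocFn]
  exact hω n (hy n hn)

variable [Nonempty Ω₁]

theorem IsMarket.exists_kernel (hM : IsMarket 𝒬 K T) {t : ℕ} (ht : t < T) :
    ∃ κ : (Fin t → Ω₁) → ProbabilityMeasure Ω₁, UnivMeasurable (fun ω => (κ ω : Measure Ω₁)) ∧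
      ∀ ω, κ ω ∈ 𝒬 t ω := by
  obtain ⟨κ, hκ, h⟩ := (hM.graph t ht).exists_kernel_selection
  exact ⟨κ, hκ, fun ω => h ω (hM.nonempty t ht ω)⟩

theorem QuasiSurely.of_proj_succ (hM : IsMarket 𝒬 K T) {t : ℕ} (ht : t < T)
    {p : (Fin t → Ω₁) → Prop}
    (hp : QuasiSurely 𝒬 (t + 1) fun ω => p (proj (t + 1) t t.le_succ ω)) : QuasiSurely 𝒬 t p := by
  obtain ⟨κ, hκ, hκ𝒬⟩ := hM.exists_kernel ht
  refine forall_mem_prodSet.2 fun P hP => ?_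
  filter_upwards [hp.ae_ae hP hκ hκ𝒬] with ω hω
  simp only [proj_snocFn] at hω
  obtain ⟨_, h⟩ := hω.exists
  exact h

theorem IsMarket.nonempty_openHull_chargedSet (hM : IsMarket 𝒬 K T) {k t : ℕ} (ht : t < T)
    (h : QuasiSurely 𝒬 (t + 1) fun ω => (priceSet 𝒬 K k (t + 1) ω).Nonempty) :
    QuasiSurely 𝒬 t fun ω => (openHull d (chargedSet 𝒬 K k t ω)).Nonempty := by
  obtain ⟨κ, hκ, hκ𝒬⟩ := hM.exists_kernel ht
  refine forall_mem_prodSet.2 fun P hP => ?_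
  filter_upwards [h.ae_ae hP hκ hκ𝒬] with ω hω
  obtain ⟨y, ⟨z, hz⟩, h2⟩ := (hω.and (ae_mem_chargedSet (K := K) (k := k) (hκ𝒬 ω))).exists
  exact ⟨z, openHull_mono (fun n hn => h2 n hn)
    (subset_openHull (isOpenCone_priceSet k (t + 1) _).isOpen hz)⟩

/-- Under no-arbitrage and efficient friction the continuation price sets are nonempty, and
attainable claims that are nonnegative under all continuation prices vanish. -/
theorem IsMarket.priceSet_nonempty_and_eq_zero (hM : IsMarket 𝒬 K T)
    (hNA : StrictNoArbitrage 𝒬 K T) (hEF : EfficientFriction 𝒬 K T) (k : ℕ) :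
    ∀ t, t + k = T → (QuasiSurely 𝒬 t fun ω => (priceSet 𝒬 K k t ω).Nonempty) ∧
      ∀ g, UnivMeasurable g → Attainable K t g →
        (QuasiSurely 𝒬 t fun ω => ∀ n, densePt d n ∈ priceSet 𝒬 K k t ω →
          0 ≤ g ω ⬝ᵥ densePt d n) → QuasiSurely 𝒬 t fun ω => g ω = 0 := by
  classical
  have key : ∀ t ≤ T, ∀ g, UnivMeasurable g → Attainable K t g →
      (QuasiSurely 𝒬 t fun ω => g ω ∈ K t ω) → QuasiSurely 𝒬 t fun ω => g ω = 0 := by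
    intro t ht g hg hgA hgK μ hμ
    filter_upwards [hNA t ht g hgA hg hgK μ hμ, hEF t ht μ hμ] with ω h1 h2
    exact eq_zero_of_mem_neg_mem h2 h1.1 h1.2
  induction k with
  | zero =>
    intro t ht
    refine ⟨hEF t (by omega), fun g hg hgA h => key t (by omega) g hg hgA fun μ hμ => ?_⟩
    filter_upwards [h μ hμ, hEF t (by omega) μ hμ] with ω h1 h2
    exact (hM.solvency t (by omega) ω).mem_of_forall_interior h2
      (dotProduct_nonneg_of_densePt isOpen_interior h1)
  | succ k ih =>
    intro t ht
    have htT : t < T := by omega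
    obtain ⟨ih1, ih2⟩ := ih (t + 1) (by omega)
    have hopen := hM.nonempty_openHull_chargedSet htT ih1
    have hB := hM.univMeasurableSet_mem_chargedSet ht
    have vanish : ∀ f : (Fin t → Ω₁) → Fin d → ℝ, UnivMeasurable f → Attainable K t f →
        (QuasiSurely 𝒬 t fun ω => ∀ n ∈ chargedSet 𝒬 K k t ω, 0 ≤ f ω ⬝ᵥ densePt d n) →
        QuasiSurely 𝒬 t fun ω => f ω = 0 := fun f hf hfA h =>
      QuasiSurely.of_proj_succ hM htT (ih2 _ (hf.comp_measurable (measurable_proj _))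
        (hfA.proj_succ hM.solvency htT) (hM.quasiSurely_nonneg_priceSet ht hf h))
    have hne : QuasiSurely 𝒬 t fun ω => (priceSet 𝒬 K (k + 1) t ω).Nonempty := by
      obtain ⟨g, hg, hgK, hgsel⟩ := hM.exists_selection htT.le hB
        (measurable_const (a := (0 : Fin d → ℝ))).univMeasurable
        (measurableSet_singleton (0 : Fin d → ℝ)).compl
      have hsep : ∀ ω, (interior (dualCone (K t ω))).Nonempty →
          (openHull d (chargedSet 𝒬 K k t ω)).Nonempty →
          ¬ (priceSet 𝒬 K (k + 1) t ω).Nonempty → g ω ∈ ({0} : Set (Fin d → ℝ))ᶜ ∧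
            ∀ n ∈ chargedSet 𝒬 K k t ω, 0 ≤ (0 - g ω) ⬝ᵥ densePt d n := by
        intro ω h1 h2 h3
        rw [priceSet_succ, ← Set.disjoint_iff_inter_eq_empty.trans
          Set.not_nonempty_iff_eq_empty.symm] at h3
        obtain ⟨x, hx0, hxK, hx⟩ := (hM.solvency t htT.le ω).exists_separating h1 h2 h3
        exact hgsel ω h1 ⟨-x, by simpa using hx0, hxK, by simpa using hx⟩
      -- the selected portfolio, restricted to the set where it is an arbitrage
      have hS := univMeasurableSet_forall_dotProduct_nonneg hB
        (f := fun ω => 0 - g ω) (Measurable.const_sub (m := univComp _) hg 0)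
      have hf : UnivMeasurable ({ω | ∀ n ∈ chargedSet 𝒬 K k t ω,
          0 ≤ (0 - g ω) ⬝ᵥ densePt d n}.indicator fun ω => 0 - g ω) :=
        Measurable.indicator (m := univComp _)
          (Measurable.const_sub (m := univComp _) hg 0) hS
      have h0 := vanish _ hf (attainable_of_neg_mem hM.solvency htT.le hf fun ω => by
        rw [indicator_apply]
        split_ifs
        · simpa using hgK ω
        · simpa using (hM.solvency t htT.le ω).zero_mem) fun μ _ =>
            Filter.Eventually.of_forall fun ω n hn => by
          rw [indicator_apply]
          split_ifs with h
          · exact h n hn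
          · simp
      intro μ hμ
      filter_upwards [h0 μ hμ, hopen μ hμ, hEF t htT.le μ hμ] with ω h1 h2 h3
      by_contra h4
      obtain ⟨h5, h6⟩ := hsep ω h3 h2 h4
      have hmemS : ω ∈ {ω | ∀ n ∈ chargedSet 𝒬 K k t ω, 0 ≤ (0 - g ω) ⬝ᵥ densePt d n} := h6
      rw [indicator_of_mem hmemS] at h1
      exact h5 (by simpa using h1)
    refine ⟨hne, fun g hg hgA h => key t htT.le g hg hgA ?_⟩
    obtain ⟨x, hx, hxK, hxsel⟩ := hM.exists_selection htT.le hB hg MeasurableSet.univ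
    have hsel : QuasiSurely 𝒬 t fun ω =>
        ∀ n ∈ chargedSet 𝒬 K k t ω, 0 ≤ (g + -x) ω ⬝ᵥ densePt d n := by
      intro μ hμ
      filter_upwards [h μ hμ, hne μ hμ] with ω h1 h2
      obtain ⟨w, hwK, hw⟩ := (hM.solvency t htT.le ω).exists_add_of_nonneg h2
        (dotProduct_nonneg_of_densePt (isOpenCone_priceSet (k + 1) t ω).isOpen h1)
      have := (hxsel ω (h2.mono inter_subset_left) ⟨w, trivial, hwK, hw⟩).2
      simpa [sub_eq_add_neg] using this
    have hx' : UnivMeasurable (-x) := Measurable.neg (m := univComp _) hx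
    have h0 := vanish (g + -x) (Measurable.add (m := univComp _) hg hx')
      (hgA.add hM.solvency htT.le
        (attainable_of_neg_mem hM.solvency htT.le hx' fun ω => by simpa using hxK ω)) hsel
    intro μ hμ
    filter_upwards [h0 μ hμ] with ω hω
    have : g ω = x ω := by simpa [add_neg_eq_zero] using hω
    rw [this]
    exact hxK ω

end NoArbitrage

/-! ### Construction of the next price -/

section NextPrice

variable {d : ℕ}

theorem lintegral_ofReal_add_sum_indicator {Y : Type*} [MeasurableSpace Y] (μ : Measure Y)
    [IsProbabilityMeasure μ] {y₀ : Y → ℝ} (hy₀ : AEMeasurable y₀ μ) (hy₀0 : ∀ᵐ y ∂μ, 0 ≤ y₀ y)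
    (hy₀1 : ∀ y, y₀ y ≤ 1) {ε : ℝ} (hε : 0 ≤ ε) (F : Finset ℕ) {A : ℕ → Set Y}
    (hA : ∀ m, NullMeasurableSet (A m) μ) {c q : ℕ → ℝ} (hc : ∀ m ∈ F, 0 ≤ c m)
    (hq : ∀ m ∈ F, 0 ≤ q m) (hAF : ∀ m ∈ F, μ (A m) ≠ 0) :
    ∫⁻ y, ENNReal.ofReal (ε * y₀ y + ∑ m ∈ F,
        (A m).indicator (fun _ => c m / (μ (A m)).toReal * q m) y) ∂μ =
      ENNReal.ofReal (ε * (∫⁻ y, ENNReal.ofReal (y₀ y) ∂μ).toReal + ∑ m ∈ F, c m * q m) := by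
  have hfin : ∫⁻ y, ENNReal.ofReal (y₀ y) ∂μ ≠ ∞ := by
    refine ((lintegral_mono fun y => ENNReal.ofReal_le_ofReal (hy₀1 y)).trans_lt ?_).ne
    simp
  have hpos : ∀ m ∈ F, 0 < (μ (A m)).toReal := fun m hm =>
    ENNReal.toReal_pos (hAF m hm) (measure_ne_top _ _)
  have hterm : ∀ m ∈ F, 0 ≤ c m / (μ (A m)).toReal * q m := fun m hm =>
    mul_nonneg (div_nonneg (hc m hm) (hpos m hm).le) (hq m hm)
  have hind : ∀ m ∈ F, ∀ y, 0 ≤ (A m).indicator (fun _ => c m / (μ (A m)).toReal * q m) y :=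
    fun m hm y => indicator_nonneg (fun _ _ => hterm m hm) y
  have h1 : ∀ᵐ y ∂μ, ENNReal.ofReal (ε * y₀ y + ∑ m ∈ F,
        (A m).indicator (fun _ => c m / (μ (A m)).toReal * q m) y) =
      ENNReal.ofReal ε * ENNReal.ofReal (y₀ y) + ∑ m ∈ F,
        (A m).indicator (fun _ => ENNReal.ofReal (c m / (μ (A m)).toReal * q m)) y := by
    filter_upwards [hy₀0] with y hy
    rw [ENNReal.ofReal_add (mul_nonneg hε hy) (Finset.sum_nonneg fun m hm => hind m hm y),
      ENNReal.ofReal_mul hε, ENNReal.ofReal_sum_of_nonneg fun m hm => hind m hm y]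
    congr 1
    refine Finset.sum_congr rfl fun m hm => ?_
    by_cases hy : y ∈ A m
    · simp [hy]
    · simp [hy]
  rw [lintegral_congr_ae h1, lintegral_add_left' (hy₀.ennreal_ofReal.const_mul _),
    lintegral_const_mul'' _ hy₀.ennreal_ofReal, lintegral_finsetSum' _ fun m _ =>
      (aemeasurable_const.indicator₀ (hA m)),
    ENNReal.ofReal_add (mul_nonneg hε ENNReal.toReal_nonneg)
      (Finset.sum_nonneg fun m hm => mul_nonneg (hc m hm) (hq m hm)),
    ENNReal.ofReal_mul hε, ENNReal.ofReal_toReal hfin,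
    ENNReal.ofReal_sum_of_nonneg fun m hm => mul_nonneg (hc m hm) (hq m hm)]
  congr 1
  refine Finset.sum_congr rfl fun m hm => ?_
  rw [lintegral_indicator_const₀ (hA m)]
  have hne := (hpos m hm).ne'
  have hofReal : μ (A m) = ENNReal.ofReal (μ (A m)).toReal :=
    (ENNReal.ofReal_toReal (measure_ne_top _ _)).symm
  calc ENNReal.ofReal (c m / (μ (A m)).toReal * q m) * μ (A m)
      = ENNReal.ofReal (c m / (μ (A m)).toReal * q m) * ENNReal.ofReal (μ (A m)).toReal :=
        congrArg _ hofReal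
    _ = ENNReal.ofReal (c m * q m) := by
      rw [← ENNReal.ofReal_mul (hterm m hm)]
      congr 1
      field_simp

theorem exists_coeff_of_mem_coneHull {F : Finset ℕ} {z : Fin d → ℝ} (hz : z ∈ coneHull d F) :
    ∃ a : ℕ → ℝ, (∀ m ∈ F, 0 ≤ a m) ∧ ∑ m ∈ F, a m • densePt d m = z := by
  classical
  rw [coneHull, PointedCone.hull, Submodule.mem_span_image_finset_iff_exists_fun] at hz
  obtain ⟨a, rfl⟩ := hz
  refine ⟨fun m => if h : m ∈ F then a ⟨m, h⟩ else 0, fun m hm => ?_, ?_⟩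
  · simp only [dif_pos hm]
    exact (a ⟨m, hm⟩).2
  · rw [← Finset.sum_coe_sort F]
    refine Finset.sum_congr rfl fun m _ => ?_
    simp only [dif_pos m.2]
    rfl

/-- Measurable choice of nonnegative coefficients representing points of a finitely generated
cone. -/
theorem exists_univMeasurable_coeff (F : Finset ℕ) :
    ∃ c : (Fin d → ℝ) → ℕ → ℝ, UnivMeasurable c ∧ ∀ z ∈ coneHull d F,
      (∀ m ∈ F, 0 ≤ c z m) ∧ ∑ m ∈ F, c z m • densePt d m = z := by
  let E : Set ((Fin d → ℝ) × (ℕ → ℝ)) :=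
    {p | (∀ m ∈ F, 0 ≤ p.2 m) ∧ ∑ m ∈ F, p.2 m • densePt d m = p.1}
  have hE : IsClosed E := by
    refine IsClosed.inter ?_ (isClosed_eq (by fun_prop) (by fun_prop))
    have : IsClosed (⋂ m ∈ F, {p : (Fin d → ℝ) × (ℕ → ℝ) | 0 ≤ p.2 m}) :=
      isClosed_biInter fun m _ => isClosed_le continuous_const (by fun_prop)
    have heq : (⋂ m ∈ F, {p : (Fin d → ℝ) × (ℕ → ℝ) | 0 ≤ p.2 m}) =
        {p | ∀ m ∈ F, 0 ≤ p.2 m} := by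
      ext p
      simp
    rw [heq] at this
    exact this
  obtain ⟨c, hc, h⟩ := hE.analyticSet.exists_univMeasurable_selection
  exact ⟨c, hc, fun z hz => h z (exists_coeff_of_mem_coneHull hz)⟩

theorem IsOpenCone.add_sum_mem {S : Set (Fin d → ℝ)} (h : IsOpenCone S) {x : Fin d → ℝ}
    (hx : x ∈ S) (F : Finset ℕ) {v : ℕ → Fin d → ℝ}
    (hv : ∀ m ∈ F, v m = 0 ∨ ∃ c : ℝ, 0 ≤ c ∧ ∃ y ∈ S, v m = c • y) : x + ∑ m ∈ F, v m ∈ S := by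
  classical
  induction F using Finset.induction_on with
  | empty => simpa
  | insert m F hm ih =>
    have ih' := ih fun n hn => hv n (Finset.mem_insert_of_mem hn)
    rw [Finset.sum_insert hm, add_comm (v m), ← add_assoc]
    rcases hv m (Finset.mem_insert_self m F) with h0 | ⟨c, hc, y, hy, h0⟩
    · rwa [h0, add_zero]
    · rw [h0]
      exact h.add_smul_mem ih' hy hc

theorem IsOpenCone.mem_iff_mem_openHull {S : Set (Fin d → ℝ)} (h : IsOpenCone S)
    (hne : S.Nonempty) {z : Fin d → ℝ} : z ∈ S ↔ z ∈ openHull d {n | densePt d n ∈ S} := by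
  refine ⟨fun hz => subset_openHull h.isOpen hz, fun hz => ?_⟩
  obtain ⟨u, hu⟩ := hne
  have hc : Filter.Tendsto (fun ε : ℝ => z - ε • u) (nhdsWithin 0 (Set.Ioi 0)) (nhds z) := by
    have : Continuous fun ε : ℝ => z - ε • u := by fun_prop
    simpa using (this.tendsto 0).mono_left nhdsWithin_le_nhds
  obtain ⟨ε, hε, hε0⟩ := ((hc.eventually (mem_interior_iff_mem_nhds.1 hz)).and
    self_mem_nhdsWithin).exists
  have hsub : ∀ y ∈ coneHull d {n | densePt d n ∈ S}, y = 0 ∨ y ∈ S := by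
    intro y hy
    obtain ⟨F, hF, hyF⟩ := exists_finset_mem_coneHull hy
    obtain ⟨a, ha0, rfl⟩ := exists_coeff_of_mem_coneHull hyF
    by_cases ha : ∀ m ∈ F, a m = 0
    · exact Or.inl (Finset.sum_eq_zero fun m hm => by rw [ha m hm, zero_smul])
    · push Not at ha
      obtain ⟨m, hm, ham⟩ := ha
      right
      rw [← Finset.add_sum_erase F _ hm]
      refine h.add_sum_mem (h.smul_mem (c := a m) ?_ (hF hm)) _ fun n hn => Or.inr
        ⟨a n, ha0 n (Finset.mem_of_mem_erase hn), _, hF (Finset.mem_of_mem_erase hn), rfl⟩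
      exact lt_of_le_of_ne (ha0 m hm) (Ne.symm ham)
  have := hsub _ hε
  rw [← sub_add_cancel z (ε • u)]
  rcases this with h0 | h0
  · rw [h0, zero_add]
    exact h.smul_mem hε0 hu
  · exact h.add_mem h0 (h.smul_mem hε0 hu)

theorem univMeasurableSet_mem_openHull {X : Type*} [MeasurableSpace X] {A : X → Set ℕ}
    (hA : ∀ n, UnivMeasurableSet {x | n ∈ A x}) {f : X → Fin d → ℝ} (hf : UnivMeasurable f) :
    UnivMeasurableSet {x | f x ∈ openHull d (A x)} := by
  have h : {x | f x ∈ openHull d (A x)} =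
      ⋃ F : Finset ℕ, (⋂ n ∈ F, {x | n ∈ A x}) ∩ f ⁻¹' openHull d F := by
    ext x
    simp only [Set.mem_ofPred_eq, mem_iUnion, mem_inter_iff, mem_iInter, mem_preimage]
    rw [mem_openHull_iff]
    exact Iff.rfl
  rw [h]
  exact MeasurableSet.iUnion fun F =>
    (MeasurableSet.biInter F.countable_toSet fun n _ => hA n).inter
    (hf isOpen_interior.measurableSet)

end NextPrice

/-! ### One step of the construction of price systems -/

section Mixture

variable {X Y : Type*} [MeasurableSpace X] [MeasurableSpace Y]

/-- The midpoint of two probability measures. -/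
def midpointProb (P Q : ProbabilityMeasure Y) : ProbabilityMeasure Y :=
  ⟨(2⁻¹ : ℝ≥0∞) • (P : Measure Y) + (2⁻¹ : ℝ≥0∞) • (Q : Measure Y), ⟨by
    simp [ENNReal.inv_two_add_inv_two]⟩⟩

theorem coe_midpointProb (P Q : ProbabilityMeasure Y) : (midpointProb P Q : Measure Y) =
    (2⁻¹ : ℝ≥0∞) • (P : Measure Y) + (2⁻¹ : ℝ≥0∞) • (Q : Measure Y) := rfl

theorem ConvexProb.midpointProb_mem {𝒬 : Set (ProbabilityMeasure Y)} (h : ConvexProb 𝒬)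
    {P Q : ProbabilityMeasure Y} (hP : P ∈ 𝒬) (hQ : Q ∈ 𝒬) : midpointProb P Q ∈ 𝒬 :=
  h P hP Q hQ _ _ ENNReal.inv_two_add_inv_two _ rfl

theorem absolutelyContinuous_midpointProb_left (P Q : ProbabilityMeasure Y) :
    (P : Measure Y) ≪ midpointProb P Q := by
  refine Measure.AbsolutelyContinuous.mk fun s _ hs => ?_
  rw [coe_midpointProb] at hs
  simpa using (add_eq_zero.1 hs).1

theorem absolutelyContinuous_midpointProb_right (P Q : ProbabilityMeasure Y) :
    (Q : Measure Y) ≪ midpointProb P Q := by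
  refine Measure.AbsolutelyContinuous.mk fun s _ hs => ?_
  rw [coe_midpointProb] at hs
  simpa using (add_eq_zero.1 hs).2

theorem univMeasurable_midpointProb {κ κ' : X → ProbabilityMeasure Y}
    (h : UnivMeasurable fun x => (κ x : Measure Y))
    (h' : UnivMeasurable fun x => (κ' x : Measure Y)) :
    UnivMeasurable fun x => (midpointProb (κ x) (κ' x) : Measure Y) := by
  refine univMeasurable_kernel_of_apply fun s hs => ?_
  have : (fun x => (midpointProb (κ x) (κ' x) : Measure Y) s) =
      fun x => (2⁻¹ : ℝ≥0∞) * (κ x : Measure Y) s + 2⁻¹ * (κ' x : Measure Y) s := by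
    funext x
    rw [coe_midpointProb]
    rfl
  rw [this]
  exact Measurable.add (m := univComp X)
    (Measurable.const_mul (m := univComp X) (h.kernel_apply hs) _)
    (Measurable.const_mul (m := univComp X) (h'.kernel_apply hs) _)

/-- Finitely many selectors of convex sets of models are dominated by a single selector. -/
theorem exists_dominating_kernel {𝒬 : X → Set (ProbabilityMeasure Y)}
    (h𝒬 : ∀ x, ConvexProb (𝒬 x)) {κ₀ : X → ProbabilityMeasure Y}
    (hκ₀ : UnivMeasurable fun x => (κ₀ x : Measure Y)) (hκ₀𝒬 : ∀ x, κ₀ x ∈ 𝒬 x)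
    {p : ℕ → X → ProbabilityMeasure Y} (hp : ∀ m, UnivMeasurable fun x => (p m x : Measure Y))
    (hp𝒬 : ∀ m x, p m x ∈ 𝒬 x) (F : Finset ℕ) :
    ∃ κ : X → ProbabilityMeasure Y, UnivMeasurable (fun x => (κ x : Measure Y)) ∧
      ∀ x, κ x ∈ 𝒬 x ∧ (κ₀ x : Measure Y) ≪ κ x ∧ ∀ m ∈ F, (p m x : Measure Y) ≪ κ x := by
  classical
  induction F using Finset.induction_on with
  | empty => exact ⟨κ₀, hκ₀, fun x => ⟨hκ₀𝒬 x, .rfl, by simp⟩⟩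
  | insert m F _ ih =>
    obtain ⟨κ, hκ, h⟩ := ih
    refine ⟨fun x => midpointProb (κ x) (p m x), univMeasurable_midpointProb hκ (hp m),
      fun x => ⟨(h𝒬 x).midpointProb_mem (h x).1 (hp𝒬 m x),
        (h x).2.1.trans (absolutelyContinuous_midpointProb_left _ _), fun n hn => ?_⟩⟩
    rcases Finset.mem_insert.1 hn with rfl | hn
    · exact absolutelyContinuous_midpointProb_right _ _
    · exact ((h x).2.2 n hn).trans (absolutelyContinuous_midpointProb_left _ _)

end Mixture

section Step

variable {Ω₁ : Type*} [TopologicalSpace Ω₁] [MeasurableSpace Ω₁] [BorelSpace Ω₁]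
  {d : ℕ} {𝒬 : (t : ℕ) → (Fin t → Ω₁) → Set (ProbabilityMeasure Ω₁)}
  {K : (t : ℕ) → (Fin t → Ω₁) → Set (Fin d → ℝ)} {T k t : ℕ}

theorem IsMarket.priceSet_nonneg (hM : IsMarket 𝒬 K T) (ht : t ≤ T) {ω : Fin t → Ω₁}
    {z : Fin d → ℝ} (hz : z ∈ priceSet 𝒬 K k t ω) (i : Fin d) : 0 ≤ z i :=
  (hM.solvency t ht ω).dualCone_nonneg (interior_subset (priceSet_subset k t ω hz)) i

variable [PolishSpace Ω₁]

/-- A bounded universally measurable selector of the continuation prices. -/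
theorem IsMarket.exists_bounded_price (hM : IsMarket 𝒬 K T) (ht : t + k = T) :
    ∃ Y : (Fin t → Ω₁) → Fin d → ℝ, UnivMeasurable Y ∧ (∀ ω i, Y ω i ≤ 1) ∧
      ∀ ω, (priceSet 𝒬 K k t ω).Nonempty → Y ω ∈ priceSet 𝒬 K k t ω := by
  obtain ⟨F, hF, hFmem⟩ := exists_univMeasurable_index
    (fun n => {ω : Fin t → Ω₁ | densePt d n ∈ priceSet 𝒬 K k t ω})
    fun n => (hM.analyticSet_priceSet ht (densePt d n)).univMeasurableSet
  refine ⟨fun ω => (1 + ‖densePt d (F ω)‖)⁻¹ • densePt d (F ω),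
    UnivMeasurable.glue (f := fun n _ => (1 + ‖densePt d n‖)⁻¹ • densePt d n) hF
      fun n => measurable_const.univMeasurable, fun ω i => ?_, fun ω hne => ?_⟩
  · have hpos : 0 < 1 + ‖densePt d (F ω)‖ := by positivity
    change (1 + ‖densePt d (F ω)‖)⁻¹ * densePt d (F ω) i ≤ 1
    rw [inv_mul_le_one₀ hpos]
    linarith [(le_abs_self _).trans (norm_le_pi_norm (densePt d (F ω)) i)]
  · exact (isOpenCone_priceSet k t ω).smul_mem (by positivity)
      (hFmem ω (exists_densePt_mem (isOpenCone_priceSet k t ω).isOpen hne))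

/-- The conditional mean of a nonnegative vector. -/
def meanVec (κ : (Fin t → Ω₁) → ProbabilityMeasure Ω₁) (Y : (Fin (t + 1) → Ω₁) → Fin d → ℝ)
    (ω : Fin t → Ω₁) : Fin d → ℝ :=
  fun i => (∫⁻ y, ENNReal.ofReal (Y (snocFn ω y) i) ∂(κ ω : Measure Ω₁)).toReal

theorem univMeasurable_coord {X : Type*} [MeasurableSpace X] {Y : X → Fin d → ℝ}
    (hY : UnivMeasurable Y) (i : Fin d) : UnivMeasurable fun x => Y x i :=
  (measurable_pi_apply i).comp_univMeasurable hY

theorem univMeasurable_ofReal_coord {X : Type*} [MeasurableSpace X] {Y : X → Fin d → ℝ}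
    (hY : UnivMeasurable Y) (i : Fin d) : UnivMeasurable fun x => ENNReal.ofReal (Y x i) :=
  ENNReal.measurable_ofReal.comp_univMeasurable (univMeasurable_coord hY i)

theorem univMeasurable_meanVec {κ : (Fin t → Ω₁) → ProbabilityMeasure Ω₁}
    (hκ : UnivMeasurable fun ω => (κ ω : Measure Ω₁)) {Y : (Fin (t + 1) → Ω₁) → Fin d → ℝ}
    (hY : UnivMeasurable Y) : UnivMeasurable (meanVec κ Y) :=
  @measurable_pi_lambda _ _ _ (univComp _) _ _ fun i =>
    ENNReal.measurable_toReal.comp_univMeasurable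
      (hκ.lintegral_kernel measurable_snocFn (univMeasurable_ofReal_coord hY i))

/-- `Z'` is a successor of the price `Z` under the model `κ` at `ω`. -/
def IsSuccessor (𝒬 : (t : ℕ) → (Fin t → Ω₁) → Set (ProbabilityMeasure Ω₁))
    (K : (t : ℕ) → (Fin t → Ω₁) → Set (Fin d → ℝ)) (k : ℕ)
    (κ : (Fin t → Ω₁) → ProbabilityMeasure Ω₁) (Z : (Fin t → Ω₁) → Fin d → ℝ)
    (Z' : (Fin (t + 1) → Ω₁) → Fin d → ℝ) (ω : Fin t → Ω₁) : Prop :=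
  (∀ᵐ y ∂(κ ω : Measure Ω₁), Z' (snocFn ω y) ∈ priceSet 𝒬 K k (t + 1) (snocFn ω y)) ∧
    ∀ i, ∫⁻ y, ENNReal.ofReal (Z' (snocFn ω y) i) ∂(κ ω : Measure Ω₁) = ENNReal.ofReal (Z ω i)

theorem IsMarket.exists_successor_of_finset (hM : IsMarket 𝒬 K T) (ht : t + (k + 1) = T)
    {κ : (Fin t → Ω₁) → ProbabilityMeasure Ω₁} (hκ : UnivMeasurable fun ω => (κ ω : Measure Ω₁))
    {F : Finset ℕ} (hκF : ∀ ω, ∀ m ∈ F, m ∈ chargedSet 𝒬 K k t ω →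
      (κ ω : Measure Ω₁) {y | densePt d m ∈ priceSet 𝒬 K k (t + 1) (snocFn ω y)} ≠ 0)
    {Z : (Fin t → Ω₁) → Fin d → ℝ} (hZ : UnivMeasurable Z)
    {Y : (Fin (t + 1) → Ω₁) → Fin d → ℝ} (hY : UnivMeasurable Y) (hY1 : ∀ ω i, Y ω i ≤ 1)
    (hYmem : ∀ ω, (priceSet 𝒬 K k (t + 1) ω).Nonempty → Y ω ∈ priceSet 𝒬 K k (t + 1) ω)
    {ε : ℝ} (hε : 0 < ε) :
    ∃ Z' : (Fin (t + 1) → Ω₁) → Fin d → ℝ, UnivMeasurable Z' ∧ ∀ ω,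
      ↑F ⊆ chargedSet 𝒬 K k t ω → Z ω - ε • meanVec κ Y ω ∈ openHull d F →
      (∀ᵐ y ∂(κ ω : Measure Ω₁), (priceSet 𝒬 K k (t + 1) (snocFn ω y)).Nonempty) →
      IsSuccessor 𝒬 K k κ Z Z' ω := by
  classical
  obtain ⟨c, hc, hcF⟩ := exists_univMeasurable_coeff (d := d) F
  let A : ℕ → Set (Fin (t + 1) → Ω₁) := fun m => {ω | densePt d m ∈ priceSet 𝒬 K k (t + 1) ω}
  have hA : ∀ m, UnivMeasurableSet (A m) := fun m =>
    (hM.analyticSet_priceSet (by omega) (densePt d m)).univMeasurableSet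
  let z : (Fin t → Ω₁) → Fin d → ℝ := fun ω => Z ω - ε • meanVec κ Y ω
  have hz : UnivMeasurable z := Measurable.sub (m := univComp _) hZ
    (Measurable.const_smul (m := univComp _) (univMeasurable_meanVec hκ hY) ε)
  let a : ℕ → (Fin t → Ω₁) → ℝ := fun m ω =>
    c (z ω) m / ((κ ω : Measure Ω₁) {y | snocFn ω y ∈ A m}).toReal
  have ha : ∀ m, UnivMeasurable (a m) := fun m => Measurable.div (m := univComp _)
    ((measurable_pi_apply m).comp_univMeasurable (hc.comp hz))
    (ENNReal.measurable_toReal.comp_univMeasurable (hκ.kernel_section measurable_snocFn (hA m)))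
  let Z' : (Fin (t + 1) → Ω₁) → Fin d → ℝ := fun ω' => ε • Y ω' +
    ∑ m ∈ F, (A m).indicator (fun ω' => a m (proj (t + 1) t t.le_succ ω') • densePt d m) ω'
  refine ⟨Z', ?_, fun ω hF hzF hne => ⟨?_, fun i => ?_⟩⟩
  · refine Measurable.add (m := univComp _) (Measurable.const_smul (m := univComp _) hY ε) ?_
    refine @Finset.measurable_sum _ _ _ _ _ _ (univComp _) _ F fun m _ => ?_
    refine Measurable.indicator (m := univComp _) ?_ (hA m)
    exact Measurable.smul_const (m := univComp _)
      ((ha m).comp_measurable (measurable_proj _)) (densePt d m)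
  · filter_upwards [hne] with y hy
    have hS := isOpenCone_priceSet (𝒬 := 𝒬) (K := K) k (t + 1) (snocFn ω y)
    refine hS.add_sum_mem (hS.smul_mem hε (hYmem _ hy)) F fun m hm => ?_
    by_cases hmA : snocFn ω y ∈ A m
    · right
      refine ⟨a m ω, ?_, densePt d m, hmA, ?_⟩
      · exact div_nonneg ((hcF _ (interior_subset hzF)).1 m hm) ENNReal.toReal_nonneg
      · rw [indicator_of_mem hmA, proj_snocFn]
    · left
      rw [indicator_of_notMem hmA]
  · have hsec : ∀ m, NullMeasurableSet {y | snocFn ω y ∈ A m} (κ ω : Measure Ω₁) := fun m =>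
      (hA m).preimage_measurable (measurable_snocFn.comp measurable_prodMk_left) _ inferInstance
    have hq : ∀ m ∈ F, 0 ≤ densePt d m i := fun m hm => by
      obtain ⟨y, hy⟩ := nonempty_of_measure_ne_zero (hκF ω m hm (hF hm))
      exact hM.priceSet_nonneg (by omega) hy i
    have key := lintegral_ofReal_add_sum_indicator (κ ω : Measure Ω₁)
      (y₀ := fun y => Y (snocFn ω y) i)
      (UnivMeasurable.aemeasurable ((univMeasurable_coord hY i).comp_measurable
        (measurable_snocFn.comp measurable_prodMk_left)) _)
      (by
        filter_upwards [hne] with y hy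
        exact hM.priceSet_nonneg (by omega) (hYmem _ hy) i)
      (fun y => hY1 _ i) hε.le F hsec (hcF _ (interior_subset hzF)).1 hq
      (fun m hm => hκF ω m hm (hF hm))
    have hsum := congrFun (hcF _ (interior_subset hzF)).2 i
    have hl : ∀ y, Z' (snocFn ω y) i = ε * Y (snocFn ω y) i + ∑ m ∈ F,
        {y | snocFn ω y ∈ A m}.indicator (fun _ => c (z ω) m /
          ((κ ω : Measure Ω₁) {y | snocFn ω y ∈ A m}).toReal * densePt d m i) y := fun y => by
      simp only [Z', Pi.add_apply, Pi.smul_apply, smul_eq_mul, Finset.sum_apply]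
      congr 1
      refine Finset.sum_congr rfl fun m _ => ?_
      by_cases hmA : snocFn ω y ∈ A m
      · have hmA' : y ∈ {y | snocFn ω y ∈ A m} := hmA
        rw [indicator_of_mem hmA, indicator_of_mem hmA', proj_snocFn]
        rfl
      · have hmA' : y ∉ {y | snocFn ω y ∈ A m} := hmA
        rw [indicator_of_notMem hmA, indicator_of_notMem hmA']
        rfl
    simp only [hl]
    rw [key]
    congr 1
    simp only [Finset.sum_apply, Pi.smul_apply, smul_eq_mul, Pi.sub_apply] at hsum
    rw [hsum]
    change ε * meanVec κ Y ω i + _ = _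
    ring

theorem IsMarket.exists_charging_kernels [Nonempty Ω₁] (hM : IsMarket 𝒬 K T)
    (ht : t + (k + 1) = T) :
    ∃ p : ℕ → (Fin t → Ω₁) → ProbabilityMeasure Ω₁, ∀ m,
      UnivMeasurable (fun ω => (p m ω : Measure Ω₁)) ∧ ∀ ω, p m ω ∈ 𝒬 t ω ∧
        (m ∈ chargedSet 𝒬 K k t ω → (p m ω : Measure Ω₁)
          {y | densePt d m ∈ priceSet 𝒬 K k (t + 1) (snocFn ω y)} ≠ 0) := by
  classical
  have : ∀ m, ∃ p : (Fin t → Ω₁) → ProbabilityMeasure Ω₁,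
      UnivMeasurable (fun ω => (p ω : Measure Ω₁)) ∧ ∀ ω, p ω ∈ 𝒬 t ω ∧
        (m ∈ chargedSet 𝒬 K k t ω → (p ω : Measure Ω₁)
          {y | densePt d m ∈ priceSet 𝒬 K k (t + 1) (snocFn ω y)} ≠ 0) := by
    intro m
    obtain ⟨κ, hκ, hκ𝒬⟩ := hM.exists_kernel (by omega : t < T)
    obtain ⟨p, hp, h⟩ := (AnalyticSet.setOf_section_ne_zero (continuous_snocFn (Ω₁ := Ω₁) (t := t))
      (hM.graph t (by omega)) (hM.analyticSet_priceSet (k := k) (by omega)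
        (densePt d m))).exists_kernel_selection
    have hJ := hM.univMeasurableSet_mem_chargedSet ht m
    refine ⟨fun ω => if ω ∈ {ω | m ∈ chargedSet 𝒬 K k t ω} then p ω else κ ω, ?_, fun ω => ?_⟩
    · convert UnivMeasurable.ite' hJ hp hκ using 2 with ω
      by_cases hm : ω ∈ {ω | m ∈ chargedSet 𝒬 K k t ω}
      · simp only [if_pos hm]
      · simp only [if_neg hm]
    · by_cases hm : ω ∈ {ω | m ∈ chargedSet 𝒬 K k t ω}
      · simp only [if_pos hm]
        obtain ⟨P, hP, hPA⟩ := id hm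
        obtain ⟨h1, h2⟩ := h ω ⟨P, hP, hPA⟩
        exact ⟨h1, fun _ => h2⟩
      · simp only [if_neg hm]
        exact ⟨hκ𝒬 ω, fun h => absurd h hm⟩
  choose p hp using this
  exact ⟨p, hp⟩

/-- One step of the construction of a strictly consistent price system. -/
theorem IsMarket.exists_successor [Nonempty Ω₁] (hM : IsMarket 𝒬 K T) (ht : t + (k + 1) = T)
    {κ₀ : (Fin t → Ω₁) → ProbabilityMeasure Ω₁}
    (hκ₀ : UnivMeasurable fun ω => (κ₀ ω : Measure Ω₁)) (hκ₀𝒬 : ∀ ω, κ₀ ω ∈ 𝒬 t ω)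
    {Z : (Fin t → Ω₁) → Fin d → ℝ} (hZ : UnivMeasurable Z) :
    ∃ (κ : (Fin t → Ω₁) → ProbabilityMeasure Ω₁) (Z' : (Fin (t + 1) → Ω₁) → Fin d → ℝ),
      UnivMeasurable (fun ω => (κ ω : Measure Ω₁)) ∧ (∀ ω, κ ω ∈ 𝒬 t ω) ∧ UnivMeasurable Z' ∧
      (∀ ω, (κ₀ ω : Measure Ω₁) ≪ κ ω) ∧ ∀ ω, Z ω ∈ priceSet 𝒬 K (k + 1) t ω →
        (∀ᵐ y ∂(κ ω : Measure Ω₁), (priceSet 𝒬 K k (t + 1) (snocFn ω y)).Nonempty) →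
        IsSuccessor 𝒬 K k κ Z Z' ω := by
  obtain ⟨p, hp⟩ := hM.exists_charging_kernels (k := k) ht
  obtain ⟨Y, hY, hY1, hYmem⟩ := hM.exists_bounded_price (k := k) (t := t + 1) (by omega)
  have hκ := fun F => exists_dominating_kernel (hM.convex t (by omega)) hκ₀ hκ₀𝒬
    (fun m => (hp m).1) (fun m ω => ((hp m).2 ω).1) F
  choose κ hκm hκ𝒬 using hκ
  have hκF : ∀ (F : Finset ℕ) ω, ∀ m ∈ F, m ∈ chargedSet 𝒬 K k t ω → (κ F ω : Measure Ω₁)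
      {y | densePt d m ∈ priceSet 𝒬 K k (t + 1) (snocFn ω y)} ≠ 0 := fun F ω m hm hmJ h0 =>
    ((hp m).2 ω).2 hmJ ((hκ𝒬 F ω).2.2 m hm h0)
  have hZ' := fun i : Finset ℕ × ℕ => hM.exists_successor_of_finset ht (hκm i.1) (hκF i.1) hZ hY
    hY1 hYmem (ε := ((i.2 : ℝ) + 1)⁻¹) (by positivity)
  choose Z' hZ'm hZ' using hZ'
  let G : Finset ℕ × ℕ → Set (Fin t → Ω₁) := fun i => (⋂ m ∈ i.1, {ω | m ∈ chargedSet 𝒬 K k t ω}) ∩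
    (fun ω => Z ω - ((i.2 : ℝ) + 1)⁻¹ • meanVec (κ i.1) Y ω) ⁻¹' openHull d i.1
  have hm : ∀ i : Finset ℕ × ℕ,
      UnivMeasurable fun ω => Z ω - ((i.2 : ℝ) + 1)⁻¹ • meanVec (κ i.1) Y ω := fun i =>
    Measurable.sub (m := univComp _) hZ (Measurable.const_smul (m := univComp _)
      (univMeasurable_meanVec (hκm i.1) hY) (((i.2 : ℝ) + 1)⁻¹))
  have hopen : ∀ F : Finset ℕ, MeasurableSet (openHull d F) := fun F =>
    isOpen_interior.measurableSet
  have hG : ∀ i, UnivMeasurableSet (G i) := fun i => MeasurableSet.inter (m := univComp _)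
    (MeasurableSet.biInter (m := univComp _) i.1.countable_toSet fun m _ =>
      hM.univMeasurableSet_mem_chargedSet ht m) (hm i (hopen i.1))
  obtain ⟨I, hI, hImem⟩ := exists_univMeasurable_index G hG
  refine ⟨fun ω => κ (I ω).1 ω, fun ω' => Z' (I (proj (t + 1) t t.le_succ ω')) ω',
    UnivMeasurable.glue (f := fun i ω => (κ i.1 ω : Measure Ω₁)) hI fun i => hκm i.1,
    fun ω => (hκ𝒬 _ ω).1,
    UnivMeasurable.glue (F := fun ω' => I (proj (t + 1) t t.le_succ ω'))
      (fun i => (hI i).preimage_measurable (measurable_proj _)) hZ'm,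
    fun ω => (hκ𝒬 _ ω).2.1, fun ω hω hne => ?_⟩
  have hex : ∃ i, ω ∈ G i := by
    obtain ⟨F, hF, hZF⟩ := exists_finset_mem_openHull hω.2
    have hlim : Filter.Tendsto (fun n : ℕ => Z ω - ((n : ℝ) + 1)⁻¹ • meanVec (κ F) Y ω)
        Filter.atTop (nhds (Z ω)) := by
      have h1 : Filter.Tendsto (fun n : ℕ => ((n : ℝ) + 1)⁻¹) Filter.atTop (nhds 0) := by
        simpa using tendsto_one_div_add_atTop_nhds_zero_nat (𝕜 := ℝ)
      simpa using tendsto_const_nhds.sub (h1.smul_const (meanVec (κ F) Y ω))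
    obtain ⟨n, hn⟩ := (hlim.eventually (isOpen_interior.mem_nhds hZF)).exists
    refine ⟨(F, n), ?_, hn⟩
    simp only [mem_iInter]
    exact fun m hm => hF hm
  obtain ⟨h1, h2⟩ := hImem ω hex
  simp only [mem_iInter] at h1
  have := hZ' (I ω) ω (fun m hm => h1 m hm) h2 hne
  simpa only [IsSuccessor, proj_snocFn] using this

end Step

/-! ### Construction of price systems -/

section Martingale

variable {Ω₁ : Type*} [MeasurableSpace Ω₁] {P : KernelFamily Ω₁} {T t : ℕ}

/-- A nonnegative process on the finite product with constant one-step means. -/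
structure IsOneStepMartingale (P : KernelFamily Ω₁) (T : ℕ)
    (X : (t : ℕ) → (Fin t → Ω₁) → ℝ) : Prop where
  kernels : UnivKernels P T
  univMeasurable : ∀ t ≤ T, UnivMeasurable (X t)
  nonneg : ∀ t ≤ T, ∀ᵐ ω ∂prodProb P t, 0 ≤ X t ω
  step : ∀ t < T, ∀ᵐ ω ∂prodProb P t,
    ∫⁻ y, ENNReal.ofReal (X (t + 1) (snocFn ω y)) ∂(P t ω : Measure Ω₁) = ENNReal.ofReal (X t ω)

theorem IsOneStepMartingale.univMeasurable_ofReal {X : (t : ℕ) → (Fin t → Ω₁) → ℝ}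
    (hX : IsOneStepMartingale P T X) (ht : t ≤ T) :
    UnivMeasurable fun ω => ENNReal.ofReal (X t ω) :=
  ENNReal.measurable_ofReal.comp_univMeasurable (hX.univMeasurable t ht)

variable [MeasurableSpace.CountablyGenerated Ω₁]

theorem UnivKernels.lintegral_proj (h : UnivKernels P T) (ht : t ≤ T)
    {f : (Fin t → Ω₁) → ℝ≥0∞} (hf : UnivMeasurable f) :
    ∫⁻ ω, f (proj T t ht ω) ∂prodProb P T = ∫⁻ ω, f ω ∂prodProb P t := by
  have := (h.mono ht).isProbabilityMeasure
  have := h.isProbabilityMeasure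
  rw [← h.map_proj ht, lintegral_map' _ (measurable_proj ht).aemeasurable]
  rw [h.map_proj ht]
  exact hf.aemeasurable _

namespace IsOneStepMartingale

variable {X : (t : ℕ) → (Fin t → Ω₁) → ℝ}

theorem lintegral_ofReal_proj (hX : IsOneStepMartingale P T X) (ht : t ≤ T) :
    ∫⁻ ω, ENNReal.ofReal (X t (proj T t ht ω))
    ∂prodProb P T = ∫⁻ ω, ENNReal.ofReal (X t ω) ∂prodProb P t :=
  hX.kernels.lintegral_proj ht (hX.univMeasurable_ofReal ht)

theorem lintegral_indicator_succ (hX : IsOneStepMartingale P T X) (ht : t < T)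
    {B : Set (Fin t → Ω₁)} (hB : UnivMeasurableSet B) :
    ∫⁻ ω, (proj (t + 1) t t.le_succ ⁻¹' B).indicator (fun ω => ENNReal.ofReal (X (t + 1) ω)) ω
      ∂prodProb P (t + 1) =
      ∫⁻ ω, B.indicator (fun ω => ENNReal.ofReal (X t ω)) ω ∂prodProb P t := by
  rw [(hX.kernels.mono ht).lintegral_succ (Measurable.indicator (m := univComp _)
    (hX.univMeasurable_ofReal ht)
    (hB.preimage_measurable (measurable_proj _)))]
  refine lintegral_congr_ae ?_
  filter_upwards [hX.step t ht] with ω hω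
  by_cases h : ω ∈ B
  · rw [indicator_of_mem h, ← hω]
    refine lintegral_congr fun y => indicator_of_mem ?_ _
    rwa [mem_preimage, proj_snocFn]
  · rw [indicator_of_notMem h]
    refine (lintegral_congr fun y => indicator_of_notMem ?_ _).trans lintegral_zero
    rwa [mem_preimage, proj_snocFn]

theorem lintegral_lt_top (hX : IsOneStepMartingale P T X) (ht : t ≤ T) :
    ∫⁻ ω, ENNReal.ofReal (X t ω) ∂prodProb P t < ⊤ := by
  induction t with
  | zero =>
    refine (lintegral_congr fun ω => ?_ : _ = ∫⁻ _, ENNReal.ofReal (X 0 fun i => i.elim0)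
      ∂prodProb P 0).trans_lt ?_
    · rw [Subsingleton.elim ω fun i => i.elim0]
    · have := (hX.kernels.mono ht).isProbabilityMeasure
      simp
  | succ t ih =>
    have := hX.lintegral_indicator_succ ht (B := univ) MeasurableSet.univ.univMeasurableSet
    simp only [preimage_univ, indicator_univ] at this
    rw [this]
    exact ih (by omega)

theorem aemeasurable_proj (hX : IsOneStepMartingale P T X) (ht : t ≤ T) :
    AEMeasurable (fun ω => X t (proj T t ht ω)) (prodProb P T) := by
  have := hX.kernels.isProbabilityMeasure
  exact UnivMeasurable.aemeasurable
    ((hX.univMeasurable t ht).comp_measurable (measurable_proj ht)) _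

theorem integrable_proj (hX : IsOneStepMartingale P T X) (ht : t ≤ T) :
    Integrable (fun ω => X t (proj T t ht ω)) (prodProb P T) := by
  refine ⟨(hX.aemeasurable_proj ht).aestronglyMeasurable, ?_⟩
  rw [hasFiniteIntegral_iff_ofReal (hX.kernels.ae_proj ht (hX.nonneg t ht)),
    hX.lintegral_ofReal_proj ht]
  exact hX.lintegral_lt_top ht

theorem setIntegral_proj (hX : IsOneStepMartingale P T X) (ht : t ≤ T)
    {B : Set (Fin t → Ω₁)} (hB : UnivMeasurableSet B) :
    ∫ ω in proj T t ht ⁻¹' B, X t (proj T t ht ω) ∂prodProb P T =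
      (∫⁻ ω, B.indicator (fun ω => ENNReal.ofReal (X t ω)) ω ∂prodProb P t).toReal := by
  have := hX.kernels.isProbabilityMeasure
  rw [integral_eq_lintegral_of_nonneg_ae
    (ae_restrict_of_ae (hX.kernels.ae_proj ht (hX.nonneg t ht)))
    (hX.aemeasurable_proj ht).aestronglyMeasurable.restrict,
    ← lintegral_indicator₀ (hB.preimage_measurable (measurable_proj ht) _ inferInstance),
    ← hX.kernels.lintegral_proj ht (Measurable.indicator (m := univComp _)
      (hX.univMeasurable_ofReal ht) hB)]
  rfl

theorem setIntegral_succ (hX : IsOneStepMartingale P T X) (ht : t < T)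
    {s : Set (Fin T → Ω₁)} (hs : MeasurableSet[filt T t ht.le] s) :
    ∫ ω in s, X (t + 1) (proj T (t + 1) ht ω) ∂prodProb P T =
      ∫ ω in s, X t (proj T t ht.le ω) ∂prodProb P T := by
  obtain ⟨B, hB, rfl⟩ := hs
  rw [hX.setIntegral_proj ht.le hB, ← hX.lintegral_indicator_succ ht hB,
    ← hX.setIntegral_proj ht (UnivMeasurableSet.preimage_measurable hB (measurable_proj _))]
  rfl

end IsOneStepMartingale

end Martingale

section Construction

variable {Ω₁ : Type*} [TopologicalSpace Ω₁] [PolishSpace Ω₁] [MeasurableSpace Ω₁] [BorelSpace Ω₁]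
  {d : ℕ} {𝒬 : (t : ℕ) → (Fin t → Ω₁) → Set (ProbabilityMeasure Ω₁)}
  {K : (t : ℕ) → (Fin t → Ω₁) → Set (Fin d → ℝ)} {T k t : ℕ}

theorem IsMarket.univMeasurableSet_mem_priceSet (hM : IsMarket 𝒬 K T) (ht : t + k = T)
    {Z : (Fin t → Ω₁) → Fin d → ℝ} (hZ : UnivMeasurable Z) :
    UnivMeasurableSet {ω | Z ω ∈ priceSet 𝒬 K k t ω} := by
  have hA : ∀ n, UnivMeasurableSet {ω : Fin t → Ω₁ | densePt d n ∈ priceSet 𝒬 K k t ω} := fun n =>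
    (hM.analyticSet_priceSet ht (densePt d n)).univMeasurableSet
  have h : {ω | Z ω ∈ priceSet 𝒬 K k t ω} = (⋃ n, {ω | densePt d n ∈ priceSet 𝒬 K k t ω}) ∩
      {ω | Z ω ∈ openHull d {n | densePt d n ∈ priceSet 𝒬 K k t ω}} := by
    ext ω
    simp only [Set.mem_ofPred_eq, mem_inter_iff, mem_iUnion]
    have hS := isOpenCone_priceSet (𝒬 := 𝒬) (K := K) k t ω
    constructor
    · exact fun hz => ⟨exists_densePt_mem hS.isOpen ⟨_, hz⟩, (hS.mem_iff_mem_openHull ⟨_, hz⟩).1 hz⟩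
    · rintro ⟨⟨n, hn⟩, hz⟩
      exact (hS.mem_iff_mem_openHull ⟨_, hn⟩).2 hz
  rw [h]
  exact MeasurableSet.inter (m := univComp _) (MeasurableSet.iUnion (m := univComp _) hA)
    (univMeasurableSet_mem_openHull hA hZ)

/-- Under strict no-arbitrage and efficient friction, every model is dominated by one that
carries a price system. -/
theorem IsMarket.exists_priceSystem [Nonempty Ω₁] (hM : IsMarket 𝒬 K T)
    (hNA : StrictNoArbitrage 𝒬 K T) (hEF : EfficientFriction 𝒬 K T) {P : KernelFamily Ω₁}
    (hP : IsSelector 𝒬 P T) :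
    ∃ (P' : KernelFamily Ω₁) (Z : (t : ℕ) → (Fin t → Ω₁) → Fin d → ℝ), IsSelector 𝒬 P' T ∧
      prodProb P T ≪ prodProb P' T ∧ (∀ t, UnivMeasurable (Z t)) ∧
      (∀ t ≤ T, ∀ᵐ ω ∂prodProb P' t, Z t ω ∈ interior (dualCone (K t ω))) ∧
      ∀ i, IsOneStepMartingale P' T fun t ω => Z t ω i := by
  have hne : ∀ t ≤ T, QuasiSurely 𝒬 t fun ω => (priceSet 𝒬 K (T - t) t ω).Nonempty := fun t ht =>
    (hM.priceSet_nonempty_and_eq_zero hNA hEF (T - t) t (by omega)).1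
  have hstep : ∀ (t : ℕ) (Z : {Z : (Fin t → Ω₁) → Fin d → ℝ // UnivMeasurable Z}),
      ∃ (κ : (Fin t → Ω₁) → ProbabilityMeasure Ω₁)
        (Z' : {Z : (Fin (t + 1) → Ω₁) → Fin d → ℝ // UnivMeasurable Z}), t < T →
        (UnivMeasurable (fun ω => (κ ω : Measure Ω₁)) ∧ ∀ ω, κ ω ∈ 𝒬 t ω) ∧
        (∀ ω, (P t ω : Measure Ω₁) ≪ κ ω) ∧ ∀ ω, Z.1 ω ∈ priceSet 𝒬 K (T - t) t ω →
          (∀ᵐ y ∂(κ ω : Measure Ω₁),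
            (priceSet 𝒬 K (T - (t + 1)) (t + 1) (snocFn ω y)).Nonempty) →
          IsSuccessor 𝒬 K (T - (t + 1)) κ Z.1 Z'.1 ω := by
    intro t Z
    by_cases ht : t < T
    · obtain ⟨κ, Z', h1, h2, h3, h4, h5⟩ := hM.exists_successor (k := T - (t + 1)) (by omega)
        (hP t ht).1 (hP t ht).2 Z.2
      rw [show T - (t + 1) + 1 = T - t by omega] at h5
      exact ⟨κ, ⟨Z', h3⟩, fun _ => ⟨⟨h1, h2⟩, h4, h5⟩⟩
    · exact ⟨P t, ⟨fun _ => 0, measurable_const.univMeasurable⟩, fun h => absurd h ht⟩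
  choose κ Z' hκ using hstep
  have h0 := hne 0 T.zero_le _ (hP.mono T.zero_le).prodProb_mem
  have : IsProbabilityMeasure (prodProb P 0) := Measure.dirac.isProbabilityMeasure
  obtain ⟨ω₀, z₀, hz₀⟩ := h0.exists
  let Z : (t : ℕ) → {Z : (Fin t → Ω₁) → Fin d → ℝ // UnivMeasurable Z} := fun t =>
    Nat.rec ⟨fun _ => z₀, measurable_const.univMeasurable⟩ (fun t Z => Z' t Z) t
  let P' : KernelFamily Ω₁ := fun t => κ t (Z t)
  have hP' : IsSelector 𝒬 P' T := fun t ht => (hκ t (Z t) ht).1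
  have hmem : ∀ t ≤ T, ∀ᵐ ω ∂prodProb P' t, (Z t).1 ω ∈ priceSet 𝒬 K (T - t) t ω := by
    intro t
    induction t with
    | zero =>
      refine fun _ => Filter.Eventually.of_forall fun ω => ?_
      rw [Subsingleton.elim ω ω₀]
      exact hz₀
    | succ t ih =>
      intro ht
      refine ((hP'.mono ht).univKernels.ae_succ_iff
        (hM.univMeasurableSet_mem_priceSet (by omega) (Z (t + 1)).2)).2 ?_
      filter_upwards [ih (by omega), (hP'.mono ht).univKernels.ae_ae_of_ae_succ
        ((hne (t + 1) ht).ae_prodProb (hP'.mono ht))] with ω h1 h2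
      exact ((hκ t (Z t) ht).2.2 ω h1 h2).1
  have hint : ∀ t ≤ T, ∀ᵐ ω ∂prodProb P' t, (Z t).1 ω ∈ interior (dualCone (K t ω)) :=
    fun t ht => (hmem t ht).mono fun ω hω => priceSet_subset _ _ _ hω
  refine ⟨P', fun t => (Z t).1, hP', hP.univKernels.absolutelyContinuous hP'.univKernels
    fun t ht => (hκ t (Z t) ht).2.1, fun t => (Z t).2, hint, fun i => ⟨hP'.univKernels,
    fun t _ => univMeasurable_coord (Z t).2 i, fun t ht => ?_, fun t ht => ?_⟩⟩
  · filter_upwards [hmem t ht] with ω hω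
    exact hM.priceSet_nonneg ht hω i
  · filter_upwards [hmem t ht.le, (hP'.mono ht).univKernels.ae_ae_of_ae_succ
      ((hne (t + 1) ht).ae_prodProb (hP'.mono ht))] with ω h1 h2
    exact ((hκ t (Z t) ht).2.2 ω h1 h2).2 i

end Construction

/-! ### From price systems to the absence of arbitrage -/

section Martingale

variable {Ω : Type*} {m mΩ : MeasurableSpace Ω} {Q : Measure Ω} [IsProbabilityMeasure Q]

theorem aemeasurable_of_le_univComp (hm : m ≤ univComp Ω) {g : Ω → ℝ} (hg : Measurable[m] g) :
    AEMeasurable g Q :=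
  UnivMeasurable.aemeasurable (hg.mono hm le_rfl) Q

theorem integrable_mul_of_le_univComp (hm : m ≤ univComp Ω) {W : Ω → ℝ} (hW : Integrable W Q)
    {g : Ω → ℝ} (hg : Measurable[m] g) {c : ℝ} (hc : ∀ ω, ‖g ω‖ ≤ c) :
    Integrable (fun ω => W ω * g ω) Q :=
  hW.mul_bdd (aemeasurable_of_le_univComp hm hg).aestronglyMeasurable (.of_forall hc)

theorem integral_mul_eq_zero (hm : m ≤ univComp Ω) {W : Ω → ℝ} (hW : Integrable W Q)
    (h0 : ∀ s, MeasurableSet[m] s → ∫ ω in s, W ω ∂Q = 0) {g : Ω → ℝ} (hg : Measurable[m] g)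
    {c : ℝ} (hc : ∀ ω, ‖g ω‖ ≤ c) : ∫ ω, W ω * g ω ∂Q = 0 := by
  have hsimple : ∀ f : @SimpleFunc Ω m ℝ, ∫ ω, W ω * f ω ∂Q = 0 := by
    intro f
    induction f using SimpleFunc.induction with
    | const r hs =>
      rename_i s
      have h : (fun ω => W ω * (@SimpleFunc.piecewise Ω ℝ m s hs (@SimpleFunc.const Ω ℝ m r)
          (@SimpleFunc.const Ω ℝ m 0)) ω) = s.indicator fun ω => W ω * r := by
        funext ω
        by_cases hω : ω ∈ s <;> simp [hω]
      rw [h, integral_indicator₀ (hm _ hs Q inferInstance), integral_mul_const, h0 s hs, zero_mul]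
    | add _ hf hg =>
      rename_i f g _
      obtain ⟨a, ha⟩ := @SimpleFunc.exists_forall_norm_le _ _ m _ f
      obtain ⟨b, hb⟩ := @SimpleFunc.exists_forall_norm_le _ _ m _ g
      simp only [SimpleFunc.coe_add, Pi.add_apply, mul_add]
      rw [integral_add (integrable_mul_of_le_univComp hm hW (@SimpleFunc.measurable _ _ m _ f) ha)
        (integrable_mul_of_le_univComp hm hW (@SimpleFunc.measurable _ _ m _ g) hb),
        hf, hg, add_zero]
  have hgs : StronglyMeasurable[m] g := hg.stronglyMeasurable
  have := nonempty_of_isProbabilityMeasure Q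
  have hc0 : 0 ≤ c := (norm_nonneg _).trans (hc (Classical.arbitrary Ω))
  have hlim := tendsto_integral_of_dominated_convergence (μ := Q)
    (F := fun n ω => W ω * hgs.approxBounded c n ω) (f := fun ω => W ω * g ω)
    (fun ω => ‖W ω‖ * c)
    (fun n => (integrable_mul_of_le_univComp hm hW
      (@SimpleFunc.measurable _ _ m _ (hgs.approxBounded c n))
      (hgs.norm_approxBounded_le hc0 n)).aestronglyMeasurable)
    (hW.norm.mul_const c)
    (fun n => .of_forall fun ω => by
      rw [norm_mul]
      exact mul_le_mul_of_nonneg_left (hgs.norm_approxBounded_le hc0 n ω) (norm_nonneg _))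
    (.of_forall fun ω => (hgs.tendsto_approxBounded_of_norm_le (hc ω)).const_mul _)
  simp only [hsimple] at hlim
  exact tendsto_nhds_unique hlim tendsto_const_nhds

variable {d : ℕ} {Z Z' θ : Ω → Fin d → ℝ}

theorem setIntegral_dotProduct_eq (hm : m ≤ univComp Ω) (hZ : ∀ i, Integrable (fun ω => Z ω i) Q)
    (hZ' : ∀ i, Integrable (fun ω => Z' ω i) Q)
    (hZZ' : ∀ s, MeasurableSet[m] s → ∀ i, ∫ ω in s, Z' ω i ∂Q = ∫ ω in s, Z ω i ∂Q)
    (hθ : Measurable[m] θ) {s : Set Ω} (hs : MeasurableSet[m] s) {c : ℝ}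
    (hc : ∀ ω ∈ s, ‖θ ω‖ ≤ c) :
    IntegrableOn (fun ω => θ ω ⬝ᵥ Z ω) s Q ∧ IntegrableOn (fun ω => θ ω ⬝ᵥ Z' ω) s Q ∧
      ∫ ω in s, θ ω ⬝ᵥ Z' ω ∂Q = ∫ ω in s, θ ω ⬝ᵥ Z ω ∂Q := by
  have hs' : NullMeasurableSet s Q := hm _ hs Q inferInstance
  let g : Fin d → Ω → ℝ := fun i => s.indicator fun ω => θ ω i
  have hg : ∀ i, Measurable[m] (g i) := fun i =>
    Measurable.indicator ((measurable_pi_apply i).comp hθ) hs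
  have hgc : ∀ i ω, ‖g i ω‖ ≤ |c| := fun i ω => by
    by_cases hω : ω ∈ s
    · simp only [g, indicator_of_mem hω]
      exact (norm_le_pi_norm (θ ω) i).trans ((hc ω hω).trans (le_abs_self c))
    · simp [g, indicator_of_notMem hω]
  have hrw : ∀ Y : Ω → Fin d → ℝ, (s.indicator fun ω => θ ω ⬝ᵥ Y ω) =
      fun ω => ∑ i, Y ω i * g i ω := fun Y => by
    funext ω
    by_cases hω : ω ∈ s
    · simp [g, hω, dotProduct, mul_comm]
    · simp [g, hω]
  have hint : ∀ Y : Ω → Fin d → ℝ, (∀ i, Integrable (fun ω => Y ω i) Q) →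
      ∀ i, Integrable (fun ω => Y ω i * g i ω) Q := fun Y hY i =>
    integrable_mul_of_le_univComp hm (hY i) (hg i) (hgc i)
  have hon : ∀ Y : Ω → Fin d → ℝ, (∀ i, Integrable (fun ω => Y ω i) Q) →
      IntegrableOn (fun ω => θ ω ⬝ᵥ Y ω) s Q := fun Y hY => by
    have h := integrable_finsetSum Finset.univ fun i _ => hint Y hY i
    rw [← hrw] at h
    refine h.integrableOn.congr ?_
    filter_upwards [ae_restrict_mem₀ hs'] with ω hω using indicator_of_mem hω _
  refine ⟨hon Z hZ, hon Z' hZ', ?_⟩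
  rw [← integral_indicator₀ hs', ← integral_indicator₀ hs', hrw, hrw,
    integral_finsetSum _ fun i _ => hint Z hZ i, integral_finsetSum _ fun i _ => hint Z' hZ' i]
  refine Finset.sum_congr rfl fun i _ => ?_
  rw [← sub_eq_zero, ← integral_sub (hint Z' hZ' i) (hint Z hZ i)]
  simp only [← sub_mul]
  refine integral_mul_eq_zero hm ((hZ' i).sub (hZ i)) (fun s hs => ?_) (hg i) (hgc i)
  exact (integral_sub (hZ' i).integrableOn (hZ i).integrableOn).trans (sub_eq_zero.2 (hZZ' s hs i))

/-- A self-financed position with nonnegative value at the next date has nonnegative value. -/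
theorem ae_dotProduct_nonneg (hm : m ≤ univComp Ω) (hZ : ∀ i, Integrable (fun ω => Z ω i) Q)
    (hZ' : ∀ i, Integrable (fun ω => Z' ω i) Q)
    (hZZ' : ∀ s, MeasurableSet[m] s → ∀ i, ∫ ω in s, Z' ω i ∂Q = ∫ ω in s, Z ω i ∂Q)
    (hZm : Measurable[m] Z) (hθ : Measurable[m] θ) (h : ∀ᵐ ω ∂Q, 0 ≤ θ ω ⬝ᵥ Z' ω) :
    ∀ᵐ ω ∂Q, 0 ≤ θ ω ⬝ᵥ Z ω := by
  have hV : Measurable[m] fun ω => θ ω ⬝ᵥ Z ω := by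
    refine Finset.measurable_sum _ fun i _ => ?_
    exact ((measurable_pi_apply i).comp hθ).mul ((measurable_pi_apply i).comp hZm)
  have hN : Measurable[m] fun ω => ‖θ ω‖ := measurable_norm.comp hθ
  have key : ∀ n : ℕ, ∀ᵐ ω ∂Q, ‖θ ω‖ ≤ n → 0 ≤ θ ω ⬝ᵥ Z ω := by
    intro n
    let s : Set Ω := {ω | θ ω ⬝ᵥ Z ω < 0} ∩ {ω | ‖θ ω‖ ≤ n}
    have hs : MeasurableSet[m] s := (hV measurableSet_Iio).inter (hN measurableSet_Iic)
    have hs' : NullMeasurableSet s Q := hm _ hs Q inferInstance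
    obtain ⟨h1, h2, h3⟩ := setIntegral_dotProduct_eq hm hZ hZ' hZZ' hθ hs (c := n)
      fun ω hω => hω.2
    have hle : 0 ≤ ∫ ω in s, θ ω ⬝ᵥ Z ω ∂Q :=
      h3 ▸ integral_nonneg_of_ae (ae_restrict_of_ae h)
    have hpos : 0 ≤ᵐ[Q.restrict s] fun ω => -(θ ω ⬝ᵥ Z ω) := by
      filter_upwards [ae_restrict_mem₀ hs'] with ω hω
      exact neg_nonneg.2 (le_of_lt hω.1)
    have h0 : ∫ ω in s, -(θ ω ⬝ᵥ Z ω) ∂Q = 0 := by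
      refine le_antisymm ?_ (integral_nonneg_of_ae hpos)
      rw [integral_neg]
      linarith
    rw [integral_eq_zero_iff_of_nonneg_ae hpos h1.neg] at h0
    filter_upwards [(ae_restrict_iff'₀ hs').1 h0] with ω hω hn
    by_contra hlt
    have := hω ⟨not_le.1 hlt, hn⟩
    simp only [Pi.zero_apply, neg_eq_zero] at this
    exact hlt this.ge
  filter_upwards [ae_all_iff.2 key] with ω hω
  obtain ⟨n, hn⟩ := exists_nat_ge ‖θ ω‖
  exact hω n hn

/-- A position of value zero with nonnegative value at the next date has value zero there. -/
theorem ae_dotProduct_eq_zero (hm : m ≤ univComp Ω) (hZ : ∀ i, Integrable (fun ω => Z ω i) Q)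
    (hZ' : ∀ i, Integrable (fun ω => Z' ω i) Q)
    (hZZ' : ∀ s, MeasurableSet[m] s → ∀ i, ∫ ω in s, Z' ω i ∂Q = ∫ ω in s, Z ω i ∂Q)
    (hθ : Measurable[m] θ) (h : ∀ᵐ ω ∂Q, 0 ≤ θ ω ⬝ᵥ Z' ω) (h0 : ∀ᵐ ω ∂Q, θ ω ⬝ᵥ Z ω = 0) :
    ∀ᵐ ω ∂Q, θ ω ⬝ᵥ Z' ω = 0 := by
  have hN : Measurable[m] fun ω => ‖θ ω‖ := measurable_norm.comp hθ
  have key : ∀ n : ℕ, ∀ᵐ ω ∂Q, ‖θ ω‖ ≤ n → θ ω ⬝ᵥ Z' ω = 0 := by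
    intro n
    let s : Set Ω := {ω | ‖θ ω‖ ≤ n}
    have hs : MeasurableSet[m] s := hN measurableSet_Iic
    obtain ⟨h1, h2, h3⟩ := setIntegral_dotProduct_eq hm hZ hZ' hZZ' hθ hs (c := n) fun ω hω => hω
    rw [integral_eq_zero_of_ae (ae_restrict_of_ae h0),
      integral_eq_zero_iff_of_nonneg_ae (ae_restrict_of_ae h) h2] at h3
    exact (ae_restrict_iff'₀ (hm _ hs Q inferInstance)).1 h3
  filter_upwards [ae_all_iff.2 key] with ω hω
  obtain ⟨n, hn⟩ := exists_nat_ge ‖θ ω‖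
  exact hω n hn

end Martingale

section PriceSystem

variable {Ω₁ : Type*} [MeasurableSpace Ω₁] {d T : ℕ}

theorem filt_le {t : ℕ} (ht : t ≤ T) : filt (Ω₁ := Ω₁) T t ht ≤ univComp (Fin T → Ω₁) := by
  rintro _ ⟨B, hB, rfl⟩
  exact UnivMeasurableSet.preimage_measurable hB (measurable_proj ht)

theorem filt_mono {s t : ℕ} (hst : s ≤ t) (ht : t ≤ T) :
    filt (Ω₁ := Ω₁) T s (hst.trans ht) ≤ filt T t ht := by
  rintro _ ⟨B, hB, rfl⟩
  exact ⟨proj t s hst ⁻¹' B, UnivMeasurableSet.preimage_measurable hB (measurable_proj hst), rfl⟩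

theorem UnivMeasurable.measurable_filt {t : ℕ} (ht : t ≤ T) {g : (Fin t → Ω₁) → Fin d → ℝ}
    (hg : UnivMeasurable g) : Measurable[filt T t ht] fun ω => g (proj T t ht ω) :=
  fun _ hs => ⟨_, hg hs, rfl⟩

/-- `Z` is a `Q`-martingale with values in the interiors of the dual cones. -/
structure IsPriceSystem (K : (t : ℕ) → (Fin t → Ω₁) → Set (Fin d → ℝ))
    (Q : Measure (Fin T → Ω₁)) (Z : ℕ → (Fin T → Ω₁) → Fin d → ℝ) : Prop where
  adapted : ∀ t, ∀ ht : t ≤ T, Measurable[filt T t ht] (Z t) ∧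
    (∀ i, Integrable (fun ω => Z t ω i) Q) ∧
    ∀ᵐ ω ∂Q, Z t ω ∈ interior (dualCone (K t (proj T t ht ω)))
  step : ∀ t, ∀ ht : t < T, ∀ s : Set (Fin T → Ω₁), MeasurableSet[filt T t ht.le] s →
    ∀ i, (∫ ω in s, Z (t + 1) ω i ∂Q) = ∫ ω in s, Z t ω i ∂Q

variable {K : (t : ℕ) → (Fin t → Ω₁) → Set (Fin d → ℝ)} {Q : Measure (Fin T → Ω₁)}
  [IsProbabilityMeasure Q] {Z : ℕ → (Fin T → Ω₁) → Fin d → ℝ}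

theorem IsPriceSystem.ae_dotProduct_nonneg (h : IsPriceSystem K Q Z) {t : ℕ} (ht : t < T)
    {θ : (Fin T → Ω₁) → Fin d → ℝ} (hθ : Measurable[filt T t ht.le] θ)
    (hn : ∀ᵐ ω ∂Q, 0 ≤ θ ω ⬝ᵥ Z (t + 1) ω) : ∀ᵐ ω ∂Q, 0 ≤ θ ω ⬝ᵥ Z t ω :=
  _root_.ae_dotProduct_nonneg (filt_le ht.le) (h.adapted t ht.le).2.1 (h.adapted (t + 1) ht).2.1
    (h.step t ht) (h.adapted t ht.le).1 hθ hn

theorem IsPriceSystem.ae_dotProduct_eq_zero (h : IsPriceSystem K Q Z) {t : ℕ} (ht : t < T)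
    {θ : (Fin T → Ω₁) → Fin d → ℝ} (hθ : Measurable[filt T t ht.le] θ)
    (hn : ∀ᵐ ω ∂Q, 0 ≤ θ ω ⬝ᵥ Z (t + 1) ω) (h0 : ∀ᵐ ω ∂Q, θ ω ⬝ᵥ Z t ω = 0) :
    ∀ᵐ ω ∂Q, θ ω ⬝ᵥ Z (t + 1) ω = 0 :=
  _root_.ae_dotProduct_eq_zero (filt_le ht.le) (h.adapted t ht.le).2.1
    (h.adapted (t + 1) ht).2.1 (h.step t ht) hθ hn h0

/-- A price system excludes nontrivial attainable claims in the solvency cone. -/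
theorem IsPriceSystem.ae_eq_zero (h : IsPriceSystem K Q Z) {t : ℕ} (ht : t ≤ T)
    {f : (Fin t → Ω₁) → Fin d → ℝ} (hf : Attainable K t f)
    (hfK : ∀ᵐ ω ∂Q, f (proj T t ht ω) ∈ K t (proj T t ht ω)) :
    ∀ᵐ ω ∂Q, f (proj T t ht ω) = 0 := by
  obtain ⟨ξ, hξ, hfξ⟩ := hf
  let θ : ℕ → (Fin T → Ω₁) → Fin d → ℝ := fun s ω => ∑ r ∈ Finset.range s, ξ r (proj T t ht ω)
  have hξm : ∀ s, ∀ hs : s ≤ t,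
      Measurable[filt T s (hs.trans ht)] fun ω => ξ s (proj T t ht ω) := fun s hs => by
    obtain ⟨g, hg, -, hgξ⟩ := hξ s hs
    simp only [hgξ]
    exact hg.measurable_filt (hs.trans ht)
  have hθm : ∀ s, ∀ hs : s ≤ t, Measurable[filt T s (hs.trans ht)] (θ (s + 1)) := fun s hs =>
    @Finset.measurable_sum _ _ _ _ _ _ (filt T s (hs.trans ht)) _ _ fun r hr => by
      have hr : r ≤ s := Nat.lt_succ_iff.1 (Finset.mem_range.1 hr)
      exact (hξm r (hr.trans hs)).mono (filt_mono hr (hs.trans ht)) le_rfl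
  have hξn : ∀ s ≤ t, ∀ᵐ ω ∂Q, ξ s (proj T t ht ω) ⬝ᵥ Z s ω ≤ 0 := fun s hs => by
    obtain ⟨g, -, hgK, hgξ⟩ := hξ s hs
    filter_upwards [(h.adapted s (hs.trans ht)).2.2] with ω hω
    rw [hgξ]
    have := mem_dualCone.1 (interior_subset hω) _ (hgK (proj T s (hs.trans ht) ω))
    rw [neg_dotProduct] at this
    exact neg_nonneg.1 this
  have hθs : ∀ s ω, θ (s + 1) ω = θ s ω + ξ s (proj T t ht ω) := fun s ω =>
    Finset.sum_range_succ _ _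
  have hθf : ∀ ω, θ (t + 1) ω = f (proj T t ht ω) := fun ω => (hfξ _).symm
  have hV : ∀ k s, s + k = t → ∀ᵐ ω ∂Q, 0 ≤ θ (s + 1) ω ⬝ᵥ Z s ω := by
    intro k
    induction k with
    | zero =>
      rintro s rfl
      filter_upwards [hfK, (h.adapted (s + 0) ht).2.2] with ω h1 h2
      exact hθf ω ▸ mem_dualCone.1 (interior_subset h2) _ h1
    | succ k ih =>
      intro s hs
      refine h.ae_dotProduct_nonneg (by omega) (hθm s (by omega)) ?_
      filter_upwards [ih (s + 1) (by omega), hξn (s + 1) (by omega)] with ω h1 h2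
      rw [hθs (s + 1), add_dotProduct] at h1
      linarith
  have hV0 : ∀ s ≤ t, ∀ᵐ ω ∂Q, θ (s + 1) ω ⬝ᵥ Z s ω = 0 := by
    intro s
    induction s with
    | zero =>
      intro hs
      filter_upwards [hV t 0 (by omega), hξn 0 hs] with ω h1 h2
      refine le_antisymm ?_ h1
      rw [hθs, add_dotProduct]
      simpa [θ] using h2
    | succ s ih =>
      intro hs
      have hn : ∀ᵐ ω ∂Q, 0 ≤ θ (s + 1) ω ⬝ᵥ Z (s + 1) ω := by
        filter_upwards [hV (t - (s + 1)) (s + 1) (by omega), hξn (s + 1) hs] with ω h1 h2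
        rw [hθs (s + 1), add_dotProduct] at h1
        linarith
      filter_upwards [h.ae_dotProduct_eq_zero (by omega) (hθm s (by omega)) hn (ih (by omega)),
        hξn (s + 1) hs, hV (t - (s + 1)) (s + 1) (by omega)] with ω h1 h2 h3
      refine le_antisymm ?_ h3
      rw [hθs (s + 1), add_dotProduct, h1, zero_add]
      exact h2
  filter_upwards [hV0 t le_rfl, (h.adapted t ht).2.2, hfK] with ω h1 h2 h3
  rw [hθf] at h1
  exact eq_zero_of_dotProduct_interior_dualCone h2 h3 h1

end PriceSystem

section Necessity

variable {Ω₁ : Type*} [MeasurableSpace Ω₁] [MeasurableSpace.CountablyGenerated Ω₁] {T t : ℕ}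

theorem UnivKernels.ae_of_ae_proj {P : KernelFamily Ω₁} (h : UnivKernels P T) (ht : t ≤ T)
    {s : Set (Fin t → Ω₁)} (hs : UnivMeasurableSet s)
    (hp : ∀ᵐ ω ∂prodProb P T, proj T t ht ω ∈ s) : ∀ᵐ ω ∂prodProb P t, ω ∈ s := by
  have := h.isProbabilityMeasure
  have := Measure.isProbabilityMeasure_map (μ := prodProb P T) (measurable_proj ht).aemeasurable
  rw [← h.map_proj ht, ae_iff]
  exact (Measure.map_apply₀ (measurable_proj ht).aemeasurable
    (MeasurableSet.compl (m := univComp _) hs _ this)).trans hp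

end Necessity

section Equivalence

variable {Ω₁ : Type*} [TopologicalSpace Ω₁] [PolishSpace Ω₁] [MeasurableSpace Ω₁] [BorelSpace Ω₁]
  {d T : ℕ} {𝒬 : (t : ℕ) → (Fin t → Ω₁) → Set (ProbabilityMeasure Ω₁)}
  {K : (t : ℕ) → (Fin t → Ω₁) → Set (Fin d → ℝ)}

/-- Every model is dominated by a measure that carries a price system and is dominated by a
model. -/
def HasPriceSystems (𝒬 : (t : ℕ) → (Fin t → Ω₁) → Set (ProbabilityMeasure Ω₁))
    (K : (t : ℕ) → (Fin t → Ω₁) → Set (Fin d → ℝ)) (T : ℕ) : Prop :=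
  ∀ P ∈ ProdSet 𝒬 T, ∃ (Q : Measure (Fin T → Ω₁)) (Z : ℕ → (Fin T → Ω₁) → Fin d → ℝ),
    IsProbabilityMeasure Q ∧ IsPriceSystem K Q Z ∧ P ≪ Q ∧ ∃ P' ∈ ProdSet 𝒬 T, Q ≪ P'

theorem IsMarket.hasPriceSystems [Nonempty Ω₁] (hM : IsMarket 𝒬 K T)
    (hNA : StrictNoArbitrage 𝒬 K T) (hEF : EfficientFriction 𝒬 K T) : HasPriceSystems 𝒬 K T := by
  rintro _ ⟨P, hP, rfl⟩
  obtain ⟨P', Z, hP', hac, hZ, hmem, hmart⟩ := hM.exists_priceSystem hNA hEF hP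
  refine ⟨prodProb P' T, fun t ω => if ht : t ≤ T then Z t (proj T t ht ω) else 0,
    hP'.univKernels.isProbabilityMeasure, ⟨fun t ht => ?_, fun t ht s hs i => ?_⟩, hac, _,
    hP'.prodProb_mem, Measure.AbsolutelyContinuous.rfl⟩
  · simp only [dif_pos ht]
    exact ⟨(hZ t).measurable_filt ht, fun i => (hmart i).integrable_proj ht,
      hP'.univKernels.ae_proj ht (hmem t ht)⟩
  · simp only [dif_pos ht.le, dif_pos (Nat.succ_le_of_lt ht)]
    exact (hmart i).setIntegral_succ ht hs

theorem HasPriceSystems.efficientFriction [Nonempty Ω₁] (h : HasPriceSystems 𝒬 K T)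
    (hM : IsMarket 𝒬 K T) : EfficientFriction 𝒬 K T := by
  intro t ht
  refine forall_mem_prodSet.2 fun P hP => ?_
  obtain ⟨P₀, hP₀⟩ := exists_isSelector hM.nonempty hM.graph
  obtain ⟨P', hP', hPP'⟩ := hP.exists_extend hP₀
  obtain ⟨Q, Z, _, hZ, hac, -⟩ := h _ hP'.prodProb_mem
  rw [← hPP']
  refine hP'.univKernels.ae_of_ae_proj ht (hM.univMeasurableSet_nonempty_interior ht) ?_
  filter_upwards [hac.ae_le (hZ.adapted t ht).2.2] with ω hω using ⟨_, hω⟩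

theorem HasPriceSystems.strictNoArbitrage [Nonempty Ω₁] (h : HasPriceSystems 𝒬 K T)
    (hM : IsMarket 𝒬 K T) : StrictNoArbitrage 𝒬 K T := by
  intro t ht f hf hfm hfK
  refine forall_mem_prodSet.2 fun P hP => ?_
  obtain ⟨P₀, hP₀⟩ := exists_isSelector hM.nonempty hM.graph
  obtain ⟨P', hP', hPP'⟩ := hP.exists_extend hP₀
  obtain ⟨Q, Z, _, hZ, hac, _, ⟨R, hR, rfl⟩, hQR⟩ := h _ hP'.prodProb_mem
  have hfR : ∀ᵐ ω ∂Q, f (proj T t ht ω) ∈ K t (proj T t ht ω) :=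
    hQR.ae_le (UnivKernels.ae_proj (IsSelector.univKernels hR) ht
      (hfK _ (IsSelector.mono hR ht).prodProb_mem))
  have h0 : ∀ᵐ ω ∂prodProb P t, ω ∈ f ⁻¹' {0} := by
    rw [← hPP']
    exact hP'.univKernels.ae_of_ae_proj ht (hfm (measurableSet_singleton 0))
      (hac.ae_le (hZ.ae_eq_zero ht hf hfR))
  filter_upwards [h0] with ω hω
  have hω : f ω = 0 := hω
  rw [hω, mem_inter_iff, Set.mem_neg, neg_zero, and_self]
  exact (hM.solvency t ht ω).zero_mem

end Equivalence

theorem prodSet_eq_empty {Ω₁ : Type*} [MeasurableSpace Ω₁] [IsEmpty Ω₁]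
    {𝒬 : (t : ℕ) → (Fin t → Ω₁) → Set (ProbabilityMeasure Ω₁)} (T : ℕ) : ProdSet 𝒬 T = ∅ := by
  rw [Set.eq_empty_iff_forall_notMem]
  rintro _ ⟨P, -⟩
  exact IsEmpty.elim ‹_› (nonempty_of_isProbabilityMeasure (P 0 Fin.elim0 : Measure Ω₁)).some

/-- Theorem 5.5, multi-dimensional FTAP. `NAˢ(𝒫)` together with efficient
friction holds if and only if for every `P ∈ 𝒫` there is a strictly consistent price system:
a probability measure `Q` with `P ≪ Q ⋘ 𝒫` and a `Q`-martingale `Z` in the filtration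
`(𝓕ₜ)` with `Zₜ ∈ int K*ₜ` `Q`-a.s. for all `t`. -/
theorem FTAP_multidimensional {Ω₁ : Type*} [TopologicalSpace Ω₁] [PolishSpace Ω₁]
    [MeasurableSpace Ω₁] [BorelSpace Ω₁] (T d : ℕ)
    (𝒬 : (t : ℕ) → (Fin t → Ω₁) → Set (ProbabilityMeasure Ω₁))
    (h𝒬ne : ∀ t, t < T → ∀ ω, (𝒬 t ω).Nonempty)
    (h𝒬conv : ∀ t, t < T → ∀ ω, ConvexProb (𝒬 t ω))
    (h𝒬graph : ∀ t, t < T →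
      AnalyticSet {p : (Fin t → Ω₁) × ProbabilityMeasure Ω₁ | p.2 ∈ 𝒬 t p.1})
    (K : (t : ℕ) → (Fin t → Ω₁) → Set (Fin d → ℝ))
    (hKcl : ∀ t, t ≤ T → ∀ ω, IsClosed (K t ω))
    (hKconv : ∀ t, t ≤ T → ∀ ω, Convex ℝ (K t ω))
    (hKcone : ∀ t, t ≤ T → ∀ ω, ∀ c : ℝ, 0 ≤ c → ∀ x ∈ K t ω, c • x ∈ K t ω)
    (hKorth : ∀ t, t ≤ T → ∀ ω, {x : Fin d → ℝ | ∀ i, 0 ≤ x i} ⊆ K t ω)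
    (hKgraph : ∀ t, t ≤ T →
      AnalyticSet {p : (Fin t → Ω₁) × (Fin d → ℝ) | p.2 ∈ dualCone (K t p.1)}) :
    (StrictNoArbitrage 𝒬 K T ∧ EfficientFriction 𝒬 K T) ↔
      ∀ P ∈ ProdSet 𝒬 T, ∃ (Q : Measure (Fin T → Ω₁)) (Z : ℕ → (Fin T → Ω₁) → Fin d → ℝ),
        IsProbabilityMeasure Q ∧
        (∀ t, ∀ ht : t ≤ T, Measurable[filt T t ht] (Z t) ∧
          (∀ i, Integrable (fun ω => Z t ω i) Q) ∧
          ∀ᵐ ω ∂Q, Z t ω ∈ interior (dualCone (K t (proj T t ht ω)))) ∧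
        (∀ t, ∀ ht : t < T, ∀ s : Set (Fin T → Ω₁), MeasurableSet[filt T t ht.le] s →
          ∀ i, (∫ ω in s, Z (t + 1) ω i ∂Q) = ∫ ω in s, Z t ω i ∂Q) ∧
        P ≪ Q ∧ ∃ P' ∈ ProdSet 𝒬 T, Q ≪ P' := by
  have hM : IsMarket 𝒬 K T := ⟨h𝒬ne, h𝒬conv, h𝒬graph, fun t ht ω =>
    ⟨hKcl t ht ω, hKconv t ht ω, hKcone t ht ω, hKorth t ht ω⟩, hKgraph⟩
  refine Iff.trans ?_ (b := HasPriceSystems 𝒬 K T) ?_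
  · cases isEmpty_or_nonempty Ω₁
    · have h : ∀ t, ProdSet 𝒬 t = ∅ := prodSet_eq_empty
      simp [StrictNoArbitrage, EfficientFriction, HasPriceSystems, h]
    · exact ⟨fun h => hM.hasPriceSystems h.1 h.2, fun h =>
        ⟨h.strictNoArbitrage hM, h.efficientFriction hM⟩⟩
  · refine forall₂_congr fun P _ => exists₂_congr fun Q Z => ?_
    exact ⟨fun ⟨h, hZ, hac⟩ => ⟨h, hZ.adapted, hZ.step, hac⟩,
      fun ⟨h, ha, hs, hac⟩ => ⟨h, ⟨ha, hs⟩, hac⟩⟩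
end
end

section
/- Define K̃*_T := K*_T and, for t = T−1,…,0 and ω ∈ Ω_t, K̃*_t(ω) := K*_t(ω) ∩ cl(conv(Γ_t(ω))), where Γ_t(ω) := supp_{𝒫_t(ω)} K̃*_{t+1}(ω,·). Then for each t, the graph of K̃*_t is analytic. -/
open MeasureTheory Set
open scoped ENNReal

noncomputable section

/-- The support of a set-valued map under a family of probability measures: the smallest closed
set `F ⊆ ℝ^d` such that `P(C(·) ⊆ F) = 1` for every member `P` of the family. -/
def svSupport {α : Type*} [MeasurableSpace α] {d : ℕ} (𝒬 : Set (ProbabilityMeasure α))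
    (C : α → Set (Fin d → ℝ)) : Set (Fin d → ℝ) :=
  ⋂₀ {F : Set (Fin d → ℝ) | IsClosed F ∧ ∀ P ∈ 𝒬, (P : Measure α) {x | C x ⊆ F} = 1}

open Filter Topology

/-- A sequence in `ℕ → ℕ` which is eventually bounded in every coordinate has a convergent
subsequence. -/
theorem exists_tendsto_subseq_of_isBoundedUnder {x : ℕ → ℕ → ℕ}
    (hx : ∀ i, IsBoundedUnder (· ≤ ·) atTop fun k => x k i) :
    ∃ a, ∃ φ : ℕ → ℕ, StrictMono φ ∧ Tendsto (x ∘ φ) atTop (𝓝 a) := by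
  choose S hS using fun i => (hx i).bddAbove_range
  obtain ⟨a, -, φ, hφ, ha⟩ := (isCompact_Icc (a := (0 : ℕ → ℕ)) (b := S)).tendsto_subseq
    (x := x) fun k => ⟨fun i => Nat.zero_le _, fun i => hS i (mem_range_self k)⟩
  exact ⟨a, φ, hφ, ha⟩

/-- The set of points coded by sequences dominated by `s` depends on `s` in a closed way. -/
theorem isClosed_setOf_exists_le {X : Type*} [TopologicalSpace X] [T2Space X]
    [FirstCountableTopology X] {f : (ℕ → ℕ) → X} (hf : Continuous f) :
    IsClosed {p : (ℕ → ℕ) × X | ∃ x ≤ p.1, f x = p.2} := by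
  refine IsSeqClosed.isClosed fun p q hp hq => ?_
  choose x hxs hxf using hp
  have hs : Tendsto (fun k => (p k).1) atTop (𝓝 q.1) := (continuous_fst.tendsto q).comp hq
  have hy : Tendsto (fun k => (p k).2) atTop (𝓝 q.2) := (continuous_snd.tendsto q).comp hq
  obtain ⟨a, φ, hφ, ha⟩ := exists_tendsto_subseq_of_isBoundedUnder (x := x) fun i =>
    ((tendsto_pi_nhds.1 hs i).isBoundedUnder_le).mono_le (.of_forall fun k => hxs k i)
  refine ⟨a, le_of_tendsto_of_tendsto' ha (hs.comp hφ.tendsto_atTop) fun k => hxs _, ?_⟩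
  refine tendsto_nhds_unique ((hf.tendsto a).comp ha) ?_
  exact (hy.comp hφ.tendsto_atTop).congr fun k => (hxf _).symm

/-- The measure of the sections of a closed set is upper semicontinuous. -/
theorem isClosed_setOf_le_measure_section {W Y : Type*} [TopologicalSpace W]
    [FirstCountableTopology W] [TopologicalSpace Y] [MeasurableSpace Y] [OpensMeasurableSpace Y]
    [HasOuterApproxClosed Y] {μ : W → ProbabilityMeasure Y} (hμ : Continuous μ)
    {C : Set (W × Y)} (hC : IsClosed C) (r : ℝ≥0∞) :
    IsClosed {w | r ≤ (μ w : Measure Y) {y | (w, y) ∈ C}} := by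
  refine IsSeqClosed.isClosed fun w w₀ hw hw₀ => ?_
  let D : ℕ → Set Y := fun N => closure (⋃ n ≥ N, {y | (w n, y) ∈ C})
  have hD : Antitone D := fun M N hMN =>
    closure_mono (biUnion_subset_biUnion_left fun n hn => le_trans hMN hn)
  have hDr (N : ℕ) : r ≤ (μ w₀ : Measure Y) (D N) := by
    refine le_trans ?_ (ProbabilityMeasure.limsup_measure_closed_le_of_tendsto
      ((hμ.tendsto w₀).comp hw₀) (isClosed_closure : IsClosed (D N)))
    refine le_limsup_of_frequently_le (Eventually.frequently ?_)
    filter_upwards [eventually_ge_atTop N] with n hn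
    exact (hw n).trans (measure_mono fun y hy => subset_closure (mem_biUnion hn hy))
  have hDC : ⋂ N, D N ⊆ {y | (w₀, y) ∈ C} := by
    intro y hy
    refine hC.closure_subset (mem_closure_iff_nhds.2 fun U hU => ?_)
    obtain ⟨U₁, hU₁, U₂, hU₂, hUU⟩ := mem_nhds_prod_iff.1 hU
    obtain ⟨N, hN⟩ := eventually_atTop.1 (hw₀.eventually_mem hU₁)
    obtain ⟨z, hz, hzC⟩ := mem_closure_iff_nhds.1 (mem_iInter.1 hy N) U₂ hU₂
    obtain ⟨n, hn, hzn⟩ := mem_iUnion₂.1 hzC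
    exact ⟨(w n, z), hUU ⟨hN n hn, hz⟩, hzn⟩
  exact (ge_of_tendsto' (tendsto_measure_iInter_atTop
    (fun N => (isClosed_closure : IsClosed (D N)).nullMeasurableSet) hD
    ⟨0, measure_ne_top _ _⟩) hDr).trans (measure_mono hDC)

/-- Capacitability of sections of analytic sets: a section of positive outer measure contains a
set of positive measure coded by a set of dominated sequences. -/
theorem exists_measure_image_le_pos {V Y : Type*} [TopologicalSpace V] [T1Space V]
    [TopologicalSpace Y] [T2Space Y] [FirstCountableTopology Y]
    [MeasurableSpace Y] [OpensMeasurableSpace Y] (P : Measure Y) [IsFiniteMeasure P]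
    {f : (ℕ → ℕ) → V × Y} (hf : Continuous f) {v : V}
    (hv : 0 < P {y | (v, y) ∈ range f}) :
    ∃ s : ℕ → ℕ, 0 < P {y | ∃ x ≤ s, f x = (v, y)} := by
  obtain ⟨c, hc0, hc⟩ := exists_between hv
  let D : ℕ → (ℕ → ℕ) → Set Y := fun n s => {y | ∃ x, (∀ i < n, x i ≤ s i) ∧ f x = (v, y)}
  have step (n : ℕ) (s : ℕ → ℕ) (hs : c < P (D n s)) :
      ∃ m, c < P (D (n + 1) (Function.update s n m)) := by
    have hmono : Monotone fun m => D (n + 1) (Function.update s n m) := by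
      rintro m m' hm y ⟨x, hx, hxy⟩
      refine ⟨x, fun i hi => (hx i hi).trans ?_, hxy⟩
      exact update_le_update_iff.2 ⟨hm, fun _ _ => le_rfl⟩ i
    have hU : D n s ⊆ ⋃ m, D (n + 1) (Function.update s n m) := by
      rintro y ⟨x, hx, hxy⟩
      refine mem_iUnion.2 ⟨x n, x, fun i hi => ?_, hxy⟩
      rcases eq_or_ne i n with rfl | hin
      · simp
      · rw [Function.update_of_ne hin]
        exact hx i (by omega)
    have h := hs.trans_le (measure_mono hU)
    rw [hmono.measure_iUnion] at h
    exact lt_iSup_iff.1 h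
  let good : ℕ → Type := fun n => {s : ℕ → ℕ // c < P (D n s)}
  let S : (n : ℕ) → good n := fun n => Nat.rec
    ⟨0, by convert hc using 3; ext y; simp⟩
    (fun n s => ⟨Function.update s.1 n (step n s.1 s.2).choose, (step n s.1 s.2).choose_spec⟩) n
  have hS (n i : ℕ) (hi : i ≠ n) : (S (n + 1)).1 i = (S n).1 i := Function.update_of_ne hi _ _
  let s : ℕ → ℕ := fun i => (S (i + 1)).1 i
  have hSs (n i : ℕ) (hi : i < n) : (S n).1 i = s i := by
    induction n, Nat.succ_le_of_lt hi using Nat.le_induction with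
    | base => rfl
    | succ n hn ih => rw [hS n i (by omega), ih (by omega)]
  have hDs (n : ℕ) : c < P (D n s) := by
    have hDS : D n s = D n (S n).1 := by
      ext y
      refine exists_congr fun x => and_congr_left fun _ => forall₂_congr fun i hi => ?_
      rw [hSs n i hi]
    exact hDS ▸ (S n).2
  have hanti : Antitone fun n => closure (D n s) := fun m n hmn => closure_mono <| by
    rintro y ⟨x, hx, hxy⟩
    exact ⟨x, fun i hi => hx i (hi.trans_le hmn), hxy⟩
  refine ⟨s, hc0.trans_le ?_⟩
  refine (ge_of_tendsto' (tendsto_measure_iInter_atTop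
    (fun n => isClosed_closure.nullMeasurableSet) hanti ⟨0, measure_ne_top _ _⟩) fun n =>
      (hDs n).le.trans (measure_mono subset_closure)).trans (measure_mono fun y hy => ?_)
  obtain ⟨U, hU⟩ := (𝓝 y).exists_antitone_basis
  have hy' (n : ℕ) : ∃ x, (∀ i < n, x i ≤ s i) ∧ (f x).1 = v ∧ (f x).2 ∈ U n := by
    obtain ⟨z, hzU, x, hx, hxz⟩ :=
      mem_closure_iff_nhds.1 (mem_iInter.1 hy n) (U n) (hU.1.mem_of_mem trivial)
    exact ⟨x, hx, by rw [hxz], by rwa [hxz]⟩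
  choose x hxs hxv hxU using hy'
  have hxs' (i : ℕ) : ∀ᶠ k in atTop, x k i ≤ s i :=
    (eventually_gt_atTop i).mono fun k hk => hxs k i hk
  obtain ⟨a, φ, hφ, ha⟩ := exists_tendsto_subseq_of_isBoundedUnder (x := x) fun i =>
    ⟨s i, hxs' i⟩
  have hfa := (hf.tendsto a).comp ha
  refine ⟨a, fun i => le_of_tendsto (tendsto_pi_nhds.1 ha i)
    (hφ.tendsto_atTop.eventually (hxs' i)), Prod.ext ?_ ?_⟩
  · have h := (continuous_fst.tendsto _).comp hfa
    have hconst : (Prod.fst ∘ f ∘ x ∘ φ) = fun _ => v := funext fun k => hxv _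
    rw [hconst] at h
    exact (tendsto_const_nhds_iff.1 h).symm
  · exact tendsto_nhds_unique ((continuous_snd.tendsto _).comp hfa)
      ((hU.tendsto hxU).comp hφ.tendsto_atTop)

/-- An analytic set of positive outer measure contains a measurable set of positive measure. -/
theorem exists_measurableSet_subset_measure_pos {Y : Type*} [TopologicalSpace Y] [T2Space Y]
    [FirstCountableTopology Y] [MeasurableSpace Y] [OpensMeasurableSpace Y]
    (P : Measure Y) [IsFiniteMeasure P] {A : Set Y} (hA : AnalyticSet A) (hP : 0 < P A) :
    ∃ B ⊆ A, MeasurableSet B ∧ 0 < P B := by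
  rw [AnalyticSet] at hA
  rcases hA with rfl | ⟨f, hf, rfl⟩
  · simp at hP
  obtain ⟨s, hs⟩ := exists_measure_image_le_pos P (f := fun x => ((), f x)) (v := ())
    (by fun_prop) (by convert hP using 2; ext y; simp)
  refine ⟨_, ?_, IsClosed.measurableSet ?_, hs⟩
  · rintro y ⟨x, -, hx⟩
    exact ⟨x, congrArg Prod.snd hx⟩
  · have h := (isClosed_setOf_exists_le hf).preimage (Continuous.prodMk_right s)
    convert! h using 1
    ext y
    simp

namespace MeasureTheory.AnalyticSet

variable {α β : Type*} [TopologicalSpace α] [TopologicalSpace β]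

theorem inter [T2Space α] {s t : Set α} (hs : AnalyticSet s) (ht : AnalyticSet t) :
    AnalyticSet (s ∩ t) := by
  rw [inter_eq_iInter]
  exact .iInter (Bool.forall_bool.2 ⟨ht, hs⟩)

theorem setOf_exists {s : Set (α × β)} (hs : AnalyticSet s) :
    AnalyticSet {a | ∃ b, (a, b) ∈ s} := by
  convert! hs.image_of_continuous continuous_fst using 1
  ext a
  simp

/-- The parameters at which a section of an analytic set has positive measure form an analytic
set. -/
theorem setOf_measure_section_pos {V E Y : Type*} [TopologicalSpace V] [PolishSpace V]
    [TopologicalSpace E] [PolishSpace E] [TopologicalSpace Y] [PolishSpace Y]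
    [MeasurableSpace Y] [BorelSpace Y] {A : Set (V × Y)} (hA : AnalyticSet A)
    {μ : E → ProbabilityMeasure Y} (hμ : Continuous μ) :
    AnalyticSet {p : V × E | 0 < (μ p.2 : Measure Y) {y | (p.1, y) ∈ A}} := by
  rw [AnalyticSet] at hA
  rcases hA with rfl | ⟨f, hf, rfl⟩
  · simpa using analyticSet_empty
  have hclosed (m : ℕ) : IsClosed {q : (V × E) × (ℕ → ℕ) |
      ((m : ℝ≥0∞)⁻¹) ≤ (μ q.1.2 : Measure Y) {y | ∃ x ≤ q.2, f x = (q.1.1, y)}} := by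
    refine isClosed_setOf_le_measure_section (W := (V × E) × (ℕ → ℕ))
      (μ := fun q => μ q.1.2) (by fun_prop)
      (C := {p | ∃ x ≤ p.1.2, f x = (p.1.1.1, p.2)}) ?_ _
    exact (isClosed_setOf_exists_le hf).preimage
      (f := fun p : ((V × E) × (ℕ → ℕ)) × Y => (p.1.2, (p.1.1.1, p.2))) (by fun_prop)
  convert! AnalyticSet.iUnion fun m => (hclosed m).analyticSet.setOf_exists using 1
  ext ⟨v, e⟩
  simp only [mem_ofPred_eq, mem_iUnion]
  constructor
  · intro h
    obtain ⟨s, hs⟩ := exists_measure_image_le_pos _ hf h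
    obtain ⟨m, hm⟩ := ENNReal.exists_inv_nat_lt hs.ne'
    exact ⟨m, s, hm.le⟩
  · rintro ⟨m, s, h⟩
    refine (ENNReal.inv_pos.2 (ENNReal.natCast_ne_top m)).trans_le
      (h.trans (measure_mono ?_))
    rintro y ⟨x, -, hx⟩
    exact ⟨x, hx⟩

/-- The parameters at which a section of an analytic set has positive measure under some member of
an analytic family of probability measures form an analytic set. -/
theorem setOf_exists_measure_section_pos {V Z Y : Type*} [TopologicalSpace V] [PolishSpace V]
    [TopologicalSpace Z] [T2Space Z] [TopologicalSpace Y] [PolishSpace Y]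
    [MeasurableSpace Y] [BorelSpace Y] {A : Set (V × Y)} (hA : AnalyticSet A)
    {𝒬 : Z → Set (ProbabilityMeasure Y)}
    (h𝒬 : AnalyticSet {p : Z × ProbabilityMeasure Y | p.2 ∈ 𝒬 p.1})
    {π : V → Z} (hπ : Continuous π) :
    AnalyticSet {v | ∃ P ∈ 𝒬 (π v), 0 < (P : Measure Y) {y | (v, y) ∈ A}} := by
  obtain ⟨E, _, _, h, hh, hr⟩ := analyticSet_iff_exists_polishSpace_range.1 h𝒬
  have hcl : IsClosed {p : V × E | (h p.2).1 = π p.1} := isClosed_eq (by fun_prop) (by fun_prop)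
  convert! (hcl.analyticSet.inter (setOf_measure_section_pos hA
    (μ := fun e => (h e).2) (by fun_prop))).setOf_exists using 1
  ext v
  simp only [mem_ofPred_eq, mem_inter_iff]
  constructor
  · rintro ⟨P, hP, hpos⟩
    obtain ⟨e, he⟩ : (π v, P) ∈ range h := hr ▸ hP
    exact ⟨e, by simp [he], by simpa [he] using hpos⟩
  · rintro ⟨e, he, hpos⟩
    have hmem : h e ∈ {p : Z × ProbabilityMeasure Y | p.2 ∈ 𝒬 p.1} := hr ▸ mem_range_self e
    exact ⟨(h e).2, he ▸ hmem, hpos⟩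

/-- The fibrewise closure of an analytic set is analytic. -/
theorem setOf_mem_closure_section {E : Type*} [PseudoMetricSpace E] [PolishSpace E] [PolishSpace α]
    {Γ : α → Set E} (hΓ : AnalyticSet {p : α × E | p.2 ∈ Γ p.1}) :
    AnalyticSet {p : α × E | p.2 ∈ closure (Γ p.1)} := by
  have hn (n : ℕ) : AnalyticSet {p : α × E | ∃ z, z ∈ Γ p.1 ∧ dist p.2 z < 1 / (n + 1 : ℝ)} := by
    have h₁ := hΓ.preimage (f := fun q : (α × E) × E => (q.1.1, q.2)) (by fun_prop)
    have h₂ : IsOpen {q : (α × E) × E | dist q.1.2 q.2 < 1 / (n + 1 : ℝ)} :=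
      isOpen_lt (by fun_prop) (by fun_prop)
    have h₂' : AnalyticSet {q : (α × E) × E | dist q.1.2 q.2 < 1 / (n + 1 : ℝ)} := by
      simpa using h₂.analyticSet_image continuous_id
    exact (h₁.inter h₂').setOf_exists
  convert! AnalyticSet.iInter hn using 1
  ext ⟨a, y⟩
  simp only [mem_ofPred_eq, mem_iInter]
  rw [Metric.mem_closure_iff]
  constructor
  · exact fun h n => h _ Nat.one_div_pos_of_nat
  · intro h ε hε
    obtain ⟨n, hn⟩ := exists_nat_one_div_lt hε
    obtain ⟨z, hz, hd⟩ := h n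
    exact ⟨z, hz, hd.trans hn⟩

/-- The fibrewise convex hull of an analytic set is analytic. -/
theorem setOf_mem_convexHull_section {E : Type*} [AddCommGroup E] [Module ℝ E]
    [TopologicalSpace E] [IsTopologicalAddGroup E] [ContinuousSMul ℝ E] [PolishSpace E]
    [PolishSpace α] {Γ : α → Set E} (hΓ : AnalyticSet {p : α × E | p.2 ∈ Γ p.1}) :
    AnalyticSet {p : α × E | p.2 ∈ convexHull ℝ (Γ p.1)} := by
  have hn (n : ℕ) : AnalyticSet {p : α × E | ∃ q : (Fin n → ℝ) × (Fin n → E),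
      ((∀ i, 0 ≤ q.1 i) ∧ ∑ i, q.1 i = 1 ∧ ∑ i, q.1 i • q.2 i = p.2) ∧
        (∀ i, q.2 i ∈ Γ p.1) } := by
    have h₁ : IsClosed {r : (α × E) × ((Fin n → ℝ) × (Fin n → E)) |
        (∀ i, 0 ≤ r.2.1 i) ∧ ∑ i, r.2.1 i = 1 ∧ ∑ i, r.2.1 i • r.2.2 i = r.1.2} := by
      refine .and ?_ (.and ?_ ?_)
      · simp only [ofPred_forall]
        exact isClosed_iInter fun i => isClosed_le (by fun_prop) (by fun_prop)
      · exact isClosed_eq (by fun_prop) (by fun_prop)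
      · exact isClosed_eq (by fun_prop) (by fun_prop)
    have h₂ : AnalyticSet {r : (α × E) × ((Fin n → ℝ) × (Fin n → E)) |
        ∀ i, r.2.2 i ∈ Γ r.1.1} := by
      cases isEmpty_or_nonempty (Fin n) with
      | inl _ => simpa using isClosed_univ.analyticSet
      | inr _ =>
        simp only [ofPred_forall]
        exact .iInter fun i => hΓ.preimage
          (f := fun r : (α × E) × ((Fin n → ℝ) × (Fin n → E)) => (r.1.1, r.2.2 i)) (by fun_prop)
    exact (h₁.analyticSet.inter h₂).setOf_exists
  convert! AnalyticSet.iUnion hn using 1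
  ext ⟨a, y⟩
  simp only [mem_ofPred_eq, mem_iUnion]
  constructor
  · rw [mem_convexHull_iff_exists_fintype]
    rintro ⟨ι, _, w, z, hw₀, hw₁, hz, hy⟩
    let e := (Fintype.equivFin ι).symm
    exact ⟨Fintype.card ι, (w ∘ e, z ∘ e), ⟨fun i => hw₀ _, (e.sum_comp w).trans hw₁,
      (e.sum_comp fun i => w i • z i).trans hy⟩, fun i => hz _⟩
  · rintro ⟨n, ⟨w, z⟩, ⟨hw₀, hw₁, hy⟩, hz⟩
    exact mem_convexHull_of_exists_fintype w z hw₀ hw₁ hz hy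

end MeasureTheory.AnalyticSet

/-- A point belongs to the support of a set-valued map with analytic hitting sets iff each of its
neighbourhoods is hit with positive probability under some member of the family. -/
theorem mem_svSupport_iff {Y : Type*} [TopologicalSpace Y] [T2Space Y] [FirstCountableTopology Y]
    [MeasurableSpace Y] [OpensMeasurableSpace Y] {d : ℕ} {𝒬 : Set (ProbabilityMeasure Y)}
    {C : Y → Set (Fin d → ℝ)}
    (hC : ∀ y ε, AnalyticSet {x | (C x ∩ Metric.ball y ε).Nonempty}) (y : Fin d → ℝ) :
    y ∈ svSupport 𝒬 C ↔
      ∀ n : ℕ, ∃ P ∈ 𝒬, 0 < (P : Measure Y) {x | (C x ∩ Metric.ball y (1 / (n + 1))).Nonempty} := by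
  constructor
  · intro hy n
    by_contra! hn
    have hmem := hy (Metric.ball y (1 / (n + 1)))ᶜ ⟨Metric.isOpen_ball.isClosed_compl, fun P hP => by
      have h0 := le_antisymm (hn P hP) zero_le
      convert! prob_compl_eq_one_iff₀ (.of_null h0) |>.2 h0 using 2
      ext x
      simp [subset_compl_iff_disjoint_right, not_nonempty_iff_eq_empty, disjoint_iff_inter_eq_empty]⟩
    exact hmem (Metric.mem_ball_self Nat.one_div_pos_of_nat)
  · rintro h F ⟨hF, hF1⟩
    by_contra hyF
    obtain ⟨ε, hε, hεF⟩ := Metric.isOpen_iff.1 hF.isOpen_compl y hyF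
    obtain ⟨n, hn⟩ := exists_nat_one_div_lt hε
    obtain ⟨P, hP, hpos⟩ := h n
    obtain ⟨B, hBsub, hB, hBpos⟩ := exists_measurableSet_subset_measure_pos _ (hC _ _) hpos
    have hsub : {x | C x ⊆ F} ⊆ Bᶜ := by
      intro x hx hxB
      obtain ⟨z, hzC, hzb⟩ := hBsub hxB
      exact hεF (Metric.ball_subset_ball hn.le hzb) (hx hzC)
    have hone : (P : Measure Y) Bᶜ = 1 :=
      le_antisymm prob_le_one ((hF1 P hP).symm.le.trans (measure_mono hsub))
    exact hBpos.ne' ((prob_compl_eq_one_iff hB).1 hone)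

/-- The support of a set-valued map with analytic graph under an analytic family of probability
measures has an analytic graph. -/
theorem analyticSet_setOf_mem_svSupport {Z Y : Type*} [TopologicalSpace Z] [PolishSpace Z]
    [TopologicalSpace Y] [PolishSpace Y] [MeasurableSpace Y] [BorelSpace Y] {d : ℕ}
    {𝒬 : Z → Set (ProbabilityMeasure Y)}
    (h𝒬 : AnalyticSet {p : Z × ProbabilityMeasure Y | p.2 ∈ 𝒬 p.1})
    {C : Z → Y → Set (Fin d → ℝ)}
    (hC : AnalyticSet {p : (Z × Y) × (Fin d → ℝ) | p.2 ∈ C p.1.1 p.1.2}) :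
    AnalyticSet {p : Z × (Fin d → ℝ) | p.2 ∈ svSupport (𝒬 p.1) (C p.1)} := by
  have hA (ε : ℝ) : AnalyticSet {q : (Z × (Fin d → ℝ)) × Y |
      (C q.1.1 q.2 ∩ Metric.ball q.1.2 ε).Nonempty} := by
    have h₁ := hC.preimage
      (f := fun r : ((Z × (Fin d → ℝ)) × Y) × (Fin d → ℝ) => ((r.1.1.1, r.1.2), r.2)) (by fun_prop)
    have h₂ : IsOpen {r : ((Z × (Fin d → ℝ)) × Y) × (Fin d → ℝ) | dist r.2 r.1.1.2 < ε} :=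
      isOpen_lt (by fun_prop) (by fun_prop)
    have h₂' : AnalyticSet {r : ((Z × (Fin d → ℝ)) × Y) × (Fin d → ℝ) | dist r.2 r.1.1.2 < ε} := by
      simpa using h₂.analyticSet_image continuous_id
    exact (h₁.inter h₂').setOf_exists
  convert! AnalyticSet.iInter fun n : ℕ =>
    AnalyticSet.setOf_exists_measure_section_pos (hA (1 / (n + 1))) h𝒬 continuous_fst using 1
  ext ⟨ω, y⟩
  simp only [mem_ofPred_eq, mem_iInter]
  exact mem_svSupport_iff (C := C ω)
    (fun y ε => (hA ε).preimage (f := fun x => ((ω, y), x)) (by fun_prop)) y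

/-- Lemma 5.6. If `K̃*` is defined by the backward recursion
`K̃*_T = K*_T` and `K̃*_t(ω) = K*_t(ω) ∩ cl conv (supp_{𝒫_t(ω)} K̃*_{t+1}(ω, ·))`, then each
`K̃*_t` has an analytic graph. -/
theorem backward_recursion_cone_analytic {Ω₁ : Type*} [TopologicalSpace Ω₁] [PolishSpace Ω₁]
    [MeasurableSpace Ω₁] [BorelSpace Ω₁] (T d : ℕ)
    (𝒬 : (t : ℕ) → (Fin t → Ω₁) → Set (ProbabilityMeasure Ω₁))
    (h𝒬ne : ∀ t, t < T → ∀ ω, (𝒬 t ω).Nonempty)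
    (h𝒬conv : ∀ t, t < T → ∀ ω, ConvexProb (𝒬 t ω))
    (h𝒬graph : ∀ t, t < T →
      AnalyticSet {p : (Fin t → Ω₁) × ProbabilityMeasure Ω₁ | p.2 ∈ 𝒬 t p.1})
    (Kstar : (t : ℕ) → (Fin t → Ω₁) → Set (Fin d → ℝ))
    (hKcl : ∀ t, t ≤ T → ∀ ω, IsClosed (Kstar t ω))
    (hKconv : ∀ t, t ≤ T → ∀ ω, Convex ℝ (Kstar t ω))
    (hKcone : ∀ t, t ≤ T → ∀ ω, ∀ c : ℝ, 0 ≤ c → ∀ x ∈ Kstar t ω, c • x ∈ Kstar t ω)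
    (hKgraph : ∀ t, t ≤ T →
      AnalyticSet {p : (Fin t → Ω₁) × (Fin d → ℝ) | p.2 ∈ Kstar t p.1})
    (Ktilde : (t : ℕ) → (Fin t → Ω₁) → Set (Fin d → ℝ))
    (hT : Ktilde T = Kstar T)
    (hrec : ∀ t, t < T → ∀ ω, Ktilde t ω = Kstar t ω ∩
      closure (convexHull ℝ
        (svSupport (𝒬 t ω) (fun ω' => Ktilde (t + 1) (Fin.snoc ω ω'))))) :
    ∀ t, t ≤ T → AnalyticSet {p : (Fin t → Ω₁) × (Fin d → ℝ) | p.2 ∈ Ktilde t p.1} := by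
  intro t ht
  induction ht using Nat.decreasingInduction with
  | self => rw [hT]; exact hKgraph T le_rfl
  | @of_succ t ht ih =>
    have hC : AnalyticSet {p : ((Fin t → Ω₁) × Ω₁) × (Fin d → ℝ) |
        p.2 ∈ Ktilde (t + 1) (Fin.snoc p.1.1 p.1.2)} :=
      ih.preimage (f := fun p : ((Fin t → Ω₁) × Ω₁) × (Fin d → ℝ) =>
        ((Fin.snoc p.1.1 p.1.2 : Fin (t + 1) → Ω₁), p.2))
        ((Continuous.finSnoc (by fun_prop) (by fun_prop)).prodMk continuous_snd)
    have hΓ := analyticSet_setOf_mem_svSupport (h𝒬graph t ht)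
      (C := fun ω ω' => Ktilde (t + 1) (Fin.snoc ω ω')) hC
    have hconv := AnalyticSet.setOf_mem_convexHull_section (Γ := fun ω =>
      svSupport (𝒬 t ω) fun ω' => Ktilde (t + 1) (Fin.snoc ω ω')) hΓ
    have hcl := AnalyticSet.setOf_mem_closure_section (Γ := fun ω => convexHull ℝ
      (svSupport (𝒬 t ω) fun ω' => Ktilde (t + 1) (Fin.snoc ω ω'))) hconv
    convert! (hKgraph t ht.le).inter hcl using 1
    ext p
    simp [hrec t ht]
end
end
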